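/- arXiv:1009.3531 — 2 statements merged into one kernel-verified Lean document; each statement's English description precedes it below -/
import Mathlib

section
/- Let (R, 𝔪) be a commutative Noetherian local ring and M a generalized Cohen-Macaulay R-module of dimension d, and let n₀ be a positive integer such that 𝔪^{n₀}·H^i_𝔪(M) = 0 for all i < d. Then for every parameter ideal 𝔮 of M contained in 𝔪^{2n₀} and every positive integer k ≤ n₀, the length ℓ_R((𝔮M :_M 𝔪^k)/𝔮M) is independent of the choice of 𝔮 and equals ∑_{i=0}^{d} binom(d,i)·ℓ_R(0 :_{H^i_𝔪(M)} 𝔪^k). -/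
open CategoryTheory Limits

namespace LCAux
noncomputable section

section LD
universe v u v' u'
variable {C : Type u} [Category.{v} C] [Abelian C] [HasProjectiveResolutions C]
  {D : Type u'} [Category.{v'} D] [Abelian D]

/-- the complex computing the derived functors -/
abbrev hc (F : C ⥤ D) [F.Additive] (K : ChainComplex C ℕ) : ChainComplex D ℕ :=
  (F.mapHomologicalComplex (ComplexShape.down ℕ)).obj K

abbrev hcm (F : C ⥤ D) [F.Additive] {K L : ChainComplex C ℕ} (f : K ⟶ L) : hc F K ⟶ hc F L :=
  (F.mapHomologicalComplex (ComplexShape.down ℕ)).map f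

abbrev hct {F G : C ⥤ D} [F.Additive] [G.Additive] (α : F ⟶ G) (K : ChainComplex C ℕ) :
    hc F K ⟶ hc G K :=
  (NatTrans.mapHomologicalComplex α (ComplexShape.down ℕ)).app K

def ldi (F : C ⥤ D) [F.Additive] (n : ℕ) (X : C) :
    (F.leftDerived n).obj X ≅ (hc F (projectiveResolution X).complex).homology n :=
  (projectiveResolution X).isoLeftDerivedObj F n

lemma ldi_nat (F : C ⥤ D) [F.Additive] (n : ℕ) {X Y : C} (f : X ⟶ Y)
   (g : (projectiveResolution X).complex ⟶ (projectiveResolution Y).complex)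
   (hg : g.f 0 ≫ (projectiveResolution Y).π.f 0 = (projectiveResolution X).π.f 0 ≫ f) :
    (F.leftDerived n).map f ≫ (ldi F n Y).hom = (ldi F n X).hom ≫
      HomologicalComplex.homologyMap (hcm F g) n :=
  ProjectiveResolution.isoLeftDerivedObj_hom_naturality f _ _ g hg F n

lemma ldi_app {F G : C ⥤ D} [F.Additive] [G.Additive] (α : F ⟶ G) (n : ℕ) (X : C) :
    (NatTrans.leftDerived α n).app X = (ldi F n X).hom ≫
      HomologicalComplex.homologyMap (hct α (projectiveResolution X).complex) n ≫ (ldi G n X).inv :=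
  ProjectiveResolution.leftDerived_app_eq α (projectiveResolution X) n

lemma hct_comp {F G H : C ⥤ D} [F.Additive] [G.Additive] [H.Additive] (α : F ⟶ G) (β : G ⟶ H)
    (w : α ≫ β = 0) (K : ChainComplex C ℕ) : hct α K ≫ hct β K = 0 := by
  ext i
  exact NatTrans.congr_app w (K.X i)

/-- the short complex of complexes attached to a sequence of functors -/
abbrev ldSC {F₁ F₂ F₃ : C ⥤ D} [F₁.Additive] [F₂.Additive] [F₃.Additive]
    (α : F₁ ⟶ F₂) (β : F₂ ⟶ F₃) (w : α ≫ β = 0) (K : ChainComplex C ℕ) :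
    ShortComplex (ChainComplex D ℕ) :=
  ShortComplex.mk (hct α K) (hct β K) (hct_comp α β w K)

variable {F₁ F₂ F₃ : C ⥤ D} [F₁.Additive] [F₂.Additive] [F₃.Additive]
    {α : F₁ ⟶ F₂} {β : F₂ ⟶ F₃} {w : α ≫ β = 0}

variable (α β w) in
def PEx : Prop := ∀ (P : C) [Projective P], (ShortComplex.mk (α.app P) (β.app P)
  (NatTrans.congr_app w P)).ShortExact

lemma ldSC_se (h : PEx α β w) {X : C} (P : ProjectiveResolution X) :
    (ldSC α β w P.complex).ShortExact :=
  HomologicalComplex.shortExact_of_degreewise_shortExact _ (fun i => h (P.complex.X i))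

def hδ (h : PEx α β w) {X : C} (P : ProjectiveResolution X) (n : ℕ) :
    (hc F₃ P.complex).homology (n+1) ⟶ (hc F₁ P.complex).homology n :=
  (ldSC_se h P).δ (n+1) n (by simp)

lemma hδ_comp (h : PEx α β w) {X : C} (P : ProjectiveResolution X) (n : ℕ) :
    hδ h P n ≫ HomologicalComplex.homologyMap (hct α P.complex) n = 0 :=
  (ldSC_se h P).δ_comp (n+1) n (by simp)

lemma comp_hδ (h : PEx α β w) {X : C} (P : ProjectiveResolution X) (n : ℕ) :
    HomologicalComplex.homologyMap (hct β P.complex) (n+1) ≫ hδ h P n = 0 :=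
  (ldSC_se h P).comp_δ (n+1) n (by simp)

lemma hδ_ex₁ (h : PEx α β w) {X : C} (P : ProjectiveResolution X) (n : ℕ) :
    (ShortComplex.mk _ _ (hδ_comp h P n)).Exact :=
  (ldSC_se h P).homology_exact₁ (n+1) n (by simp)

lemma hδ_ex₃ (h : PEx α β w) {X : C} (P : ProjectiveResolution X) (n : ℕ) :
    (ShortComplex.mk _ _ (comp_hδ h P n)).Exact :=
  (ldSC_se h P).homology_exact₃ (n+1) n (by simp)

lemma h_zero (α : F₁ ⟶ F₂) (β : F₂ ⟶ F₃) (w : α ≫ β = 0) (K : ChainComplex C ℕ) (n : ℕ) :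
    HomologicalComplex.homologyMap (hct α K) n ≫ 
     HomologicalComplex.homologyMap (hct β K) n = 0 := by
  rw [← HomologicalComplex.homologyMap_comp, hct_comp α β w, HomologicalComplex.homologyMap_zero]

lemma hδ_ex₂ (h : PEx α β w) {X : C} (P : ProjectiveResolution X) (n : ℕ) :
    (ShortComplex.mk _ _ (h_zero α β w P.complex n)).Exact :=
  (ldSC_se h P).homology_exact₂ n

lemma hδ_nat (h : PEx α β w) {X Y : C} (P : ProjectiveResolution X) (Q : ProjectiveResolution Y)
    (g : P.complex ⟶ Q.complex) (n : ℕ) :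
    HomologicalComplex.homologyMap (hcm F₃ g) (n+1) ≫ hδ h Q n =
      hδ h P n ≫ HomologicalComplex.homologyMap (hcm F₁ g) n := by
  let φ : ldSC α β w P.complex ⟶ ldSC α β w Q.complex :=
      { τ₁ := hcm F₁ g
        τ₂ := hcm F₂ g
        τ₃ := hcm F₃ g
        comm₁₂ := ((NatTrans.mapHomologicalComplex α _).naturality g)
        comm₂₃ := ((NatTrans.mapHomologicalComplex β _).naturality g) }
  exact (HomologicalComplex.HomologySequence.δ_naturality φ
      (ldSC_se h P) (ldSC_se h Q) (n+1) n (by simp)).symm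

lemma hδ_nat' (h : PEx α β w) {G₁ G₂ G₃ : C ⥤ D} [G₁.Additive] [G₂.Additive] [G₃.Additive]
    {α' : G₁ ⟶ G₂} {β' : G₂ ⟶ G₃} {w' : α' ≫ β' = 0} (h' : PEx α' β' w')
    (t₁ : F₁ ⟶ G₁) (t₂ : F₂ ⟶ G₂) (t₃ : F₃ ⟶ G₃) (h₁ : t₁ ≫ α' = α ≫ t₂)
    (h₂ : t₂ ≫ β' = β ≫ t₃) {X : C} (P : ProjectiveResolution X) (n : ℕ) :
    hδ h P n ≫ HomologicalComplex.homologyMap (hct t₁ P.complex) n =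
      HomologicalComplex.homologyMap (hct t₃ P.complex) (n+1) ≫ hδ h' P n := by
  let φ : ldSC α β w P.complex ⟶ ldSC α' β' w' P.complex :=
      { τ₁ := hct t₁ _
        τ₂ := hct t₂ _
        τ₃ := hct t₃ _
        comm₁₂ := by
          ext i
          exact NatTrans.congr_app h₁ (P.complex.X i)
        comm₂₃ := by
          ext i
          exact NatTrans.congr_app h₂ (P.complex.X i) }
  exact (HomologicalComplex.HomologySequence.δ_naturality φ
      (ldSC_se h P) (ldSC_se h' P) (n+1) n (by simp))

def ldδ (h : PEx α β w) (n : ℕ) : F₃.leftDerived (n+1) ⟶ F₁.leftDerived n where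
  app X := (ldi F₃ (n+1) X).hom ≫ hδ h (projectiveResolution X) n ≫ (ldi F₁ n X).inv
  naturality {X Y} f := by
    let g := ProjectiveResolution.lift f (projectiveResolution X) (projectiveResolution Y)
    have hg : g.f 0 ≫ (projectiveResolution Y).π.f 0 = (projectiveResolution X).π.f 0 ≫ f :=
      ProjectiveResolution.lift_commutes_zero _ _ _
    rw [← cancel_mono (ldi F₁ n Y).hom]
    simp only [Category.assoc, Iso.inv_hom_id, Category.comp_id]
    rw [ldi_nat _ _ f g hg, reassoc_of% (ldi_nat F₃ (n+1) f g hg), hδ_nat, Iso.inv_hom_id_assoc]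

lemma ldδ_app (h : PEx α β w) (n : ℕ) (X : C) : (ldδ h n).app X =
  (ldi F₃ (n+1) X).hom ≫ hδ h (projectiveResolution X) n ≫ (ldi F₁ n X).inv := rfl

lemma ld_exact₂ (h : PEx α β w) (n : ℕ) (X : C) : ∃ w',
    (ShortComplex.mk ((NatTrans.leftDerived α n).app X) ((NatTrans.leftDerived β n).app X) w').Exact := by
  refine ⟨?_, ?_⟩
  · rw [ldi_app, ldi_app]
    simp only [Category.assoc, Iso.inv_hom_id_assoc]
    rw [reassoc_of% (h_zero α β w)]; simp
  · refine (ShortComplex.exact_iff_of_iso (ShortComplex.isoMk (ldi _ _ _) (ldi _ _ _) (ldi _ _ _) ?_ ?_)).2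
      (hδ_ex₂ h (projectiveResolution X) n)
    · simp [ldi_app]
    · simp [ldi_app]

lemma ld_exact₁ (h : PEx α β w) (n : ℕ) (X : C) : ∃ w',
    (ShortComplex.mk ((ldδ h n).app X) ((NatTrans.leftDerived α n).app X) w').Exact := by
  refine ⟨?_, ?_⟩
  · rw [ldi_app, ldδ_app]
    simp only [Category.assoc, Iso.inv_hom_id_assoc]
    rw [reassoc_of% (hδ_comp h)]; simp
  · refine (ShortComplex.exact_iff_of_iso (ShortComplex.isoMk (ldi _ _ _) (ldi _ _ _) (ldi _ _ _) ?_ ?_)).2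
      (hδ_ex₁ h (projectiveResolution X) n)
    · simp [ldδ_app]
    · simp [ldi_app]

lemma ld_exact₃ (h : PEx α β w) (n : ℕ) (X : C) : ∃ w',
    (ShortComplex.mk ((NatTrans.leftDerived β (n+1)).app X) ((ldδ h n).app X) w').Exact := by
  refine ⟨?_, ?_⟩
  · rw [ldi_app, ldδ_app]
    simp only [Category.assoc, Iso.inv_hom_id_assoc]
    rw [reassoc_of% (comp_hδ h)]; simp
  · refine (ShortComplex.exact_iff_of_iso (ShortComplex.isoMk (ldi _ _ _) (ldi _ _ _) (ldi _ _ _) ?_ ?_)).2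
      (hδ_ex₃ h (projectiveResolution X) n)
    · simp [ldi_app]
    · simp [ldδ_app]

lemma ldδ_nat (h : PEx α β w) {G₁ G₂ G₃ : C ⥤ D} [G₁.Additive] [G₂.Additive] [G₃.Additive]
    {α' : G₁ ⟶ G₂} {β' : G₂ ⟶ G₃} {w' : α' ≫ β' = 0} (h' : PEx α' β' w')
    (t₁ : F₁ ⟶ G₁) (t₂ : F₂ ⟶ G₂) (t₃ : F₃ ⟶ G₃) (h₁ : t₁ ≫ α' = α ≫ t₂)
    (h₂ : t₂ ≫ β' = β ≫ t₃) (n : ℕ) (X : C) :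
    (ldδ h n).app X ≫ (NatTrans.leftDerived t₁ n).app X =
      (NatTrans.leftDerived t₃ (n+1)).app X ≫ (ldδ h' n).app X := by
  rw [ldi_app, ldi_app, ldδ_app, ldδ_app]
  simp only [Category.assoc, Iso.inv_hom_id_assoc]
  rw [reassoc_of% (hδ_nat' h h' t₁ t₂ t₃ h₁ h₂)]

lemma ld_add (α β : F₁ ⟶ F₂) (n : ℕ) (X : C) : (NatTrans.leftDerived (α + β) n).app X =
    (NatTrans.leftDerived α n).app X + (NatTrans.leftDerived β n).app X := by
  rw [ldi_app, ldi_app, ldi_app]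
  have : hct (α + β) (projectiveResolution X).complex = 
    hct α (projectiveResolution X).complex + hct β (projectiveResolution X).complex := by
    ext i
    rfl
  rw [this, HomologicalComplex.homologyMap_add]
  simp

/-- a natural endomorphism of the identity acts the same way after deriving -/
lemma ld_endo (τ : 𝟭 D ⟶ 𝟭 D) (n : ℕ) (X : C) (α : F₁ ⟶ F₁) (hα : ∀ Z, α.app Z = τ.app (F₁.obj Z)) :
    (NatTrans.leftDerived α n).app X = τ.app ((F₁.leftDerived n).obj X) := by
  rw [ldi_app]
  let K := hc F₁ (projectiveResolution X).complex
  have nat {Y Z : D} (f : Y ⟶ Z) : f ≫ τ.app Z = τ.app Y ≫ f := τ.naturality f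
  have key : HomologicalComplex.homologyMap (hct α (projectiveResolution X).complex) n = τ.app (K.homology n) := by
    rw [← cancel_epi (HomologicalComplex.homologyπ _ _), HomologicalComplex.homologyπ_naturality]
    have h1 : HomologicalComplex.cyclesMap (hct α (projectiveResolution X).complex) n = τ.app (K.cycles n) := by
      rw [← cancel_mono (HomologicalComplex.iCycles _ _), HomologicalComplex.cyclesMap_i]
      have h2 : (hct α (projectiveResolution X).complex).f n = τ.app (K.X n) := hα _
      rw [h2]
      exact nat _
    rw [h1]
    exact (nat (K.homologyπ n)).symm
  rw [key]
  have n2 := nat (ldi F₁ n X).inv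
  rw [← Category.assoc, Iso.comp_inv_eq]
  exact nat _

/-- vanishing for functors that turn resolutions into exact complexes -/
lemma ld_zero (n : ℕ) (X : C) (h : ∀ (P : ProjectiveResolution X),
     ((F₁.mapHomologicalComplex (ComplexShape.down ℕ)).obj P.complex).ExactAt n) :
    IsZero ((F₁.leftDerived n).obj X) :=
  IsZero.of_iso ((h (projectiveResolution X)).isZero_homology) ((projectiveResolution X).isoLeftDerivedObj F₁ n)

end LD
end
end LCAux

open CategoryTheory Limits

namespace LCAux
noncomputable section

section LD0
universe v u v' u'
variable {C : Type u} [Category.{v} C] [Abelian C] [HasProjectiveResolutions C]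
  {D : Type u'} [Category.{v'} D] [Abelian D]
variable {F₁ F₂ : C ⥤ D} [F₁.Additive] [F₂.Additive]

lemma hct_pOp (α : F₁ ⟶ F₂) {X : C} (P : ProjectiveResolution X) :
    HomologicalComplex.opcyclesMap (hct α P.complex) 0 ≫ P.fromLeftDerivedZero' F₂ =
      P.fromLeftDerivedZero' F₁ ≫ α.app X := by
  rw [← cancel_epi (HomologicalComplex.pOpcycles _ _), HomologicalComplex.p_opcyclesMap_assoc,
    ProjectiveResolution.pOpcycles_comp_fromLeftDerivedZero']
  have := ProjectiveResolution.pOpcycles_comp_fromLeftDerivedZero'_assoc P F₁ (α.app X)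
  refine Eq.trans ?_ this.symm
  exact (α.naturality (P.π.f 0)).symm

lemma ld_zero_nat (α : F₁ ⟶ F₂) (X : C) :
    (NatTrans.leftDerived α 0).app X ≫ F₂.fromLeftDerivedZero.app X =
      F₁.fromLeftDerivedZero.app X ≫ α.app X := by
  have h1 : ∀ (F : C ⥤ D) [F.Additive], F.fromLeftDerivedZero.app X = (ldi F 0 X).hom ≫
      (hc F (projectiveResolution X).complex).homologyι 0 ≫
        (projectiveResolution X).fromLeftDerivedZero' F :=
    fun F _ => ProjectiveResolution.fromLeftDerivedZero_eq (projectiveResolution X) F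
  rw [ldi_app, h1, h1]
  simp only [Category.assoc, Iso.inv_hom_id_assoc, HomologicalComplex.homologyι_naturality_assoc]
  rw [hct_pOp]
end LD0

section EX
variable {R : Type} [CommRing R]

abbrev FY (Y : ModuleCat.{0} R) : ModuleCat.{0} R ⥤ (ModuleCat.{0} R)ᵒᵖ :=
  ((linearYoneda R (ModuleCat.{0} R)).obj Y).rightOp

abbrev tY {Y Z : ModuleCat.{0} R} (f : Y ⟶ Z) : FY Z ⟶ FY Y :=
  NatTrans.rightOp ((linearYoneda R (ModuleCat.{0} R)).map f)

abbrev EE (n : ℕ) (X Y : ModuleCat.{0} R) : ModuleCat.{0} R :=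
  ((Ext R (ModuleCat.{0} R) n).obj (.op X)).obj Y

lemma EE_eq (n : ℕ) (X Y : ModuleCat.{0} R) : EE n X Y = (((FY Y).leftDerived n).obj X).unop := rfl

lemma EE_map (n : ℕ) (X : ModuleCat.{0} R) {Y Z : ModuleCat.{0} R} (f : Y ⟶ Z) :
  ((Ext R (ModuleCat.{0} R) n).obj (.op X)).map f = ((NatTrans.leftDerived (tY f) n).app X).unop := rfl

lemma EE_map' (n : ℕ) {X X' : ModuleCat.{0} R} (g : X ⟶ X') (Y : ModuleCat.{0} R)  :
  ((Ext R (ModuleCat.{0} R) n).map g.op).app Y = (((FY Y).leftDerived n).map g).unop := rfl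

instance (Y : ModuleCat.{0} R) : PreservesFiniteLimits ((linearYoneda R (ModuleCat.{0} R)).obj Y) := by
  have : PreservesFiniteLimits ((linearYoneda R (ModuleCat.{0} R)).obj Y ⋙ forget (ModuleCat.{0} R)) :=
    inferInstanceAs (PreservesFiniteLimits (yoneda.obj Y))
  exact preservesFiniteLimits_of_reflects_of_preserves _ (forget (ModuleCat.{0} R))

instance (Y : ModuleCat.{0} R) : PreservesFiniteColimits (FY Y) :=
  preservesFiniteColimits_rightOp _

lemma tY_comp (S : ShortComplex (ModuleCat.{0} R)) : tY S.g ≫ tY S.f = 0 := by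
  have h : (linearYoneda R (ModuleCat.{0} R)).map S.f ≫ (linearYoneda R (ModuleCat.{0} R)).map S.g = 0 := by
    rw [← Functor.map_comp, S.zero]
    ext X (x : _ ⟶ _)
    exact Limits.comp_zero (C := ModuleCat.{0} R) (f := x)
  exact congrArg NatTrans.rightOp h

lemma tY_pex {S : ShortComplex (ModuleCat.{0} R)} (hS : S.ShortExact) :
    PEx (tY S.g) (tY S.f) (tY_comp S) := by
  intro P _
  have hm := hS.mono_f
  have he := hS.epi_g
  let T : ShortComplex (ModuleCat.{0} R) := ShortComplex.mk
    (((linearYoneda R (ModuleCat.{0} R)).map S.f).app (.op P))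
    (((linearYoneda R (ModuleCat.{0} R)).map S.g).app (.op P)) (by
      have := NatTrans.congr_app (tY_comp S) P
      exact congrArg Quiver.Hom.unop this)
  have hT : T.ShortExact := by
    refine ShortComplex.ShortExact.mk' ?_ ?_ ?_
    · rw [ShortComplex.moduleCat_exact_iff]
      intro (x : P ⟶ S.X₂) (hx : x ≫ S.g = 0)
      exact ⟨hS.exact.lift x hx, hS.exact.lift_f x hx⟩
    · rw [ModuleCat.mono_iff_injective]
      intro (x : P ⟶ S.X₁) (y : P ⟶ S.X₁) (hxy : x ≫ S.f = y ≫ S.f)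
      exact (cancel_mono _).1 hxy
    · rw [ModuleCat.epi_iff_surjective]
      intro (x : P ⟶ S.X₃)
      exact ⟨Projective.factorThru x S.g, Projective.factorThru_comp x S.g⟩
  exact hT.op

/-- connecting map on Ext -/
def Eδ {S : ShortComplex (ModuleCat.{0} R)} (hS : S.ShortExact) (n : ℕ) (X : ModuleCat.{0} R) :
    EE n X S.X₃ ⟶ EE (n+1) X S.X₁ := ((ldδ (tY_pex hS) n).app X).unop

lemma Eδ_nat {S : ShortComplex (ModuleCat.{0} R)} (hS : S.ShortExact) (n : ℕ) {X X' : ModuleCat.{0} R}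
    (g : X ⟶ X') : ((Ext R (ModuleCat.{0} R) n).map g.op).app S.X₃ ≫ Eδ hS n X =
      Eδ hS n X' ≫ ((Ext R (ModuleCat.{0} R) (n+1)).map g.op).app S.X₁ :=
  congrArg Quiver.Hom.unop ((ldδ (tY_pex hS) n).naturality g).symm

lemma Eδ_nat' {S T : ShortComplex (ModuleCat.{0} R)} (hS : S.ShortExact) (hT : T.ShortExact) (φ : S ⟶ T)
   (n : ℕ) (X : ModuleCat.{0} R) :
    Eδ hS n X ≫ ((Ext R (ModuleCat.{0} R) (n+1)).obj (.op X)).map φ.τ₁ =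
     ((Ext R (ModuleCat.{0} R) n).obj (.op X)).map φ.τ₃ ≫ Eδ hT n X := by
  have t (Y Z W : ModuleCat.{0} R) (f : Y ⟶ Z) (g : Z ⟶ W) : tY (f ≫ g) = tY g ≫ tY f := by
    have := (linearYoneda R (ModuleCat.{0} R)).map_comp f g
    exact congrArg NatTrans.rightOp this
  have := ldδ_nat (tY_pex hT) (tY_pex hS) (tY φ.τ₃) (tY φ.τ₂) (tY φ.τ₁)
    (by rw [← t, ← t, φ.comm₂₃]) (by rw [← t, ← t, φ.comm₁₂]) n X
  exact congrArg Quiver.Hom.unop this.symm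

lemma E_exact₂ {S : ShortComplex (ModuleCat.{0} R)} (hS : S.ShortExact) (n : ℕ) (X : ModuleCat.{0} R) :
    ∃ w', (ShortComplex.mk (((Ext R (ModuleCat.{0} R) n).obj (.op X)).map S.f)
       (((Ext R (ModuleCat.{0} R) n).obj (.op X)).map S.g) w').Exact := by
  obtain ⟨w, h⟩ := ld_exact₂ (tY_pex hS) n X
  exact ⟨congrArg Quiver.Hom.unop w, h.unop⟩

lemma E_exact₃ {S : ShortComplex (ModuleCat.{0} R)} (hS : S.ShortExact) (n : ℕ) (X : ModuleCat.{0} R) :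
    ∃ w', (ShortComplex.mk (((Ext R (ModuleCat.{0} R) n).obj (.op X)).map S.g) (Eδ hS n X) w').Exact := by
  obtain ⟨w, h⟩ := ld_exact₁ (tY_pex hS) n X
  exact ⟨congrArg Quiver.Hom.unop w, h.unop⟩

lemma E_exact₁ {S : ShortComplex (ModuleCat.{0} R)} (hS : S.ShortExact) (n : ℕ) (X : ModuleCat.{0} R) :
    ∃ w', (ShortComplex.mk (Eδ hS n X) (((Ext R (ModuleCat.{0} R) (n+1)).obj (.op X)).map S.f) w').Exact := by
  obtain ⟨w, h⟩ := ld_exact₃ (tY_pex hS) n X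
  exact ⟨congrArg Quiver.Hom.unop w, h.unop⟩

lemma E_add (n : ℕ) (X : ModuleCat.{0} R) {Y Z : ModuleCat.{0} R} (f g : Y ⟶ Z) :
    ((Ext R (ModuleCat.{0} R) n).obj (.op X)).map (f + g) =
    ((Ext R (ModuleCat.{0} R) n).obj (.op X)).map f + ((Ext R (ModuleCat.{0} R) n).obj (.op X)).map g := by
  have h : tY (f + g) = tY f + tY g := by
    have : (linearYoneda R (ModuleCat.{0} R)).map (f + g) = (linearYoneda R (ModuleCat.{0} R)).map f +
      (linearYoneda R (ModuleCat.{0} R)).map g := by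
      ext X (x : _ ⟶ _)
      exact Preadditive.comp_add (C := ModuleCat.{0} R) _ _ _ x f g
    exact congrArg NatTrans.rightOp this
  have h2 : NatTrans.leftDerived (tY (f+g)) n = NatTrans.leftDerived (tY f + tY g) n := by rw [h]
  have := ld_add (tY f) (tY g) n X
  rw [← h2] at this
  exact congrArg Quiver.Hom.unop this

/-- scalars as an endomorphism of the identity of the opposite category -/
def scal (r : R) : 𝟭 (ModuleCat.{0} R)ᵒᵖ ⟶ 𝟭 (ModuleCat.{0} R)ᵒᵖ where
  app X := (r • 𝟙 X.unop).op
  naturality X Y f := by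
    apply Quiver.Hom.unop_inj
    change (r • 𝟙 Y.unop) ≫ f.unop = f.unop ≫ (r • 𝟙 X.unop)
    simp

lemma E_smul (n : ℕ) (X : ModuleCat.{0} R) (Y : ModuleCat.{0} R) (r : R) :
    ((Ext R (ModuleCat.{0} R) n).obj (.op X)).map (r • 𝟙 Y) = r • 𝟙 (EE n X Y) := by
  have := ld_endo (F₁ := FY Y) (scal r) n X (tY (r • 𝟙 Y)) (by
    intro Z
    apply Quiver.Hom.unop_inj
    change ((linearYoneda R (ModuleCat.{0} R)).map (r • 𝟙 Y)).app (.op Z) = r • 𝟙 _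
    ext (x : _ ⟶ _)
    change x ≫ (r • 𝟙 Y) = r • x
    simp)
  exact congrArg Quiver.Hom.unop this

lemma E_inj (n : ℕ) (X Y : ModuleCat.{0} R) [Injective Y] : IsZero (EE (n+1) X Y) := by
  refine IsZero.unop (ld_zero (F₁ := FY Y) (n+1) X ?_)
  intro P
  have hP := P.complex_exactAt_succ n
  rw [HomologicalComplex.exactAt_iff' _ (n+1+1) (n+1) n (by simp) (by simp)] at hP ⊢
  have : ((P.complex.sc' (n+1+1) (n+1) n).map (FY Y)).unop.Exact := by
    rw [ShortComplex.moduleCat_exact_iff]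
    intro (x : P.complex.X (n+1) ⟶ Y) (hx : P.complex.d (n+1+1) (n+1) ≫ x = 0)
    exact ⟨hP.descToInjective x hx, hP.comp_descToInjective x hx⟩
  exact this.op

def E0 (X Y : ModuleCat.{0} R) : (X ⟶ Y) ≃ EE 0 X Y where
  toFun x := (((FY Y).fromLeftDerivedZero.app X).unop).hom x
  invFun := fun z => (((FY Y).leftDerivedZeroIsoSelf.inv.app X).unop).hom z
  left_inv x := by
    have := (FY Y).leftDerivedZeroIsoSelf_inv_hom_id_app X
    exact congrArg (fun f => f.unop.hom x) this
  right_inv x := by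
    have := (FY Y).leftDerivedZeroIsoSelf_hom_inv_id_app X
    exact congrArg (fun f => f.unop.hom x) this

lemma E0_add (X Y : ModuleCat.{0} R) (x y : X ⟶ Y) : E0 X Y (x + y) = E0 X Y x + E0 X Y y :=
  map_add ((((FY Y).fromLeftDerivedZero.app X).unop).hom) x y

lemma E0_smul (X Y : ModuleCat.{0} R) (r : R) (x : X ⟶ Y) : E0 X Y (r • x) = r • E0 X Y x :=
  map_smul ((((FY Y).fromLeftDerivedZero.app X).unop).hom) r x

lemma E0_nat (X : ModuleCat.{0} R) {Y Z : ModuleCat.{0} R} (f : Y ⟶ Z) (x : X ⟶ Y) :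
    (((Ext R (ModuleCat.{0} R) 0).obj (.op X)).map f).hom (E0 X Y x) = E0 X Z (x ≫ f) := by
  have := ld_zero_nat (tY f) X
  exact congrArg (fun f => f.unop.hom x) this

lemma E0_nat' {X X' : ModuleCat.{0} R} (g : X ⟶ X') (Y : ModuleCat.{0} R) (x : X' ⟶ Y) :
    (((Ext R (ModuleCat.{0} R) 0).map g.op).app Y).hom (E0 X' Y x) = E0 X Y (g ≫ x) := by
  have := (FY Y).fromLeftDerivedZero.naturality g
  exact congrArg (fun f => f.unop.hom x) this

end EX
end
end LCAux

open CategoryTheory Limits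

namespace LCAux
noncomputable section

section LC
variable {R : Type} [CommRing R] (J : Ideal R)

abbrev XX (t : ℕ) : ModuleCat.{0} R := ModuleCat.of R (R ⧸ J ^ t)

abbrev qq {s t : ℕ} (h : s ≤ t) : XX J t ⟶ XX J s :=
  (localCohomology.ringModIdeals (localCohomology.idealPowersDiagram J)).map (homOfLE h).op

abbrev dg (i : ℕ) := localCohomology.diagram (localCohomology.idealPowersDiagram J) i

def ιι (i t : ℕ) (Y : ModuleCat.{0} R) : EE i (XX J t) Y ⟶ (localCohomology J i).obj Y :=
  (colimit.ι (dg J i) (.op (.op t))).app Y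

abbrev em (i : ℕ) {s t : ℕ} (h : s ≤ t) (Y : ModuleCat.{0} R) : EE i (XX J s) Y ⟶ EE i (XX J t) Y :=
  ((Ext R (ModuleCat.{0} R) i).map (qq J h).op).app Y

lemma ιι_w (i : ℕ) {s t : ℕ} (h : s ≤ t) (Y : ModuleCat.{0} R) :
    em J i h Y ≫ ιι J i t Y = ιι J i s Y := 
  NatTrans.congr_app (colimit.w (dg J i) (homOfLE h).op.op) Y

lemma ιι_nat (i t : ℕ) {Y Z : ModuleCat.{0} R} (f : Y ⟶ Z) :
    ((Ext R (ModuleCat.{0} R) i).obj (.op (XX J t))).map f ≫ ιι J i t Z =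
      ιι J i t Y ≫ (localCohomology J i).map f :=
  (colimit.ι (dg J i) (.op (.op t))).naturality f

def ecc (i : ℕ) (Y : ModuleCat.{0} R) : Cocone (dg J i ⋙ (evaluation _ _).obj Y) :=
  ((evaluation _ _).obj Y).mapCocone (colimit.cocone (dg J i))

def eccc (i : ℕ) (Y : ModuleCat.{0} R) : IsColimit (ecc J i Y) :=
  isColimitOfPreserves ((evaluation _ _).obj Y) (colimit.isColimit (dg J i))

lemma ιι_surj (i : ℕ) (Y : ModuleCat.{0} R) (x : (localCohomology J i).obj Y) :
    ∃ t y, (ιι J i t Y).hom y = x := by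
  obtain ⟨j, y, hy⟩ := Concrete.isColimit_exists_rep _ (eccc J i Y) x
  exact ⟨j.unop.unop, y, hy⟩

lemma ιι_zero (i : ℕ) (Y : ModuleCat.{0} R) (s : ℕ) (x : EE i (XX J s) Y) (hx : (ιι J i s Y).hom x = 0) :
    ∃ t, ∃ h : s ≤ t, (em J i h Y).hom x = 0 := by
  have h0 : (ιι J i s Y).hom x = (ιι J i s Y).hom 0 := hx.trans (map_zero _).symm
  have h1 : (ecc J i Y).ι.app (.op (.op s)) x =
    (ecc J i Y).ι.app (.op (.op s)) (0 : EE i (XX J s) Y) := h0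
  obtain ⟨k, f, g, hk⟩ := Concrete.isColimit_exists_of_rep_eq (dg J i ⋙ (evaluation _ _).obj Y)
    (eccc J i Y) (i := .op (.op s)) (j := .op (.op s)) x (0 : EE i (XX J s) Y) h1
  refine ⟨k.unop.unop, leOfHom f.unop.unop, ?_⟩
  have h2 : (em J i (leOfHom f.unop.unop) Y).hom x = (em J i (leOfHom f.unop.unop) Y).hom 0 := hk
  rw [h2, map_zero]

def Hcδ {S : ShortComplex (ModuleCat.{0} R)} (hS : S.ShortExact) (i : ℕ) :
    (localCohomology J i).obj S.X₃ ⟶ (localCohomology J (i+1)).obj S.X₁ :=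
  (eccc J i S.X₃).desc (Cocone.mk _
    { app := fun j => Eδ hS i (XX J j.unop.unop) ≫ ιι J (i+1) j.unop.unop S.X₁
      naturality := fun j k f => by
        have h1 := Eδ_nat hS i (qq J (leOfHom f.unop.unop))
        have h2 := ιι_w J (i+1) (leOfHom f.unop.unop) S.X₁
        have h3 : em J i (leOfHom f.unop.unop) S.X₃ ≫ Eδ hS i (XX J k.unop.unop) ≫ ιι J (i+1) k.unop.unop S.X₁ =
          Eδ hS i (XX J j.unop.unop) ≫ ιι J (i+1) j.unop.unop S.X₁ := by
          rw [reassoc_of% h1, h2]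
        exact h3.trans (Category.comp_id _).symm })

lemma Hcδ_ι {S : ShortComplex (ModuleCat.{0} R)} (hS : S.ShortExact) (i t : ℕ) :
    ιι J i t S.X₃ ≫ Hcδ J hS i = Eδ hS i (XX J t) ≫ ιι J (i+1) t S.X₁ :=
  (eccc J i S.X₃).fac _ (.op (.op t))

variable {J}

lemma hc_exact {i j k : ℕ} {A B C : ModuleCat.{0} R}
  (f : (localCohomology J i).obj A →ₗ[R] (localCohomology J j).obj B)
  (g : (localCohomology J j).obj B →ₗ[R] (localCohomology J k).obj C)
  (f' : ∀ t, EE i (XX J t) A ⟶ EE j (XX J t) B)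
  (g' : ∀ t, EE j (XX J t) B ⟶ EE k (XX J t) C)
  (hf : ∀ t x, f ((ιι J i t A).hom x) = (ιι J j t B).hom ((f' t).hom x))
  (hg : ∀ t x, g ((ιι J j t B).hom x) = (ιι J k t C).hom ((g' t).hom x))
  (hem : ∀ s t (h : s ≤ t) x, (em J k h C).hom ((g' s).hom x) = (g' t).hom ((em J j h B).hom x))
  (he : ∀ t, ∃ w, (ShortComplex.mk (f' t) (g' t) w).Exact) : Function.Exact f g := by
  intro y
  constructor
  · intro hy
    obtain ⟨s, y, rfl⟩ := ιι_surj J _ _ y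
    rw [hg] at hy
    obtain ⟨t, hst, ht⟩ := ιι_zero J _ _ _ _ hy
    rw [hem] at ht
    obtain ⟨w, h⟩ := he t
    rw [ShortComplex.moduleCat_exact_iff] at h
    obtain ⟨x, hx⟩ := h _ ht
    refine ⟨(ιι J i t A).hom x, ?_⟩
    rw [hf]
    have : (f' t).hom x = (em J j hst B).hom y := hx
    rw [this]
    exact congrArg (fun z => z.hom y) (ιι_w J j hst B)
  · rintro ⟨x, rfl⟩
    obtain ⟨s, x, rfl⟩ := ιι_surj J _ _ x
    rw [hf, hg]
    obtain ⟨w, h⟩ := he s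
    have : (g' s).hom ((f' s).hom x) = 0 := congrArg (fun z => z.hom x) w
    rw [this, map_zero]

variable (J)
lemma map_ι (i t : ℕ) {Y Z : ModuleCat.{0} R} (f : Y ⟶ Z) (x) :
    ((localCohomology J i).map f).hom ((ιι J i t Y).hom x) = 
     (ιι J i t Z).hom ((((Ext R (ModuleCat.{0} R) i).obj (.op (XX J t))).map f).hom x) := 
  (congrArg (fun z => z.hom x) (ιι_nat J i t f)).symm

lemma δ_ι {S : ShortComplex (ModuleCat.{0} R)} (hS : S.ShortExact) (i t : ℕ) (x) :
    (Hcδ J hS i).hom ((ιι J i t S.X₃).hom x) = (ιι J (i+1) t S.X₁).hom ((Eδ hS i (XX J t)).hom x) :=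
  (congrArg (fun z => z.hom x) (Hcδ_ι J hS i t))

lemma em_map (i : ℕ) {Y Z : ModuleCat.{0} R} (f : Y ⟶ Z) (s t : ℕ) (h : s ≤ t) (x) :
   (em J i h Z).hom ((((Ext R (ModuleCat.{0} R) i).obj (.op (XX J s))).map f).hom x) =
    (((Ext R (ModuleCat.{0} R) i).obj (.op (XX J t))).map f).hom ((em J i h Y).hom x) :=
  (congrArg (fun z => z.hom x) (((Ext R (ModuleCat.{0} R) i).map (qq J h).op).naturality f))

lemma Hc_exact₂ {S : ShortComplex (ModuleCat.{0} R)} (hS : S.ShortExact) (i : ℕ) :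
    Function.Exact ((localCohomology J i).map S.f).hom ((localCohomology J i).map S.g).hom :=
  hc_exact _ _ _ _ (fun t x => map_ι J i t S.f x) (fun t x => map_ι J i t S.g x)
    (fun s t h x => em_map J i S.g s t h x) (fun t => E_exact₂ hS i _)

lemma Hc_exact₃ {S : ShortComplex (ModuleCat.{0} R)} (hS : S.ShortExact) (i : ℕ) :
    Function.Exact ((localCohomology J i).map S.g).hom (Hcδ J hS i).hom :=
  hc_exact _ _ _ _ (fun t x => map_ι J i t S.g x) (fun t x => δ_ι J hS i t x)
    (fun s t h x => (congrArg (fun z => z.hom x) (Eδ_nat hS i (qq J h))).symm) (fun t => E_exact₃ hS i _)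

lemma Hc_exact₁ {S : ShortComplex (ModuleCat.{0} R)} (hS : S.ShortExact) (i : ℕ) :
    Function.Exact (Hcδ J hS i).hom ((localCohomology J (i+1)).map S.f).hom :=
  hc_exact _ _ _ _ (fun t x => δ_ι J hS i t x) (fun t x => map_ι J (i+1) t S.f x)
    (fun s t h x => em_map J (i+1) S.f s t h x) (fun t => E_exact₁ hS i _)

lemma Hcδ_nat {S T : ShortComplex (ModuleCat.{0} R)} (hS : S.ShortExact) (hT : T.ShortExact) (φ : S ⟶ T)
   (i : ℕ) (x) :
    ((localCohomology J (i+1)).map φ.τ₁).hom ((Hcδ J hS i).hom x) =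
     (Hcδ J hT i).hom (((localCohomology J i).map φ.τ₃).hom x) := by
  obtain ⟨s, x, rfl⟩ := ιι_surj J _ _ x
  rw [δ_ι, map_ι, map_ι, δ_ι]
  exact congrArg _ (congrArg (fun z => z.hom x) (Eδ_nat' hS hT φ i (XX J s)))

lemma Hc_add (i : ℕ) {Y Z : ModuleCat.{0} R} (f g : Y ⟶ Z) (x) :
    ((localCohomology J i).map (f + g)).hom x =
    ((localCohomology J i).map f).hom x + ((localCohomology J i).map g).hom x := by
  obtain ⟨s, x, rfl⟩ := ιι_surj J _ _ x
  rw [map_ι, map_ι, map_ι, E_add, ← map_add]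
  rfl

lemma Hc_smul (i : ℕ) (Y : ModuleCat.{0} R) (r : R) (x) :
    ((localCohomology J i).map (r • 𝟙 Y)).hom x = r • x := by
  obtain ⟨s, x, rfl⟩ := ιι_surj J _ _ x
  rw [map_ι, E_smul, ← map_smul]
  rfl

lemma Hc_inj (i : ℕ) (Y : ModuleCat.{0} R) [Injective Y] (x : (localCohomology J (i+1)).obj Y) : x = 0 := by
  obtain ⟨s, x, rfl⟩ := ιι_surj J _ _ x
  have := ModuleCat.subsingleton_of_isZero (E_inj i (XX J s) Y)
  rw [Subsingleton.elim x 0, map_zero]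

/-! degree zero -/
lemma qq_one {s t : ℕ} (h : s ≤ t) : (qq J h).hom (Ideal.Quotient.mk _ 1) = Ideal.Quotient.mk _ 1 := rfl

lemma E0s_nat {X X' : ModuleCat.{0} R} (g : X ⟶ X') (Y : ModuleCat.{0} R) (z : EE 0 X' Y) :
    (E0 X Y).symm ((((Ext R (ModuleCat.{0} R) 0).map g.op).app Y).hom z) = g ≫ (E0 X' Y).symm z := by
  obtain ⟨z, rfl⟩ := (E0 X' Y).surjective z
  rw [E0_nat']; simp

lemma E0s_add (X Y : ModuleCat.{0} R) (z z' : EE 0 X Y) :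
    (E0 X Y).symm (z + z') = (E0 X Y).symm z + (E0 X Y).symm z' := by
  rw [Equiv.symm_apply_eq, E0_add, Equiv.apply_symm_apply, Equiv.apply_symm_apply]

lemma E0s_smul (X Y : ModuleCat.{0} R) (r : R) (z : EE 0 X Y) :
    (E0 X Y).symm (r • z) = r • (E0 X Y).symm z := by
  rw [Equiv.symm_apply_eq, E0_smul, Equiv.apply_symm_apply]

/-- evaluation at one -/
def ev1 (t : ℕ) (Y : ModuleCat.{0} R) : EE 0 (XX J t) Y ⟶ Y := ModuleCat.ofHom
  { toFun := fun z => ((E0 (XX J t) Y).symm z).hom (Ideal.Quotient.mk _ 1)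
    map_add' := fun z z' => congrArg (fun f => f.hom (Ideal.Quotient.mk _ 1)) (E0s_add (XX J t) Y z z')
    map_smul' := fun r z => congrArg (fun f => f.hom (Ideal.Quotient.mk _ 1)) (E0s_smul (XX J t) Y r z) }

lemma ev1_em {s t : ℕ} (h : s ≤ t) (Y : ModuleCat.{0} R) : em J 0 h Y ≫ ev1 J t Y = ev1 J s Y := by
  ext z
  change ((E0 (XX J t) Y).symm (((((Ext R (ModuleCat.{0} R) 0).map (qq J h).op).app Y)).hom z)).hom (Ideal.Quotient.mk _ 1) = 
    ((E0 (XX J s) Y).symm z).hom (Ideal.Quotient.mk _ 1)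
  rw [E0s_nat]; rfl

def eps (Y : ModuleCat.{0} R) : (localCohomology J 0).obj Y ⟶ Y :=
  (eccc J 0 Y).desc (Cocone.mk _
    { app := fun j => ev1 J j.unop.unop Y
      naturality := fun j k f => 
        (ev1_em J (leOfHom f.unop.unop) Y).trans (Category.comp_id _).symm })

lemma eps_ι' (Y : ModuleCat.{0} R) (t : ℕ) : ιι J 0 t Y ≫ eps J Y = ev1 J t Y :=
  (eccc J 0 Y).fac _ (.op (.op t))

lemma eps_ι (Y : ModuleCat.{0} R) (t : ℕ) (x) : (eps J Y).hom ((ιι J 0 t Y).hom x) = (ev1 J t Y).hom x :=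
  congrArg (fun z => z.hom x) (eps_ι' J Y t)

lemma ev1_E0 (t : ℕ) (Y : ModuleCat.{0} R) (z : XX J t ⟶ Y) : (ev1 J t Y).hom (E0 _ _ z) = z.hom (Ideal.Quotient.mk _ 1) := by
  change ((E0 (XX J t) Y).symm (E0 _ _ z)).hom _ = _
  rw [Equiv.symm_apply_apply]

lemma eps_nat {Y Z : ModuleCat.{0} R} (f : Y ⟶ Z) (x) :
    (eps J Z).hom (((localCohomology J 0).map f).hom x) = f.hom ((eps J Y).hom x) := by
  obtain ⟨s, x, rfl⟩ := ιι_surj J _ _ x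
  rw [map_ι, eps_ι, eps_ι]
  obtain ⟨z, rfl⟩ := (E0 (XX J s) Y).surjective x
  rw [E0_nat, ev1_E0, ev1_E0]; rfl

lemma eps_inj (Y : ModuleCat.{0} R) : Function.Injective (eps J Y).hom := by
  rw [injective_iff_map_eq_zero]
  intro x hx
  obtain ⟨s, x, rfl⟩ := ιι_surj J _ _ x
  rw [eps_ι] at hx
  obtain ⟨z, rfl⟩ := (E0 (XX J s) Y).surjective x
  rw [ev1_E0] at hx
  have : z = 0 := by
    apply ModuleCat.hom_ext
    apply LinearMap.ext
    intro r
    obtain ⟨r, rfl⟩ := Ideal.Quotient.mk_surjective r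
    have : (Ideal.Quotient.mk (J^s) r) = r • (Ideal.Quotient.mk (J^s) 1) := by
      rw [← Ideal.Quotient.mk_eq_mk, ← Ideal.Quotient.mk_eq_mk, ← Submodule.Quotient.mk_smul]; simp
    change z.hom (Ideal.Quotient.mk (J^s) r) = 0
    rw [this, map_smul]
    exact (congrArg (r • ·) hx).trans (smul_zero r)
  rw [this]
  have h0 := E0_smul (XX J s) Y 0 0
  rw [zero_smul, zero_smul] at h0
  rw [h0, map_zero]

lemma eps_range (Y : ModuleCat.{0} R) (y : Y) : (∃ x, (eps J Y).hom x = y) ↔ ∃ t, ∀ r ∈ J ^ t, r • y = 0 := by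
  constructor
  · rintro ⟨x, rfl⟩
    obtain ⟨s, x, rfl⟩ := ιι_surj J _ _ x
    refine ⟨s, fun r hr => ?_⟩
    rw [eps_ι]
    obtain ⟨z, rfl⟩ := (E0 (XX J s) Y).surjective x
    rw [ev1_E0, ← map_smul]
    have : r • (Ideal.Quotient.mk (J^s) 1) = 0 := by
      rw [← Ideal.Quotient.mk_eq_mk, ← Submodule.Quotient.mk_smul, Submodule.Quotient.mk_eq_zero]; simpa
    exact (congrArg z.hom this).trans (map_zero _)
  · rintro ⟨t, ht⟩
    let z : XX J t ⟶ Y := ModuleCat.ofHom (Submodule.liftQ (J^t) (LinearMap.toSpanSingleton R Y y) (by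
      intro r hr; exact ht r hr))
    refine ⟨(ιι J 0 t Y).hom (E0 _ _ z), ?_⟩
    rw [eps_ι, ev1_E0]
    change (Submodule.liftQ (J^t) (LinearMap.toSpanSingleton R Y y) _) (Submodule.Quotient.mk 1) = y
    exact (Submodule.liftQ_apply _ _ _).trans (one_smul R y)
end LC

end
end LCAux

open CategoryTheory Limits

namespace LCAux
noncomputable section

section HHs
variable {R : Type} [CommRing R] (J : Ideal R)

def HH (i : ℕ) (M : Type) [AddCommGroup M] [Module R M] : Type :=
  (localCohomology J i).obj (ModuleCat.of R M)

variable {A B C : Type} [AddCommGroup A] [Module R A] [AddCommGroup B] [Module R B]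
  [AddCommGroup C] [Module R C]

instance (i : ℕ) : AddCommGroup (HH J i A) :=
  inferInstanceAs (AddCommGroup ((localCohomology J i).obj (ModuleCat.of R A)))

instance (i : ℕ) : Module R (HH J i A) :=
  inferInstanceAs (Module R ((localCohomology J i).obj (ModuleCat.of R A)))

def Hm (i : ℕ) (f : A →ₗ[R] B) : HH J i A →ₗ[R] HH J i B :=
  ((localCohomology J i).map (ModuleCat.ofHom f)).hom

lemma Hm_id (i : ℕ) (x : HH J i A) : Hm J i LinearMap.id x = x :=
  congrArg (fun f => f.hom x) ((localCohomology J i).map_id (ModuleCat.of R A))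

lemma Hm_comp (i : ℕ) (g : B →ₗ[R] C) (f : A →ₗ[R] B) (x : HH J i A) :
    Hm J i (g ∘ₗ f) x = Hm J i g (Hm J i f x) :=
  congrArg (fun f => f.hom x) ((localCohomology J i).map_comp (ModuleCat.ofHom f) (ModuleCat.ofHom g))

lemma Hm_add (i : ℕ) (f g : A →ₗ[R] B) (x : HH J i A) :
    Hm J i (f + g) x = Hm J i f x + Hm J i g x :=
  Hc_add J i (ModuleCat.ofHom f) (ModuleCat.ofHom g) x

lemma Hm_smul_id (i : ℕ) (r : R) (x : HH J i A) :
    Hm J i (r • LinearMap.id : A →ₗ[R] A) x = r • x :=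
  Hc_smul J i (ModuleCat.of R A) r x

lemma Hm_smul (i : ℕ) (r : R) (f : A →ₗ[R] B) (x : HH J i A) :
    Hm J i (r • f) x = r • Hm J i f x := by
  have : r • f = (r • LinearMap.id : B →ₗ[R] B) ∘ₗ f := by ext; simp
  rw [this, Hm_comp, Hm_smul_id]

lemma Hm_zero (i : ℕ) (x : HH J i A) : Hm J i (0 : A →ₗ[R] B) x = 0 := by
  have := Hm_smul J i 0 (0 : A →ₗ[R] B) x
  simpa using this

lemma Hm_sum (i : ℕ) {ι : Type*} (s : Finset ι) (f : ι → (A →ₗ[R] B)) (x : HH J i A) :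
    Hm J i (∑ j ∈ s, f j) x = ∑ j ∈ s, Hm J i (f j) x := by
  classical
  induction s using Finset.induction_on with
  | empty => simp [Hm_zero]
  | insert a s ha ih => rw [Finset.sum_insert ha, Finset.sum_insert ha, Hm_add, ih]

/-- short exact sequences of linear maps -/
structure SES (f : A →ₗ[R] B) (g : B →ₗ[R] C) : Prop where
  inj : Function.Injective f
  surj : Function.Surjective g
  ex : Function.Exact f g

abbrev SES.sc {f : A →ₗ[R] B} {g : B →ₗ[R] C} (h : SES f g) : ShortComplex (ModuleCat.{0} R) :=
  ShortComplex.mk (ModuleCat.ofHom f) (ModuleCat.ofHom g) (by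
    apply ModuleCat.hom_ext; exact h.ex.linearMap_comp_eq_zero)

lemma SES.se {f : A →ₗ[R] B} {g : B →ₗ[R] C} (h : SES f g) : h.sc.ShortExact := by
  refine ShortComplex.ShortExact.mk' ?_ ?_ ?_
  · rw [ShortComplex.moduleCat_exact_iff]
    intro x hx
    exact (h.ex x).1 hx
  · rw [ModuleCat.mono_iff_injective]; exact h.inj
  · rw [ModuleCat.epi_iff_surjective]; exact h.surj

def Hδ {f : A →ₗ[R] B} {g : B →ₗ[R] C} (h : SES f g) (i : ℕ) : HH J i C →ₗ[R] HH J (i+1) A :=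
  (Hcδ J h.se i).hom

lemma H_ex₂ {f : A →ₗ[R] B} {g : B →ₗ[R] C} (h : SES f g) (i : ℕ) :
    Function.Exact (Hm J i f) (Hm J i g) := Hc_exact₂ J h.se i

lemma H_ex₃ {f : A →ₗ[R] B} {g : B →ₗ[R] C} (h : SES f g) (i : ℕ) :
    Function.Exact (Hm J i g) (Hδ J h i) := Hc_exact₃ J h.se i

lemma H_ex₁ {f : A →ₗ[R] B} {g : B →ₗ[R] C} (h : SES f g) (i : ℕ) :
    Function.Exact (Hδ J h i) (Hm J (i+1) f) := Hc_exact₁ J h.se i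

lemma Hδ_nat {f : A →ₗ[R] B} {g : B →ₗ[R] C} (h : SES f g)
    {A' B' C' : Type} [AddCommGroup A'] [Module R A'] [AddCommGroup B'] [Module R B']
    [AddCommGroup C'] [Module R C'] {f' : A' →ₗ[R] B'} {g' : B' →ₗ[R] C'} (h' : SES f' g')
    (a : A →ₗ[R] A') (b : B →ₗ[R] B') (c : C →ₗ[R] C') (h₁ : f' ∘ₗ a = b ∘ₗ f)
    (h₂ : g' ∘ₗ b = c ∘ₗ g) (i : ℕ) (x : HH J i C) :
    Hm J (i+1) a (Hδ J h i x) = Hδ J h' i (Hm J i c x) := by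
  let φ : h.sc ⟶ h'.sc :=
    { τ₁ := ModuleCat.ofHom a
      τ₂ := ModuleCat.ofHom b
      τ₃ := ModuleCat.ofHom c
      comm₁₂ := ModuleCat.hom_ext h₁
      comm₂₃ := ModuleCat.hom_ext h₂ }
  exact Hcδ_nat J h.se h'.se φ i x

lemma H_inj (i : ℕ) [Module.Injective R A] (x : HH J (i+1) A) : x = 0 := by
  have : Injective (ModuleCat.of R A) := Module.injective_object_of_injective_module R A
  exact Hc_inj J i (ModuleCat.of R A) x

def He (A : Type) [AddCommGroup A] [Module R A] : HH J 0 A →ₗ[R] A := (eps J (ModuleCat.of R A)).hom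

lemma He_nat (f : A →ₗ[R] B) (x : HH J 0 A) : He J B (Hm J 0 f x) = f (He J A x) :=
  eps_nat J (ModuleCat.ofHom f) x

lemma He_inj : Function.Injective (He J A) := eps_inj J (ModuleCat.of R A)

lemma He_range (y : A) : (∃ x, He J A x = y) ↔ ∃ t, ∀ r ∈ J ^ t, r • y = 0 :=
  eps_range J (ModuleCat.of R A) y

example (i : ℕ) : HH J i A = (localCohomology J i).obj (ModuleCat.of R A) := rfl
end HHs
end
end LCAux

open CategoryTheory Limits

namespace LCAux
noncomputable section

section T
variable {R : Type} [CommRing R] (J : Ideal R)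

/-- the torsion submodule -/
def tors (M : Type) [AddCommGroup M] [Module R M] : Submodule R M where
  carrier := {y | ∃ t, ∀ r ∈ J ^ t, r • y = 0}
  zero_mem' := ⟨0, by simp⟩
  add_mem' := by
    rintro a b ⟨s, hs⟩ ⟨t, ht⟩
    refine ⟨s + t, fun r hr => ?_⟩
    rw [smul_add, hs r (Ideal.pow_le_pow_right (by omega) hr),
      ht r (Ideal.pow_le_pow_right (by omega) hr), add_zero]
  smul_mem' := by
    rintro c a ⟨s, hs⟩
    exact ⟨s, fun r hr => by rw [smul_comm, hs r hr, smul_zero]⟩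

lemma mem_tors {M : Type} [AddCommGroup M] [Module R M] {y : M} :
    y ∈ tors J M ↔ ∃ t, ∀ r ∈ J ^ t, r • y = 0 := Iff.rfl

def IsTors (M : Type) [AddCommGroup M] [Module R M] : Prop := ∀ y : M, y ∈ tors J M

lemma tors_tors (M : Type) [AddCommGroup M] [Module R M] : IsTors J (tors J M) := by
  rintro ⟨y, t, ht⟩
  exact ⟨t, fun r hr => Subtype.ext (ht r hr)⟩

variable {A B C M : Type} [AddCommGroup A] [Module R A] [AddCommGroup B] [Module R B]
  [AddCommGroup C] [Module R C] [AddCommGroup M] [Module R M]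

lemma IsTors.of_surj {J : Ideal R} (h : IsTors J A) (f : A →ₗ[R] B) (hf : Function.Surjective f) : IsTors J B := by
  intro b
  obtain ⟨a, rfl⟩ := hf b
  obtain ⟨t, ht⟩ := h a
  exact ⟨t, fun r hr => by rw [← map_smul, ht r hr, map_zero]⟩

lemma IsTors.of_inj {J : Ideal R} (h : IsTors J B) (f : A →ₗ[R] B) (hf : Function.Injective f) : IsTors J A := by
  intro a
  obtain ⟨t, ht⟩ := h (f a)
  exact ⟨t, fun r hr => hf (by rw [map_smul, ht r hr, map_zero])⟩

/-- a uniform exponent for finitely generated torsion submodules -/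
lemma exists_pow_kill (N : Submodule R M) (hN : N.FG) (h : N ≤ tors J M) :
    ∃ t, ∀ r ∈ J ^ t, ∀ y ∈ N, r • y = 0 := by
  obtain ⟨S, rfl⟩ := hN
  have h1 : ∀ y : S, ∃ t, ∀ r ∈ J ^ t, r • (y : M) = 0 := fun y => h (Submodule.subset_span y.2)
  choose t ht using h1
  refine ⟨∑ y, t y, fun r hr => ?_⟩
  intro y hy
  induction hy using Submodule.span_induction with
  | mem x hx =>
    apply ht ⟨x, hx⟩
    refine Ideal.pow_le_pow_right ?_ hr
    exact Finset.single_le_sum (f := t) (fun _ _ => Nat.zero_le _) (Finset.mem_univ (⟨x, hx⟩ : S))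
  | zero => simp
  | add x y _ _ hx hy => rw [smul_add, hx, hy, add_zero]
  | smul a x _ hx => rw [smul_comm, hx, smul_zero]

lemma tors_injective [IsNoetherianRing R] [Module.Injective R A] : Module.Injective R (tors J A) := by
  apply Module.Baer.injective
  intro I f
  have hI : (LinearMap.range f).FG := by
    rw [← Submodule.map_top]
    exact Submodule.FG.map _ (IsNoetherian.noetherian _)
  obtain ⟨s, hs⟩ := exists_pow_kill J (LinearMap.range f) hI (fun y _ => tors_tors J A y)
  obtain ⟨k, hk⟩ := Ideal.exists_pow_inf_eq_pow_smul J (M := R) I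
  have hk' := hk (k + s) (by omega)
  let q : I →ₗ[R] (R ⧸ J ^ (k+s)) := (Submodule.mkQ (J ^ (k+s))) ∘ₗ I.subtype
  have hq : LinearMap.ker q ≤ LinearMap.ker ((tors J A).subtype ∘ₗ f) := by
    intro x hx
    have h1 : (x : R) ∈ J ^ (k+s) := by
      have hx' : q x = 0 := hx
      rw [← Submodule.Quotient.mk_eq_zero]; exact hx'
    have h2 : (x : R) ∈ J ^ s • I := by
      have : (x : R) ∈ J ^ (k+s) • ⊤ ⊓ I := ⟨by simpa using h1, x.2⟩
      rw [hk'] at this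
      have e : k + s - k = s := by omega
      rw [e] at this
      exact Submodule.smul_mono le_rfl inf_le_right this
    have h3 : J ^ s • I ≤ Submodule.map I.subtype (LinearMap.ker f) := by
      refine Submodule.smul_le.2 ?_
      intro r hr n hn
      refine ⟨r • ⟨n, hn⟩, ?_, rfl⟩
      change f (r • ⟨n, hn⟩) = 0
      rw [map_smul]
      exact hs r hr _ ⟨_, rfl⟩
    obtain ⟨z, hz, hzx⟩ := h3 h2
    obtain rfl : z = x := Subtype.ext hzx
    have hz' : f z = 0 := hz
    rw [LinearMap.mem_ker, LinearMap.comp_apply, hz', map_zero]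
  obtain ⟨h, hh⟩ := Module.Injective.out ((LinearMap.ker q).liftQ q le_rfl)
    (by rw [← LinearMap.ker_eq_bot]; exact Submodule.ker_liftQ_eq_bot _ _ _ le_rfl)
    ((LinearMap.ker q).liftQ ((tors J A).subtype ∘ₗ f) hq)
  let y : A := h (Submodule.Quotient.mk 1)
  have hy : y ∈ tors J A := ⟨k+s, fun r hr => by
    rw [← map_smul, ← Submodule.Quotient.mk_smul]
    have : (Submodule.Quotient.mk (r • 1) : R ⧸ J^(k+s)) = 0 := by
      rw [Submodule.Quotient.mk_eq_zero]; simpa using hr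
    rw [this, map_zero]⟩
  refine ⟨LinearMap.toSpanSingleton R _ ⟨y, hy⟩, fun x hx => ?_⟩
  apply Subtype.ext
  have := hh (Submodule.Quotient.mk ⟨x, hx⟩)
  simp only [Submodule.liftQ_apply] at this
  change x • y = (tors J A).subtype (f ⟨x, hx⟩)
  rw [← LinearMap.comp_apply, ← this, ← map_smul, ← Submodule.Quotient.mk_smul]
  simp [q]

lemma H0_surj (hB : IsTors J B) (g : B →ₗ[R] C) (hg : Function.Surjective g) :
    Function.Surjective (Hm J 0 g) := by
  intro x
  obtain ⟨b, hb⟩ := hg (He J C x)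
  obtain ⟨y, hy⟩ := (He_range J b).2 (hB b)
  exact ⟨y, He_inj J (by rw [He_nat, hy, hb])⟩

lemma H0_inj (f : A →ₗ[R] B) (hf : Function.Injective f) : Function.Injective (Hm J 0 f) := by
  intro x y h
  apply He_inj J
  apply hf
  rw [← He_nat, ← He_nat, h]

lemma ses_mkQ (N : Submodule R M) : SES N.subtype N.mkQ :=
  ⟨N.injective_subtype, N.mkQ_surjective, by
    rw [LinearMap.exact_iff]; simp⟩

lemma ses_range (f : A →ₗ[R] B) (hf : Function.Injective f) : SES f (LinearMap.range f).mkQ :=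
  ⟨hf, Submodule.mkQ_surjective _, by
    rw [LinearMap.exact_iff]; simp⟩

lemma exists_inj (A : Type) [AddCommGroup A] [Module R A] : ∃ (E : Type) (_ : AddCommGroup E) (_ : Module R E) (f : A →ₗ[R] E),
    Module.Injective R E ∧ Function.Injective f := by
  let E := Injective.under (ModuleCat.of R A)
  refine ⟨E, inferInstance, inferInstance, (Injective.ι (ModuleCat.of R A)).hom, ?_, ?_⟩
  · have : Injective (ModuleCat.of R E) := inferInstanceAs (Injective (Injective.under (ModuleCat.of R A)))
    exact Module.injective_module_of_injective_object R E
  · exact (ModuleCat.mono_iff_injective _).1 inferInstance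

lemma H_tors [IsNoetherianRing R] (i : ℕ) : ∀ (A : Type) [AddCommGroup A] [Module R A], IsTors J A → ∀ x : HH J (i+1) A, x = 0 := by
  induction i with
  | zero =>
    intro A _ _ hA x
    obtain ⟨E, _, _, f, hE, hf⟩ := exists_inj (R := R) A
    have := tors_injective J (A := E)
    let f' : A →ₗ[R] tors J E := f.codRestrict _ (fun a => by
      obtain ⟨t, ht⟩ := hA a
      exact ⟨t, fun r hr => by rw [← map_smul, ht r hr, map_zero]⟩)
    have hf' : Function.Injective f' := fun a b h => hf (congrArg Subtype.val h)
    obtain ⟨y, rfl⟩ := (H_ex₁ J (ses_range f' hf') 0 x).1 (H_inj J 0 _)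
    obtain ⟨z, rfl⟩ := H0_surj J (tors_tors J E) _ (ses_range f' hf').surj y
    exact (H_ex₃ J (ses_range f' hf') 0 _).2 ⟨_, rfl⟩
  | succ i ih =>
    intro A _ _ hA x
    obtain ⟨E, _, _, f, hE, hf⟩ := exists_inj (R := R) A
    have := tors_injective J (A := E)
    let f' : A →ₗ[R] tors J E := f.codRestrict _ (fun a => by
      obtain ⟨t, ht⟩ := hA a
      exact ⟨t, fun r hr => by rw [← map_smul, ht r hr, map_zero]⟩)
    have hf' : Function.Injective f' := fun a b h => hf (congrArg Subtype.val h)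
    obtain ⟨y, rfl⟩ := (H_ex₁ J (ses_range f' hf') (i+1) x).1 (H_inj J (i+1) _)
    rw [ih _ ((tors_tors J E).of_surj _ (ses_range f' hf').surj) y, map_zero]

/-! passing to the quotient by torsion -/
abbrev Mb (M : Type) [AddCommGroup M] [Module R M] : Type := M ⧸ tors J M

abbrev pb (M : Type) [AddCommGroup M] [Module R M] : M →ₗ[R] Mb J M := (tors J M).mkQ

lemma pb_surj [IsNoetherianRing R] (i : ℕ) : Function.Surjective (Hm J i (pb J M)) := by
  intro x
  exact (H_ex₃ J (ses_mkQ (tors J M)) i x).1 (H_tors J i _ (tors_tors J M) _)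

lemma pb_inj [IsNoetherianRing R] (i : ℕ) : Function.Injective (Hm J (i+1) (pb J M)) := by
  rw [injective_iff_map_eq_zero]
  intro x hx
  obtain ⟨y, rfl⟩ := (H_ex₂ J (ses_mkQ (tors J M)) (i+1) x).1 hx
  rw [H_tors J i _ (tors_tors J M) y, map_zero]

lemma tors_Mb [IsNoetherian R M] : tors J (Mb J M) = ⊥ := by
  rw [eq_bot_iff]
  rintro y ⟨t, ht⟩
  obtain ⟨m, rfl⟩ := Submodule.mkQ_surjective _ y
  obtain ⟨s, hs⟩ := exists_pow_kill J (tors J M) (IsNoetherian.noetherian _) le_rfl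
  rw [Submodule.mem_bot, Submodule.mkQ_apply, Submodule.Quotient.mk_eq_zero]
  refine ⟨s + t, fun r hr => ?_⟩
  rw [pow_add] at hr
  refine Submodule.mul_induction_on hr ?_ ?_
  · intro a ha b hb
    rw [mul_smul]
    apply hs a ha
    rw [← Submodule.Quotient.mk_eq_zero, Submodule.Quotient.mk_smul]
    exact ht b hb
  · intro a b ha hb
    rw [add_smul, ha, hb, add_zero]

lemma tors_kill {I : Ideal R} (h : ∀ r ∈ I, ∀ x : HH J 0 M, r • x = 0) (r : R) (hr : r ∈ I) (y : M) (hy : y ∈ tors J M) :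
    r • y = 0 := by
  obtain ⟨x, rfl⟩ := (He_range J y).2 hy
  rw [← map_smul, h r hr, map_zero]

end T
end
end LCAux

open CategoryTheory Limits

namespace LCAux
noncomputable section

section Q

/-- avoidance of finitely many primes by an element of a coset of an ideal -/
lemma coset_avoid {R : Type} [CommRing R] (a : R) (I : Ideal R) (n : ℕ) : ∀ (S : Finset (Ideal R)), S.card = n →
    (∀ p ∈ S, p.IsPrime) → (∀ p ∈ S, ¬ (a ∈ p ∧ I ≤ p)) → ∃ c ∈ I, ∀ p ∈ S, a + c ∉ p := by
  classical
  induction n with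
  | zero =>
    intro S hS _ _
    rw [Finset.card_eq_zero] at hS
    subst hS
    exact ⟨0, I.zero_mem, by simp⟩
  | succ n ih =>
    intro S hS hp hI
    have hne : S.Nonempty := Finset.card_pos.1 (by omega)
    obtain ⟨p, hpm⟩ := S.exists_minimal hne
    have hpS : p ∈ S := hpm.1
    obtain ⟨c, hc, hcS⟩ := ih (S.erase p) (by rw [Finset.card_erase_of_mem hpS, hS]; rfl)
      (fun q hq => hp q (Finset.mem_of_mem_erase hq)) (fun q hq => hI q (Finset.mem_of_mem_erase hq))
    by_cases hac : a + c ∈ p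
    · have hpp := hp p hpS
      have h1 : ¬ (I * ∏ q ∈ S.erase p, q ≤ p) := by
        intro h
        rcases (Ideal.IsPrime.mul_le hpp).1 h with h | h
        · refine hI p hpS ⟨?_, h⟩
          have := p.sub_mem hac (h hc)
          simpa using this
        · obtain ⟨q, hq, hqp⟩ := (Ideal.IsPrime.prod_le hpp).1 h
          have := hpm.2 (Finset.mem_of_mem_erase hq) hqp
          exact (Finset.ne_of_mem_erase hq) (le_antisymm hqp this)
      obtain ⟨b, hb, hbp⟩ := SetLike.not_le_iff_exists.1 h1
      have hbI : b ∈ I := by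
        have h2 : I * ∏ q ∈ S.erase p, q ≤ I := Ideal.mul_le_left
        exact h2 hb
      have hbP : b ∈ ∏ q ∈ S.erase p, q := by
        have h2 : I * ∏ q ∈ S.erase p, q ≤ ∏ q ∈ S.erase p, q := Ideal.mul_le_right
        exact h2 hb
      refine ⟨c + b, I.add_mem hc hbI, ?_⟩
      intro q hq
      by_cases hqp : q = p
      · subst hqp
        intro h
        apply hbp
        have := q.sub_mem h hac
        simpa [← add_assoc] using this
      · have hq' : q ∈ S.erase p := Finset.mem_erase.2 ⟨hqp, hq⟩
        intro h
        apply hcS q hq'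
        have hbq : b ∈ q := by
          have : (∏ q ∈ S.erase p, q) ≤ q := by
            refine Ideal.prod_le_inf.trans ?_
            exact Finset.inf_le (f := fun q => q) hq'
          exact this hbP
        have := q.sub_mem h hbq
        simpa [← add_assoc] using this
    · refine ⟨c, hc, fun q hq => ?_⟩
      by_cases hqp : q = p
      · subst hqp; exact hac
      · exact hcS q (Finset.mem_erase.2 ⟨hqp, hq⟩)

variable {R : Type} [CommRing R] (J : Ideal R)
variable {A B C M : Type} [AddCommGroup A] [Module R A] [AddCommGroup B] [Module R B]
  [AddCommGroup C] [Module R C] [AddCommGroup M] [Module R M]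

lemma kill_ses {f : A →ₗ[R] B} {g : B →ₗ[R] C} (h : SES f g) (i : ℕ) (I₁ I₂ : Ideal R)
    (h₁ : ∀ r ∈ I₁, ∀ x : HH J i B, r • x = 0) (h₂ : ∀ r ∈ I₂, ∀ x : HH J (i+1) A, r • x = 0) :
    ∀ r ∈ I₁ * I₂, ∀ x : HH J i C, r • x = 0 := by
  intro r hr x
  refine Submodule.mul_induction_on hr ?_ ?_
  · intro a ha b hb
    have : Hδ J h i (b • x) = 0 := by rw [map_smul, h₂ b hb]
    obtain ⟨y, hy⟩ := (H_ex₃ J h i _).1 this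
    rw [mul_smul, ← hy, ← map_smul, h₁ a ha, map_zero]
  · intro a b ha hb
    rw [add_smul, ha, hb, add_zero]

open IsLocalRing

lemma lemQ [IsNoetherianRing R] [IsLocalRing R] (e : ℕ) : ∀ (d : ℕ) (M : Type) [AddCommGroup M] [Module R M]
    [Module.Finite R M], e < d → ∀ (n : ℕ),
    (∀ i < d, ∀ r ∈ maximalIdeal R ^ n, ∀ x : HH (maximalIdeal R) i M, r • x = 0) →
    ∀ (K : Ideal R) (z : Fin e → R), (∀ i, z i ∈ maximalIdeal R) → ∀ t : ℕ,
    maximalIdeal R ^ t ≤ K ⊔ Ideal.span (Set.range z) →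
    ∀ m : M, (∀ a ∈ K, a • m = 0) → m ∈ tors (maximalIdeal R) M := by
  induction e with
  | zero =>
    intro d M _ _ _ _ n _ K z _ t ht m hm
    refine ⟨t, fun r hr => hm r ?_⟩
    have := ht hr
    simpa [Set.range_eq_empty] using this
  | succ e ih =>
    intro d M _ _ _ hed n hn K z hz t ht
    by_cases hK : K ≤ maximalIdeal R
    swap
    · intro m hm
      have : K = ⊤ := by
        by_contra h
        exact hK (IsLocalRing.le_maximalIdeal h)
      have h1 := hm 1 (by rw [this]; trivial)
      rw [one_smul] at h1
      rw [h1]; exact zero_mem _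
    -- reduce to the torsion free case
    suffices H : ∀ (M : Type) [AddCommGroup M] [Module R M] [Module.Finite R M],
        (∀ i < d, ∀ r ∈ maximalIdeal R ^ n, ∀ x : HH (maximalIdeal R) i M, r • x = 0) →
        tors (maximalIdeal R) M = ⊥ → ∀ m : M, (∀ a ∈ K, a • m = 0) → m = 0 by
      intro m hm
      have := H (Mb (maximalIdeal R) M) ?_ (tors_Mb _) (pb (maximalIdeal R) M m) ?_
      · simpa using this
      · intro i hi r hr x
        obtain ⟨y, rfl⟩ := pb_surj (maximalIdeal R) i x
        rw [← map_smul, hn i hi r hr, map_zero]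
      · intro a ha
        rw [← map_smul, hm a ha, map_zero]
    clear hn
    intro M _ _ _ hn htors m₀ hm₀
    set L := K ⊔ Ideal.span (Set.range (Fin.tail z)) with hL
    have hzL : K ⊔ Ideal.span (Set.range z) ≤ L ⊔ Ideal.span {z 0} := by
      refine sup_le (le_sup_left.trans le_sup_left) ?_
      rw [Ideal.span_le]
      rintro _ ⟨i, rfl⟩
      refine Fin.cases ?_ (fun j => ?_) i
      · exact Ideal.mem_sup_right (Ideal.subset_span rfl)
      · exact Ideal.mem_sup_left (Ideal.mem_sup_right (Ideal.subset_span ⟨j, rfl⟩))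
    obtain ⟨c, hc, hcx⟩ := coset_avoid (z 0) L _ (associatedPrimes.finite R M).toFinset rfl
      (fun p hp => ((associatedPrimes.finite R M).mem_toFinset.1 hp).1)
      (by
        intro p hp ⟨h0, hLp⟩
        have hp' := (associatedPrimes.finite R M).mem_toFinset.1 hp
        rw [AssociatedPrimes.mem_iff, isAssociatedPrime_iff] at hp'
        obtain ⟨hpp, x, hx⟩ := hp'
        have h1 : maximalIdeal R ^ t ≤ p := by
          refine ht.trans (hzL.trans (sup_le hLp ?_))
          rw [Ideal.span_le]; simpa using h0
        have h2 : x ∈ tors (maximalIdeal R) M := ⟨t, fun r hr => by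
          have := h1 hr
          rw [hx] at this
          simpa [Submodule.mem_colon_singleton] using this⟩
        rw [htors, Submodule.mem_bot] at h2
        apply hpp.ne_top
        rw [hx, h2]
        simp)
    set x := z 0 + c with hxdef
    have hreg : ∀ y : M, x • y = 0 → y = 0 := by
      intro y hy
      by_contra hne
      have : x ∈ ⋃ p ∈ associatedPrimes R M, (p : Set R) := by
        rw [biUnion_associatedPrimes_eq_zero_divisors]
        exact ⟨y, hne, hy⟩
      simp only [Set.mem_iUnion] at this
      obtain ⟨p, hp, hxp⟩ := this
      exact hcx p ((associatedPrimes.finite R M).mem_toFinset.2 hp) hxp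
    have hLm : L ≤ maximalIdeal R := sup_le hK (by
      rw [Ideal.span_le]
      rintro _ ⟨i, rfl⟩
      exact hz _)
    have hxm : x ∈ maximalIdeal R := Ideal.add_mem _ (hz 0) (hLm hc)
    have hregp : ∀ (j : ℕ) (y : M), x ^ j • y = 0 → y = 0 := by
      intro j
      induction j with
      | zero => intro y hy; simpa using hy
      | succ j ihj => intro y hy; rw [pow_succ, mul_smul] at hy; exact hreg _ (ihj _ hy)
    have hses : ∀ j : ℕ, SES (x ^ j • LinearMap.id : M →ₗ[R] M) (LinearMap.range (x ^ j • LinearMap.id : M →ₗ[R] M)).mkQ := by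
      intro j
      apply ses_range
      rw [injective_iff_map_eq_zero]
      intro y hy
      exact hregp j y hy
    have hkill : ∀ j i : ℕ, i + 1 < d → ∀ r ∈ maximalIdeal R ^ (n + n),
        ∀ y : HH (maximalIdeal R) i (M ⧸ LinearMap.range (x ^ j • LinearMap.id : M →ₗ[R] M)), r • y = 0 := by
      intro j i hi
      rw [pow_add]
      exact kill_ses _ (hses j) i _ _ (hn i (by omega)) (hn (i+1) hi)
    have hK' : maximalIdeal R ^ t ≤ (K ⊔ Ideal.span {x}) ⊔ Ideal.span (Set.range (Fin.tail z)) := by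
      have hLL : L ≤ (K ⊔ Ideal.span {x}) ⊔ Ideal.span (Set.range (Fin.tail z)) :=
        sup_le (le_sup_left.trans le_sup_left) le_sup_right
      refine ht.trans (hzL.trans (sup_le hLL ?_))
      rw [Ideal.span_le, Set.singleton_subset_iff]
      have : z 0 = x - c := by rw [hxdef]; ring
      rw [this]
      exact Ideal.sub_mem _ (Ideal.mem_sup_left (Ideal.mem_sup_right (Ideal.subset_span rfl))) (hLL hc)
    obtain ⟨s, hs⟩ := exists_pow_kill (maximalIdeal R) (tors (maximalIdeal R) (M ⧸ LinearMap.range (x ^ 1 • LinearMap.id : M →ₗ[R] M)))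
      (IsNoetherian.noetherian _) le_rfl
    have hstep : ∀ r ∈ maximalIdeal R ^ s, ∀ m : M, (∀ a ∈ K, a • m = 0) →
        ∃ m', (∀ a ∈ K, a • m' = 0) ∧ r • m = x • m' := by
      intro r hr m hm
      have h1 := ih (d - 1) (M ⧸ LinearMap.range (x ^ 1 • LinearMap.id : M →ₗ[R] M)) (by omega) (n + n)
        (fun i hi => hkill 1 i (by omega)) (K ⊔ Ideal.span {x}) (Fin.tail z) (fun i => hz _) t hK'
        (Submodule.mkQ _ m) (by
          intro a ha
          obtain ⟨b, hb, c, hc, rfl⟩ := Submodule.mem_sup.1 ha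
          obtain ⟨c', rfl⟩ := Ideal.mem_span_singleton'.1 hc
          rw [← map_smul, add_smul, hm b hb, zero_add, Submodule.mkQ_apply, Submodule.Quotient.mk_eq_zero]
          refine ⟨c' • m, ?_⟩
          simp [smul_smul, mul_comm])
      have h2 := hs r hr _ h1
      rw [← map_smul, Submodule.mkQ_apply, Submodule.Quotient.mk_eq_zero] at h2
      obtain ⟨m', hm'⟩ := h2
      have hm'' : r • m = x • m' := by simpa using hm'.symm
      refine ⟨m', fun a ha => hreg _ ?_, hm''⟩
      rw [smul_comm, ← hm'', smul_comm, hm a ha, smul_zero]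
    have hiter : ∀ (j : ℕ), ∀ r ∈ (maximalIdeal R ^ s) ^ j, ∀ m : M, (∀ a ∈ K, a • m = 0) →
        ∃ m', (∀ a ∈ K, a • m' = 0) ∧ r • m = x ^ j • m' := by
      intro j
      induction j with
      | zero =>
        intro r _ m hm
        exact ⟨r • m, fun a ha => by rw [smul_comm, hm a ha, smul_zero], by simp⟩
      | succ j ihj =>
        intro r hr m hm
        rw [pow_succ] at hr
        refine Submodule.mul_induction_on hr ?_ ?_
        · intro a ha b hb
          obtain ⟨m₁, h₁, e₁⟩ := hstep b hb m hm
          obtain ⟨m₂, h₂, e₂⟩ := ihj a ha m₁ h₁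
          refine ⟨m₂, h₂, ?_⟩
          rw [mul_smul, e₁, smul_comm, e₂, smul_smul, pow_succ']
        · rintro a b ⟨m₁, h₁, e₁⟩ ⟨m₂, h₂, e₂⟩
          refine ⟨m₁ + m₂, fun a ha => by rw [smul_add, h₁ a ha, h₂ a ha, add_zero], ?_⟩
          rw [add_smul, e₁, e₂, smul_add]
    have hfin : m₀ ∈ tors (maximalIdeal R) M := by
      refine ⟨n + n, fun r hr => ?_⟩
      have h0 : ∀ j : ℕ, r • m₀ ∈ (maximalIdeal R ^ j • ⊤ : Submodule R M) := by
        intro j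
        have h1 : Submodule.mkQ (LinearMap.range (x ^ j • LinearMap.id : M →ₗ[R] M)) m₀ ∈ tors (maximalIdeal R) _ := by
          refine ⟨s * j, fun r hr => ?_⟩
          rw [pow_mul] at hr
          obtain ⟨m', -, hm'⟩ := hiter j r hr m₀ hm₀
          rw [← map_smul, Submodule.mkQ_apply, Submodule.Quotient.mk_eq_zero]
          exact ⟨m', by simpa using hm'.symm⟩
        have h2 := tors_kill _ (hkill j 0 (by omega)) r hr _ h1
        rw [← map_smul, Submodule.mkQ_apply, Submodule.Quotient.mk_eq_zero] at h2
        obtain ⟨m', hm'⟩ := h2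
        rw [← hm']
        exact Submodule.smul_mem_smul (Ideal.pow_mem_pow hxm j) trivial
      have h1 : r • m₀ ∈ (⨅ j : ℕ, (maximalIdeal R ^ j • ⊤ : Submodule R M)) := (Submodule.mem_iInf _).2 h0
      rw [Ideal.iInf_pow_smul_eq_bot_of_isLocalRing _ (Ideal.IsPrime.ne_top inferInstance)] at h1
      simpa using h1
    rw [htors] at hfin
    simpa using hfin

end Q
end
end LCAux

open CategoryTheory Limits

namespace LCAux
noncomputable section

section G
variable {R : Type} [CommRing R] (J : Ideal R)

lemma exists_sum_of_mem_mul (I I' : Ideal R) (x : R) (hx : x ∈ I * I') :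
    ∃ (ι : Type) (_ : Fintype ι) (_ : DecidableEq ι) (a b : ι → R), (∀ j, a j ∈ I) ∧ (∀ j, b j ∈ I') ∧ x = ∑ j, a j * b j := by
  refine Submodule.mul_induction_on hx ?_ ?_
  · intro a ha b hb
    exact ⟨Unit, inferInstance, inferInstance, fun _ => a, fun _ => b, fun _ => ha, fun _ => hb, by simp⟩
  · rintro x y ⟨ι, _, _, a, b, ha, hb, rfl⟩ ⟨κ, _, _, a', b', ha', hb', rfl⟩
    refine ⟨ι ⊕ κ, inferInstance, inferInstance, Sum.elim a a', Sum.elim b b', ?_, ?_, ?_⟩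
    · rintro (j | j); exacts [ha j, ha' j]
    · rintro (j | j); exacts [hb j, hb' j]
    · simp

abbrev tB (I : Ideal R) (A : Type) [AddCommGroup A] [Module R A] : Submodule R A :=
  Submodule.torsionBySet R A (I : Set R)

lemma mem_tB {I : Ideal R} {A : Type} [AddCommGroup A] [Module R A] {x : A} :
    x ∈ tB I A ↔ ∀ r ∈ I, r • x = 0 := by
  rw [Submodule.mem_torsionBySet_iff]
  exact ⟨fun h r hr => h ⟨r, hr⟩, fun h r => h r r.2⟩

def tBmap (I : Ideal R) {A B : Type} [AddCommGroup A] [Module R A] [AddCommGroup B] [Module R B]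
    (f : A →ₗ[R] B) : tB I A →ₗ[R] tB I B :=
  (f ∘ₗ (tB I A).subtype).codRestrict _ (fun x => mem_tB.2 fun r hr => by
    have h := mem_tB.1 x.2 r hr
    change r • f (x : A) = 0
    rw [← map_smul, h, map_zero])

lemma tBmap_coe (I : Ideal R) {A B : Type} [AddCommGroup A] [Module R A] [AddCommGroup B] [Module R B]
    (f : A →ₗ[R] B) (x : tB I A) : (tBmap I f x : B) = f x := rfl

lemma tB_length (I : Ideal R) {A B : Type} [AddCommGroup A] [Module R A] [AddCommGroup B] [Module R B]
    (e : A ≃ₗ[R] B) : Module.length R (tB I A) = Module.length R (tB I B) := by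
  refine LinearEquiv.length_eq (LinearEquiv.ofBijective (tBmap I e.toLinearMap) ⟨?_, ?_⟩)
  · intro x y h
    exact Subtype.ext (e.injective (congrArg Subtype.val h))
  · intro y
    refine ⟨⟨e.symm y, mem_tB.2 fun r hr => ?_⟩, Subtype.ext ?_⟩
    · rw [← map_smul, mem_tB.1 y.2 r hr, map_zero]
    · rw [tBmap_coe]; simp

variable {M : Type} [AddCommGroup M] [Module R M] [IsNoetherianRing R]

section step
variable (x : R) (d n : ℕ)

abbrev NN (x : R) (M : Type) [AddCommGroup M] [Module R M] : Submodule R M := Ideal.span {x} • (⊤ : Submodule R M)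

/-- multiplication by an element of `J^n` factors through the quotient by torsion -/
def mulb (hk0 : ∀ r ∈ J ^ n, ∀ u : HH J 0 M, r • u = 0) (b : R) (hb : b ∈ J ^ n) : Mb J M →ₗ[R] M :=
  (tors J M).liftQ (b • LinearMap.id) (fun y hy => by
    have := tors_kill J hk0 b hb y hy
    simpa using this)

lemma mulb_pb (hk0 : ∀ r ∈ J ^ n, ∀ u : HH J 0 M, r • u = 0) (b : R) (hb : b ∈ J ^ n) :
    mulb J n hk0 b hb ∘ₗ pb J M = b • LinearMap.id := by
  ext m; rfl

lemma mulb_pb_apply (hk0 : ∀ r ∈ J ^ n, ∀ u : HH J 0 M, r • u = 0) (b : R) (hb : b ∈ J ^ n) (m : M) :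
    mulb J n hk0 b hb (pb J M m) = b • m := rfl

lemma ses_mulb (hk0 : ∀ r ∈ J ^ n, ∀ u : HH J 0 M, r • u = 0) (hx' : x ∈ J ^ n)
    (hxt : ∀ m : M, x • m = 0 → m ∈ tors J M) : SES (mulb J n hk0 x hx') (NN x M).mkQ := by
  refine ⟨?_, Submodule.mkQ_surjective _, ?_⟩
  · rw [injective_iff_map_eq_zero]
    intro y hy
    obtain ⟨m, rfl⟩ := Submodule.mkQ_surjective _ y
    rw [Submodule.mkQ_apply, Submodule.Quotient.mk_eq_zero]
    exact hxt m hy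
  · rw [LinearMap.exact_iff, Submodule.ker_mkQ]
    ext m
    rw [NN, Submodule.ideal_span_singleton_smul]
    constructor
    · rintro ⟨y, -, rfl⟩
      exact ⟨pb J M y, rfl⟩
    · rintro ⟨y, rfl⟩
      obtain ⟨m, rfl⟩ := Submodule.mkQ_surjective _ y
      exact ⟨m, trivial, rfl⟩

lemma step_inj (hx : x ∈ J ^ n * J ^ n) (hk : ∀ i < d + 1, ∀ r ∈ J ^ n, ∀ u : HH J i M, r • u = 0)
    (i : ℕ) (hi : i ≤ d) (hxt : ∀ m : M, x • m = 0 → m ∈ tors J M) :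
    Function.Injective (Hm J i (NN x M).mkQ) := by
  have hx' : x ∈ J ^ n := Ideal.mul_le_left hx
  have hk0 := hk 0 (by omega)
  rw [injective_iff_map_eq_zero]
  intro u hu
  obtain ⟨w, rfl⟩ := (H_ex₂ J (ses_mulb J x n hk0 hx' hxt) i u).1 hu
  obtain ⟨ι, _, _, a, b, ha, hb, hab⟩ := exists_sum_of_mem_mul _ _ _ hx
  have : mulb J n hk0 x hx' = ∑ j, a j • mulb J n hk0 (b j) (hb j) := by
    ext m
    simp only [LinearMap.comp_apply, LinearMap.sum_apply, LinearMap.smul_apply]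
    rw [mulb_pb_apply, hab, Finset.sum_smul]
    simp_rw [mulb_pb_apply, mul_smul]
  rw [this, Hm_sum]
  refine Finset.sum_eq_zero fun j _ => ?_
  rw [Hm_smul, hk i (by omega) _ (ha j)]

lemma H_pi {ι : Type} [Fintype ι] [DecidableEq ι] (i : ℕ) (w : HH J i (ι → M))
    (h : ∀ j, Hm J i (LinearMap.proj j : (ι → M) →ₗ[R] M) w = 0) : w = 0 := by
  have : (LinearMap.id : (ι → M) →ₗ[R] (ι → M)) =
      ∑ j, (LinearMap.single R (fun _ => M) j) ∘ₗ (LinearMap.proj j : (ι → M) →ₗ[R] M) := by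
    ext j m k
    simp [LinearMap.sum_apply, Pi.single_apply]
  rw [← Hm_id J i w, this, Hm_sum]
  refine Finset.sum_eq_zero fun j _ => ?_
  rw [Hm_comp, h j, map_zero]

lemma step_lift (hx : x ∈ J ^ n * J ^ n) (hk : ∀ i < d + 1, ∀ r ∈ J ^ n, ∀ u : HH J i M, r • u = 0)
    (hx' : x ∈ J ^ n) (hxt : ∀ m : M, x • m = 0 → m ∈ tors J M)
    (i : ℕ) (hi : i ≤ d) (I : Ideal R) (hI : J ^ n ≤ I) (u : HH J (i+1) M) (hu : ∀ r ∈ I, r • u = 0) :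
    ∃ v : HH J i (M ⧸ NN x M), Hδ J (ses_mulb J x n (hk 0 (by omega)) hx' hxt) i v = Hm J (i+1) (pb J M) u ∧
      ∀ r ∈ I, r • v = 0 := by
  have hk0 := hk 0 (by omega)
  obtain ⟨ι, _, _, a, b, ha, hb, hab⟩ := exists_sum_of_mem_mul _ _ _ hx
  let β : Mb J M →ₗ[R] (ι → M) := LinearMap.pi (fun j => mulb J n hk0 (b j) (hb j))
  let α : (ι → M) →ₗ[R] M := ∑ j, a j • LinearMap.proj j
  have hα : ∀ f, α f = ∑ j, a j • f j := fun f => by simp [α]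
  have hαβ : α ∘ₗ β = mulb J n hk0 x hx' := by
    ext m
    simp only [LinearMap.comp_apply]
    rw [mulb_pb_apply, hα, hab, Finset.sum_smul]
    refine Finset.sum_congr rfl fun j _ => ?_
    rw [mul_smul]
    rfl
  have hS := ses_mulb J x n hk0 hx' hxt
  have hβ : Function.Injective β := by
    intro y z h
    apply hS.inj
    rw [← hαβ, LinearMap.comp_apply, h, LinearMap.comp_apply]
  have hS' := ses_range β hβ
  let c : ((ι → M) ⧸ LinearMap.range β) →ₗ[R] (M ⧸ NN x M) :=
    Submodule.mapQ _ _ α (by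
      rintro _ ⟨y, rfl⟩
      rw [Submodule.mem_comap, ← LinearMap.comp_apply, hαβ, ← Submodule.ker_mkQ (NN x M), LinearMap.mem_ker]
      exact (hS.ex _).2 ⟨y, rfl⟩)
  have hc : (NN x M).mkQ ∘ₗ α = c ∘ₗ (LinearMap.range β).mkQ := by
    ext f; rfl
  have h0 : Hm J (i+1) β (Hm J (i+1) (pb J M) u) = 0 := by
    apply H_pi
    intro j
    rw [← Hm_comp, ← Hm_comp]
    have : ((LinearMap.proj j : (ι → M) →ₗ[R] M) ∘ₗ β) ∘ₗ pb J M = b j • LinearMap.id := by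
      ext m; rfl
    rw [this, Hm_smul_id, hu _ (hI (hb j))]
  obtain ⟨v, hv⟩ := (H_ex₁ J hS' i _).1 h0
  refine ⟨Hm J i c v, ?_, ?_⟩
  · rw [← Hδ_nat J hS' hS LinearMap.id α c (by rw [hαβ]; rfl) hc, Hm_id, hv]
  · intro r hr
    have h1 : Hδ J hS' i (r • v) = 0 := by
      rw [map_smul, hv, ← map_smul, hu r hr, map_zero]
    obtain ⟨w, hw⟩ := (H_ex₃ J hS' i _).1 h1
    have h2 : Hm J i α w = 0 := by
      simp only [α]
      rw [Hm_sum]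
      refine Finset.sum_eq_zero fun j _ => ?_
      rw [Hm_smul, hk i (by omega) _ (ha j)]
    rw [← map_smul, ← hw, ← Hm_comp, ← hc, Hm_comp, h2, map_zero]

lemma step_kill (hx : x ∈ J ^ n * J ^ n) (hk : ∀ i < d + 1, ∀ r ∈ J ^ n, ∀ u : HH J i M, r • u = 0)
    (hxt : ∀ m : M, x • m = 0 → m ∈ tors J M)
    (i : ℕ) (hi : i < d) : ∀ r ∈ J ^ n, ∀ v : HH J i (M ⧸ NN x M), r • v = 0 := by
  have hx' : x ∈ J ^ n := Ideal.mul_le_left hx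
  have hS := ses_mulb J x n (hk 0 (by omega)) hx' hxt
  intro r hr v
  obtain ⟨u, hu⟩ := pb_surj J (i+1) (Hδ J hS i v)
  obtain ⟨v₀, h₀, h₁⟩ := step_lift J x d n hx hk hx' hxt i hi.le (J ^ n) le_rfl u (fun r hr => hk _ (by omega) r hr u)
  have h2 : Hδ J hS i (v - v₀) = 0 := by rw [map_sub, h₀, hu, sub_self]
  obtain ⟨w, hw⟩ := (H_ex₃ J hS i _).1 h2
  have h3 : r • (v - v₀) = 0 := by rw [← hw, ← map_smul, hk i (by omega) r hr, map_zero]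
  rwa [smul_sub, h₁ r hr, sub_zero] at h3

lemma step_length (hx : x ∈ J ^ n * J ^ n) (hk : ∀ i < d + 1, ∀ r ∈ J ^ n, ∀ u : HH J i M, r • u = 0)
    (hxt : ∀ m : M, x • m = 0 → m ∈ tors J M)
    (i : ℕ) (hi : i ≤ d) (I : Ideal R) (hI : J ^ n ≤ I) :
    Module.length R (tB I (HH J i (M ⧸ NN x M))) =
      Module.length R (tB I (HH J i M)) + Module.length R (tB I (HH J (i+1) M)) := by
  have hx' : x ∈ J ^ n := Ideal.mul_le_left hx
  have hS := ses_mulb J x n (hk 0 (by omega)) hx' hxt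
  let e : HH J (i+1) M ≃ₗ[R] HH J (i+1) (Mb J M) :=
    LinearEquiv.ofBijective (Hm J (i+1) (pb J M)) ⟨pb_inj J i, pb_surj J (i+1)⟩
  have hinj := step_inj J x d n hx hk i hi hxt
  refine Module.length_eq_add_of_exact (tBmap I (Hm J i (NN x M).mkQ))
    (tBmap I (e.symm.toLinearMap ∘ₗ Hδ J hS i)) ?_ ?_ ?_
  · intro y z h
    exact Subtype.ext (hinj (congrArg Subtype.val h))
  · intro u
    obtain ⟨v, hv, hv'⟩ := step_lift J x d n hx hk hx' hxt i hi I hI u (mem_tB.1 u.2)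
    refine ⟨⟨v, mem_tB.2 hv'⟩, Subtype.ext ?_⟩
    rw [tBmap_coe, LinearMap.comp_apply]
    change e.symm (Hδ J hS i v) = u
    rw [LinearEquiv.symm_apply_eq, hv]
    rfl
  · intro v
    constructor
    · intro h
      have h1 : e.symm (Hδ J hS i v) = 0 := congrArg Subtype.val h
      rw [LinearEquiv.map_eq_zero_iff] at h1
      obtain ⟨w, hw⟩ := (H_ex₃ J hS i _).1 h1
      refine ⟨⟨w, mem_tB.2 fun r hr => hinj ?_⟩, Subtype.ext hw⟩
      rw [map_smul, hw, mem_tB.1 v.2 r hr, map_zero]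
    · rintro ⟨w, rfl⟩
      apply Subtype.ext
      change e.symm (Hδ J hS i (Hm J i (NN x M).mkQ w)) = 0
      rw [(H_ex₃ J hS i _).2 ⟨_, rfl⟩, map_zero]

end step
end G
end
end LCAux

open CategoryTheory Limits

namespace LCAux
noncomputable section

section F
open IsLocalRing
variable {R : Type} [CommRing R] [IsNoetherianRing R] [IsLocalRing R]

lemma finlen_kill (A : Type) [AddCommGroup A] [Module R A] (h : IsFiniteLength R A) :
    ∃ t, ∀ r ∈ maximalIdeal R ^ t, ∀ y : A, r • y = 0 := by
  obtain ⟨_, _⟩ := isFiniteLength_iff_isNoetherian_isArtinian.1 h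
  let f : ℕ →o (Submodule R A)ᵒᵈ :=
    ⟨fun t => OrderDual.toDual (maximalIdeal R ^ t • (⊤ : Submodule R A)), fun s t hst =>
      OrderDual.toDual_le_toDual.2 (Submodule.smul_mono_left (Ideal.pow_le_pow_right hst))⟩
  obtain ⟨t, ht⟩ := IsArtinian.monotone_stabilizes f
  have h1 : maximalIdeal R ^ t • (⊤ : Submodule R A) = maximalIdeal R ^ (t+1) • ⊤ := ht (t+1) (by omega)
  have h2 : maximalIdeal R ^ t • (⊤ : Submodule R A) = ⊥ := by
    apply Submodule.eq_bot_of_le_smul_of_le_jacobson_bot (maximalIdeal R) _ (IsNoetherian.noetherian _)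
    · rw [← Submodule.mul_smul, ← pow_succ', ← h1]
    · exact maximalIdeal_le_jacobson _
  refine ⟨t, fun r hr y => ?_⟩
  have : r • y ∈ maximalIdeal R ^ t • (⊤ : Submodule R A) := Submodule.smul_mem_smul hr trivial
  rw [h2] at this
  simpa using this

lemma pow_le_of_finlen (M : Type) [AddCommGroup M] [Module R M] [Module.Finite R M] (I : Ideal R)
    (h : IsFiniteLength R (M ⧸ (I • (⊤ : Submodule R M)))) :
    ∃ t, maximalIdeal R ^ t ≤ Module.annihilator R M ⊔ I := by
  obtain ⟨s, hs⟩ := finlen_kill _ h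
  have h1 : maximalIdeal R ^ s ≤ Module.annihilator R (M ⧸ (I • (⊤ : Submodule R M))) :=
    fun r hr => Module.mem_annihilator.2 (hs r hr)
  have h2 := Module.support_quotient (M := M) I
  rw [Module.support_eq_zeroLocus, Module.support_eq_zeroLocus, ← PrimeSpectrum.zeroLocus_sup] at h2
  have h3 := (PrimeSpectrum.zeroLocus_subset_zeroLocus_iff _ _).1 h2.ge
  obtain ⟨u, hu⟩ := Ideal.exists_pow_le_of_le_radical_of_fg (h1.trans h3) (IsNoetherian.noetherian _)
  exact ⟨s * u, by rw [pow_mul]; exact hu⟩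

lemma pascal (d : ℕ) (h : ℕ → ℕ∞) :
    ∑ i ∈ Finset.range (d + 1), (d.choose i : ℕ∞) * (h i + h (i+1)) =
      ∑ i ∈ Finset.range (d + 1 + 1), ((d+1).choose i : ℕ∞) * h i := by
  rw [Finset.sum_range_succ' (fun i => ((d+1).choose i : ℕ∞) * h i)]
  have h1 : ∑ i ∈ Finset.range (d + 1), ((d+1).choose (i+1) : ℕ∞) * h (i+1) =
      ∑ i ∈ Finset.range (d + 1), (d.choose i : ℕ∞) * h (i+1) +
      ∑ i ∈ Finset.range (d + 1), (d.choose (i+1) : ℕ∞) * h (i+1) := by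
    rw [← Finset.sum_add_distrib]
    refine Finset.sum_congr rfl fun i _ => ?_
    rw [Nat.choose_succ_succ, Nat.cast_add, add_mul]
  have h2 := Finset.sum_range_succ' (fun i => (d.choose i : ℕ∞) * h i) (d+1)
  rw [Finset.sum_range_succ] at h2
  simp only [Nat.choose_succ_self, Nat.cast_zero, zero_mul, add_zero, Nat.choose_zero_right, Nat.cast_one] at h2
  rw [h1, add_assoc]
  simp only [Nat.choose_zero_right, Nat.cast_one]
  rw [← h2, add_comm, ← Finset.sum_add_distrib]
  refine Finset.sum_congr rfl fun i _ => ?_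
  rw [mul_add, add_comm]

lemma map_NN (x : R) {d : ℕ} (y : Fin (d+1) → R) (hx : x = y 0) (M : Type) [AddCommGroup M] [Module R M] :
    Submodule.map (NN x M).mkQ (Ideal.span (Set.range y) • (⊤ : Submodule R M)) =
      Ideal.span (Set.range (Fin.tail y)) • (⊤ : Submodule R (M ⧸ NN x M)) := by
  have h0 : Ideal.span (Set.range y) = Ideal.span {x} ⊔ Ideal.span (Set.range (Fin.tail y)) := by
    rw [← Ideal.span_union, hx, Set.singleton_union, ← Fin.range_cons, Fin.cons_self_tail]
  rw [h0, Submodule.sup_smul, Submodule.map_sup, Submodule.map_smul'', Submodule.map_smul'', Submodule.map_top,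
    Submodule.range_mkQ]
  rw [sup_eq_right]
  have : Ideal.span {x} • (⊤ : Submodule R (M ⧸ NN x M)) = ⊥ := by
    rw [← Submodule.range_mkQ, ← Submodule.map_top, ← Submodule.map_smul'', Submodule.mkQ_map_self]
  rw [this]; exact bot_le

theorem main_ind (n : ℕ) (I : Ideal R) (hI : maximalIdeal R ^ n ≤ I) (d : ℕ) : ∀ (M : Type) [AddCommGroup M] [Module R M]
    [Module.Finite R M] (y : Fin d → R),
    (∀ i < d, ∀ r ∈ maximalIdeal R ^ n, ∀ u : HH (maximalIdeal R) i M, r • u = 0) →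
    (∀ i, y i ∈ maximalIdeal R) → (∀ i, y i ∈ maximalIdeal R ^ n * maximalIdeal R ^ n) →
    IsFiniteLength R (M ⧸ (Ideal.span (Set.range y) • (⊤ : Submodule R M))) →
    Module.length R (tB I (M ⧸ (Ideal.span (Set.range y) • (⊤ : Submodule R M)))) =
      ∑ i ∈ Finset.range (d + 1), (d.choose i : ℕ∞) * Module.length R (tB I (HH (maximalIdeal R) i M)) := by
  induction d with
  | zero =>
    intro M _ _ _ y _ _ _ hfin
    have h0 : Ideal.span (Set.range y) • (⊤ : Submodule R M) = ⊥ := by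
      simp [Set.range_eq_empty]
    have e := Submodule.quotEquivOfEqBot _ h0
    obtain ⟨t, ht⟩ := finlen_kill _ (e.isFiniteLength hfin)
    have e' : HH (maximalIdeal R) 0 M ≃ₗ[R] M := LinearEquiv.ofBijective (He (maximalIdeal R) M)
      ⟨He_inj _, fun m => (He_range _ m).2 ⟨t, fun r hr => ht r hr m⟩⟩
    rw [tB_length I e, ← tB_length I e']
    simp
  | succ d ih =>
    intro M _ _ _ y hk hy hyn hfin
    obtain ⟨t, ht⟩ := pow_le_of_finlen M _ hfin
    have hxt : ∀ m : M, y 0 • m = 0 → m ∈ tors (maximalIdeal R) M := by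
      intro m hm
      refine lemQ d (d+1) M (by omega) n hk (Module.annihilator R M ⊔ Ideal.span {y 0}) (Fin.tail y)
        (fun i => hy _) t ?_ m ?_
      · rw [sup_assoc, ← Ideal.span_union, Set.singleton_union, ← Fin.range_cons, Fin.cons_self_tail]
        exact ht
      · intro a ha
        obtain ⟨b, hb, c, hc, rfl⟩ := Submodule.mem_sup.1 ha
        obtain ⟨c', rfl⟩ := Ideal.mem_span_singleton'.1 hc
        rw [add_smul, Module.mem_annihilator.1 hb, mul_smul, hm, smul_zero, add_zero]
    have hle : NN (y 0) M ≤ Ideal.span (Set.range y) • (⊤ : Submodule R M) := by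
      refine Submodule.smul_mono_left (Ideal.span_mono ?_)
      rintro _ rfl
      exact ⟨0, rfl⟩
    let e := (Submodule.quotEquivOfEq _ _ (map_NN (y 0) y rfl M)).symm ≪≫ₗ
      Submodule.quotientQuotientEquivQuotient (NN (y 0) M) _ hle
    have h1 := ih (M ⧸ NN (y 0) M) (Fin.tail y) (step_kill _ (y 0) d n (hyn 0) hk hxt)
      (fun i => hy _) (fun i => hyn _) (e.symm.isFiniteLength hfin)
    rw [← tB_length I e, h1, ← pascal]
    refine Finset.sum_congr rfl fun i hi => ?_
    rw [step_length _ (y 0) d n (hyn 0) hk hxt i (by rw [Finset.mem_range] at hi; omega) I hI]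

lemma coe_sum_aux (s : Finset ℕ) (c : ℕ → ℕ) (h : ℕ → ℕ∞) :
    ((∑ i ∈ s, (c i : ℕ∞) * h i : ℕ∞) : WithBot ℕ∞) = ∑ i ∈ s, (c i : WithBot ℕ∞) * (h i : WithBot ℕ∞) := by
  classical
  induction s using Finset.induction_on with
  | empty => simp
  | insert a s ha ih =>
    rw [Finset.sum_insert ha, Finset.sum_insert ha, WithBot.coe_add, ih, WithBot.coe_mul]
    rfl

end F
end
end LCAux

open CategoryTheory IsLocalRing

/-- **Corollary 4.3, first part.** Let `M` be a generalized Cohen-Macaulay module of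
dimension `d` over a Noetherian local ring `(R, 𝔪)` with `𝔪^{n₀}·H^i_𝔪(M) = 0` for all
`i < d`. Then for every parameter ideal `𝔮 ⊆ 𝔪^{2n₀}` of `M` and every `0 < k ≤ n₀`, the
length `ℓ_R((𝔮M :_M 𝔪^k)/𝔮M)` (computed here as the length of the `𝔪^k`-torsion of
`M/𝔮M`) is independent of `𝔮` and equals
`∑_{i=0}^{d} binom(d,i)·ℓ_R(0 :_{H^i_𝔪(M)} 𝔪^k)`.
(The length of a module is expressed as the Krull dimension of its submodule lattice.) -/
theorem length_quotient_colon_parameter_ideal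
    {R : Type} [CommRing R] [IsNoetherianRing R] [IsLocalRing R]
    (M : Type) [AddCommGroup M] [Module R M] [Module.Finite R M]
    (d : ℕ) (hd : 0 < d)
    (hdim : ringKrullDim (R ⧸ Module.annihilator R M) = (d : WithBot (WithTop ℕ)))
    (n₀ : ℕ) (hn₀ : 0 < n₀)
    (hann : ∀ i < d, (maximalIdeal R) ^ n₀ ≤ Module.annihilator R
      ((localCohomology (maximalIdeal R) i).obj (ModuleCat.of R M)))
    (𝔮 : Ideal R) (h𝔮 : 𝔮 ≤ (maximalIdeal R) ^ (2 * n₀))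
    (hpar : ∃ y : Fin d → R, (∀ i, y i ∈ maximalIdeal R) ∧
      𝔮 = Ideal.span (Set.range y) ∧
      IsFiniteLength R (M ⧸ (𝔮 • (⊤ : Submodule R M))))
    (k : ℕ) (hk : 0 < k) (hkn : k ≤ n₀) :
    Order.krullDim (Submodule R (Submodule.torsionBySet R
        (M ⧸ (𝔮 • (⊤ : Submodule R M)))
        (((maximalIdeal R) ^ k : Ideal R) : Set R))) =
      ∑ i ∈ Finset.range (d + 1), (d.choose i : WithBot ℕ∞) *
        Order.krullDim (Submodule R (Submodule.torsionBySet R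
          ((localCohomology (maximalIdeal R) i).obj (ModuleCat.of R M))
          (((maximalIdeal R) ^ k : Ideal R) : Set R))) := by
  obtain ⟨y, hy, rfl, hfin⟩ := hpar
  have hk' : ∀ i < d, ∀ r ∈ maximalIdeal R ^ n₀, ∀ u : LCAux.HH (maximalIdeal R) i M, r • u = 0 :=
    fun i hi r hr u => Module.mem_annihilator.1 (hann i hi hr) u
  have hyn : ∀ i, y i ∈ maximalIdeal R ^ n₀ * maximalIdeal R ^ n₀ := by
    intro i
    rw [← pow_add, ← two_mul]
    exact h𝔮 (Ideal.subset_span ⟨i, rfl⟩)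
  have h := LCAux.main_ind n₀ (maximalIdeal R ^ k) (Ideal.pow_le_pow_right hkn) d M y hk' hy hyn hfin
  have h' := congrArg (fun a : ℕ∞ => (a : WithBot ℕ∞)) h
  simp only [LCAux.coe_sum_aux, Module.coe_length] at h'
  exact h'
end

section
/- Let (R, 𝔪) be a commutative Noetherian local ring and M a generalized Cohen-Macaulay R-module of dimension d, and let n₀ be a positive integer such that 𝔪^{n₀}·H^i_𝔪(M) = 0 for all i < d. Then for every parameter ideal 𝔮 of M contained in 𝔪^{2n₀}, the index of irreducibility N_R(𝔮, M) = dim_{R/𝔪} Soc(M/𝔮M) is a constant independent of the choice of 𝔮 and equals ∑_{i=0}^{d} binom(d,i)·dim_{R/𝔪} Soc(H^i_𝔪(M)). -/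
set_option linter.unusedSectionVars false


namespace LC
open CategoryTheory IsLocalRing Opposite Limits
noncomputable section
variable {R : Type} [CommRing R]

/-- Elements of the homology of a complex in the opposite category of modules,
represented by elements. -/
def Rp (L : ChainComplex (ModuleCat.{0} R)ᵒᵖ ℕ) (i : ℕ) (f : (L.X i).unop)
    (z : (L.homology i).unop) : Prop :=
  ∃ w : (L.opcycles i).unop, (L.pOpcycles i).unop w = f ∧ (L.homologyι i).unop w = z

variable {L L' : ChainComplex (ModuleCat.{0} R)ᵒᵖ ℕ} {i : ℕ}

lemma Rp.unique {f : (L.X i).unop} {e e' : (L.homology i).unop}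
    (h : Rp L i f e) (h' : Rp L i f e') : e = e' := by
  obtain ⟨w, hw, rfl⟩ := h
  obtain ⟨w', hw', rfl⟩ := h'
  have : Function.Injective (L.pOpcycles i).unop :=
    (ModuleCat.mono_iff_injective _).1 inferInstance
  rw [this (hw.trans hw'.symm)]

lemma Rp.exists (e : (L.homology i).unop) : ∃ f, Rp L i f e := by
  have : Function.Surjective (L.homologyι i).unop :=
    (ModuleCat.epi_iff_surjective _).1 inferInstance
  obtain ⟨w, rfl⟩ := this e
  exact ⟨_, w, rfl, rfl⟩

lemma Rp.add {f f' : (L.X i).unop} {e e' : (L.homology i).unop}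
    (h : Rp L i f e) (h' : Rp L i f' e') : Rp L i (f + f') (e + e') := by
  obtain ⟨w, rfl, rfl⟩ := h
  obtain ⟨w', rfl, rfl⟩ := h'
  exact ⟨w + w', by simp, by simp⟩

lemma Rp.smul {f : (L.X i).unop} {e : (L.homology i).unop}
    (h : Rp L i f e) (a : R) : Rp L i (a • f) (a • e) := by
  obtain ⟨w, rfl, rfl⟩ := h
  exact ⟨a • w, by simp, by simp⟩

lemma Rp.cocycle {f : (L.X i).unop} {e : (L.homology i).unop}
    (h : Rp L i f e) : (L.d (i+1) i).unop f = 0 := by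
  obtain ⟨w, rfl, -⟩ := h
  have h1 : L.d (i+1) i ≫ L.pOpcycles i = 0 := by simp
  have h2 := congrArg (fun g => g.unop) h1
  exact congrArg (fun g => g.hom w) h2

lemma Rp.of_cocycle {f : (L.X i).unop}
    (hf : (L.d (i+1) i).unop f = 0) : ∃ e, Rp L i f e := by
  have hex : (ShortComplex.mk (L.d (i+1) i) (L.pOpcycles i) (by simp)).Exact :=
    ShortComplex.exact_of_g_is_cokernel _ (L.opcyclesIsCokernel (i+1) i (by simp))
  have h2 := hex.unop
  rw [ShortComplex.moduleCat_exact_iff] at h2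
  obtain ⟨w, hw⟩ := h2 f hf
  exact ⟨_, w, hw, rfl⟩

lemma Rp.zero_iff {f : (L.X (i+1)).unop} :
    Rp L (i+1) f 0 ↔ ∃ g : (L.X i).unop, f = (L.d (i+1) i).unop g := by
  have hex : (ShortComplex.mk (L.homologyι (i+1)) (L.fromOpcycles (i+1) i) (by simp)).Exact :=
    ShortComplex.exact_of_f_is_kernel _ (L.homologyIsKernel (i+1) i (by simp))
  have h2 := hex.unop
  rw [ShortComplex.moduleCat_exact_iff] at h2
  have hq : (L.fromOpcycles (i+1) i).unop ≫ (L.pOpcycles (i+1)).unop = (L.d (i+1) i).unop := by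
    rw [← unop_comp]; simp
  have hp : (L.fromOpcycles (i+1) i).unop ≫ (L.homologyι (i+1)).unop = 0 := by
    rw [← unop_comp]; simp
  constructor
  · rintro ⟨w, rfl, hw⟩
    obtain ⟨g, hg⟩ := h2 w hw
    refine ⟨g, ?_⟩
    rw [← hg]
    exact congrArg (fun k => k.hom g) hq
  · rintro ⟨g, rfl⟩
    exact ⟨(L.fromOpcycles (i+1) i).unop g, congrArg (fun k => k.hom g) hq,
      congrArg (fun k => k.hom g) hp⟩

lemma Rp.zero_zero {f : (L.X 0).unop} (h : Rp L 0 f 0) : f = 0 := by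
  obtain ⟨w, rfl, hw⟩ := h
  have inj : Function.Injective (L.homologyι 0).unop := (ModuleCat.mono_iff_injective _).1 inferInstance
  have : w = 0 := inj (by rw [map_zero]; exact hw)
  rw [this, map_zero]

lemma Rp.map (φ : L' ⟶ L) {f : (L.X i).unop} {e : (L.homology i).unop} (h : Rp L i f e) :
    Rp L' i ((φ.f i).unop f) ((HomologicalComplex.homologyMap φ i).unop e) := by
  obtain ⟨w, rfl, rfl⟩ := h
  refine ⟨(HomologicalComplex.opcyclesMap φ i).unop w, ?_, ?_⟩
  · have : L'.pOpcycles i ≫ HomologicalComplex.opcyclesMap φ i = φ.f i ≫ L.pOpcycles i := by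
      simp
    have := congrArg (fun k => k.unop) this
    exact congrArg (fun k => k.hom w) this
  · have : L'.homologyι i ≫ HomologicalComplex.opcyclesMap φ i =
        HomologicalComplex.homologyMap φ i ≫ L.homologyι i := by
      simp
    have := congrArg (fun k => k.unop) this
    exact congrArg (fun k => k.hom w) this

abbrev FY (Y : ModuleCat.{0} R) : ModuleCat.{0} R ⥤ (ModuleCat.{0} R)ᵒᵖ :=
  ((linearYoneda R (ModuleCat.{0} R)).obj Y).rightOp

abbrev PC (X : ModuleCat.{0} R) : ChainComplex (ModuleCat.{0} R) ℕ :=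
  (projectiveResolution X).complex

abbrev KC (X Y : ModuleCat.{0} R) : ChainComplex (ModuleCat.{0} R)ᵒᵖ ℕ :=
  ((FY Y).mapHomologicalComplex (ComplexShape.down ℕ)).obj (PC X)

abbrev EX (i : ℕ) (X Y : ModuleCat.{0} R) : ModuleCat.{0} R :=
  ((Ext R (ModuleCat.{0} R) i).obj (op X)).obj Y

def isoH (i : ℕ) (X Y : ModuleCat.{0} R) :
    EX i X Y ≅ ((KC X Y).homology i).unop :=
  ((projectiveResolution X).isoLeftDerivedObj (FY Y) i).unop.symm

/-- `f : P_i ⟶ Y` represents the class `e` in `Ext^i(X,Y)`. -/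
def RepE (i : ℕ) (X Y : ModuleCat.{0} R) (f : (PC X).X i ⟶ Y) (e : EX i X Y) : Prop :=
  Rp (KC X Y) i f ((isoH i X Y).hom e)

variable {X X' Y Y' : ModuleCat.{0} R}

lemma isoH_inj : Function.Injective (isoH i X Y).hom :=
    (ModuleCat.mono_iff_injective _).1 inferInstance

lemma isoH_surj : Function.Surjective (isoH i X Y).hom :=
    (ModuleCat.epi_iff_surjective _).1 inferInstance

lemma RepE.unique {f : (PC X).X i ⟶ Y} {e e' : EX i X Y}
    (h : RepE i X Y f e) (h' : RepE i X Y f e') : e = e' :=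
  isoH_inj (Rp.unique h h')

lemma RepE.exists (e : EX i X Y) : ∃ f, RepE i X Y f e :=
  Rp.exists (L := KC X Y) ((isoH i X Y).hom e)

lemma RepE.add {f f' : (PC X).X i ⟶ Y} {e e' : EX i X Y}
    (h : RepE i X Y f e) (h' : RepE i X Y f' e') : RepE i X Y (f + f') (e + e') := by
  have := Rp.add h h'
  rw [← map_add] at this
  exact this

lemma RepE.smul {f : (PC X).X i ⟶ Y} {e : EX i X Y}
    (h : RepE i X Y f e) (a : R) : RepE i X Y (a • f) (a • e) := by
  have := Rp.smul h a
  rw [← map_smul] at this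
  exact this

lemma RepE.cocycle {f : (PC X).X i ⟶ Y} {e : EX i X Y}
    (h : RepE i X Y f e) : (PC X).d (i+1) i ≫ f = 0 := Rp.cocycle h

lemma RepE.of_cocycle {f : (PC X).X i ⟶ Y}
    (hf : (PC X).d (i+1) i ≫ f = 0) : ∃ e, RepE i X Y f e := by
  obtain ⟨e, he⟩ := Rp.of_cocycle (L := KC X Y) (f := f) hf
  obtain ⟨e, rfl⟩ := isoH_surj e
  exact ⟨e, he⟩

lemma RepE.zero_iff {f : (PC X).X (i+1) ⟶ Y}  :
    RepE (i+1) X Y f 0 ↔ ∃ g : (PC X).X i ⟶ Y, f = (PC X).d (i+1) i ≫ g := by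
  unfold RepE
  rw [map_zero]
  exact Rp.zero_iff

lemma RepE.zero_zero {f : (PC X).X 0 ⟶ Y} (h : RepE 0 X Y f 0) : f = 0 := by
  unfold RepE at h
  rw [map_zero] at h
  exact Rp.zero_zero h

lemma RepE.map (g : Y ⟶ Y') {f : (PC X).X i ⟶ Y} {e : EX i X Y}
    (h : RepE i X Y f e) :
    RepE i X Y' (f ≫ g) (((Ext R (ModuleCat.{0} R) i).obj (op X)).map g e) := by
  let α : FY Y' ⟶ FY Y := NatTrans.rightOp ((linearYoneda R (ModuleCat.{0} R)).map g)
  let φ : KC X Y' ⟶ KC X Y := (NatTrans.mapHomologicalComplex α _).app (PC X)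
  have h2 := ProjectiveResolution.leftDerived_app_eq α (projectiveResolution X) i
  have h2' := (Iso.inv_comp_eq _).2 h2
  have h3 : (isoH i X Y).hom ≫ (HomologicalComplex.homologyMap φ i).unop = 
     (((Ext R (ModuleCat.{0} R) i).obj (op X)).map g) ≫ (isoH i X Y').hom := by
    exact (congrArg (fun k => k.unop) h2').symm
  have := Rp.map φ h
  have h4 := congrArg (fun k => k.hom e) h3
  unfold RepE
  simp at h4
  rw [← h4]
  exact this

def lft (u : X ⟶ X') : PC X ⟶ PC X' :=
  ProjectiveResolution.lift u _ _

lemma lft_zero (u : X ⟶ X') :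
    (lft u).f 0 ≫ (projectiveResolution X').π.f 0 = (projectiveResolution X).π.f 0 ≫ u := 
  ProjectiveResolution.lift_commutes_zero _ _ _

lemma RepE.res (u : X ⟶ X') {f : (PC X').X i ⟶ Y} {e : EX i X' Y}
    (h : RepE i X' Y f e) :
    RepE i X Y ((lft u).f i ≫ f) (((Ext R (ModuleCat.{0} R) i).map u.op).app Y e) := by
  let φ : KC X Y ⟶ KC X' Y := ((FY Y).mapHomologicalComplex _).map (lft u)
  have h2 := ProjectiveResolution.isoLeftDerivedObj_inv_naturality u (projectiveResolution X)
    (projectiveResolution X') (lft u) (lft_zero u) (FY Y) i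
  have h3 : (isoH i X' Y).hom ≫ (HomologicalComplex.homologyMap φ i).unop = 
     (((Ext R (ModuleCat.{0} R) i).map u.op).app Y) ≫ (isoH i X Y).hom := by
    exact (congrArg (fun k => k.unop) h2).symm
  have := Rp.map φ h
  have h4 := congrArg (fun k => k.hom e) h3
  unfold RepE
  simp at h4
  rw [← h4]
  exact this

/-! ### Local cohomology -/

abbrev HH (J : Ideal R) (i : ℕ) : ModuleCat.{0} R ⥤ ModuleCat.{0} R := localCohomology J i

abbrev XX (J : Ideal R) (n : ℕ) : ModuleCat.{0} R := ModuleCat.of R (R ⧸ J ^ n)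

def tr (J : Ideal R) {n n' : ℕ} (h : n ≤ n') : XX J n' ⟶ XX J n :=
  ModuleCat.ofHom (Submodule.mapQ _ _ LinearMap.id (Ideal.pow_le_pow_right h))

variable {J : Ideal R}

abbrev DG (J : Ideal R) (i : ℕ) := localCohomology.diagram (localCohomology.idealPowersDiagram J) i

def rho (J : Ideal R) (n i : ℕ) (Y : ModuleCat.{0} R) : EX i (XX J n) Y ⟶ (HH J i).obj Y :=
  (colimit.ι (DG J i) (op (op n))).app Y

def isCol (J : Ideal R) (i : ℕ) (Y : ModuleCat.{0} R) :
    IsColimit (((evaluation _ _).obj Y).mapCocone (colimit.cocone (DG J i))) :=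
  isColimitOfPreserves ((evaluation _ _).obj Y) (colimit.isColimit (DG J i))

lemma rho_surj (h : (HH J i).obj Y) : ∃ n, ∃ e, rho J n i Y e = h := by
  obtain ⟨n, e, he⟩ := Concrete.isColimit_exists_rep _ (isCol J i Y) h
  exact ⟨n.unop.unop, e, he⟩

lemma rho_zero {n : ℕ} {e : EX i (XX J n) Y} (h : rho J n i Y e = 0) :
    ∃ n', ∃ hn : n ≤ n', ((Ext R (ModuleCat.{0} R) i).map (tr J hn).op).app Y e = 0 := by
  have h' : (((evaluation _ _).obj Y).mapCocone (colimit.cocone (DG J i))).ι.app (op (op n)) e =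
    (((evaluation _ _).obj Y).mapCocone (colimit.cocone (DG J i))).ι.app (op (op n)) 0 := by
      rw [map_zero]; exact h
  obtain ⟨k, f, g, hfg⟩ := Concrete.isColimit_exists_of_rep_eq _ (isCol J i Y) _ _ h'
  rw [map_zero] at hfg
  exact ⟨k.unop.unop, f.unop.unop.le, hfg⟩

lemma rho_tr {n n' : ℕ} (hn : n ≤ n') (e : EX i (XX J n) Y) :
    rho J n' i Y (((Ext R (ModuleCat.{0} R) i).map (tr J hn).op).app Y e) = rho J n i Y e := by
  have := congrArg (fun k => k.app Y) (colimit.w (DG J i) (homOfLE hn).op.op)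
  exact congrArg (fun k => k.hom e) this

lemma rho_map {n : ℕ} (g : Y ⟶ Y') (e : EX i (XX J n) Y) :
    rho J n i Y' (((Ext R (ModuleCat.{0} R) i).obj (op (XX J n))).map g e) =
      (HH J i).map g (rho J n i Y e) :=
  congrArg (fun k => k.hom e) ((colimit.ι (DG J i) (op (op n))).naturality g)

/-- the `i`-th term of the resolution of `R/J^n` -/
abbrev PP (J : Ideal R) (n : ℕ) : ChainComplex (ModuleCat.{0} R) ℕ := PC (XX J n)

/-- the transition maps of the resolutions -/
def trP (J : Ideal R) {n n' : ℕ} (h : n ≤ n') : PP J n' ⟶ PP J n := lft (tr J h)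

def Rep (J : Ideal R) (n i : ℕ) (Y : ModuleCat.{0} R) (f : (PP J n).X i ⟶ Y) (h : (HH J i).obj Y) : Prop :=
  ∃ e, RepE i (XX J n) Y f e ∧ rho J n i Y e = h

variable {n n' : ℕ}

lemma Rep.unique {f : (PP J n).X i ⟶ Y} {h h' : (HH J i).obj Y}
    (H : Rep J n i Y f h) (H' : Rep J n i Y f h') : h = h' := by
  obtain ⟨e, he, rfl⟩ := H
  obtain ⟨e', he', rfl⟩ := H'
  rw [he.unique he']

lemma Rep.exists (h : (HH J i).obj Y) : ∃ n f, Rep J n i Y f h := by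
  obtain ⟨n, e, rfl⟩ := rho_surj h
  obtain ⟨f, hf⟩ := RepE.exists e
  exact ⟨n, f, e, hf, rfl⟩

lemma Rep.add {f f' : (PP J n).X i ⟶ Y} {h h' : (HH J i).obj Y}
    (H : Rep J n i Y f h) (H' : Rep J n i Y f' h') : Rep J n i Y (f + f') (h + h') := by
  obtain ⟨e, he, rfl⟩ := H
  obtain ⟨e', he', rfl⟩ := H'
  exact ⟨_, he.add he', by simp⟩

lemma Rep.smul {f : (PP J n).X i ⟶ Y} {h : (HH J i).obj Y}
    (H : Rep J n i Y f h) (a : R) : Rep J n i Y (a • f) (a • h) := by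
  obtain ⟨e, he, rfl⟩ := H
  exact ⟨_, he.smul a, by simp⟩

lemma Rep.sub {f f' : (PP J n).X i ⟶ Y} {h h' : (HH J i).obj Y}
    (H : Rep J n i Y f h) (H' : Rep J n i Y f' h') : Rep J n i Y (f - f') (h - h') := by
  have := H.add (H'.smul (-1))
  simpa [sub_eq_add_neg] using this

lemma Rep.cocycle {f : (PP J n).X i ⟶ Y} {h : (HH J i).obj Y}
    (H : Rep J n i Y f h) : (PP J n).d (i+1) i ≫ f = 0 := by
  obtain ⟨e, he, rfl⟩ := H
  exact he.cocycle

lemma Rep.of_cocycle {f : (PP J n).X i ⟶ Y}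
    (hf : (PP J n).d (i+1) i ≫ f = 0) : ∃ h, Rep J n i Y f h := by
  obtain ⟨e, he⟩ := RepE.of_cocycle hf
  exact ⟨_, e, he, rfl⟩

lemma Rep.tr {f : (PP J n).X i ⟶ Y} {h : (HH J i).obj Y}
    (H : Rep J n i Y f h) (hn : n ≤ n') : Rep J n' i Y ((trP J hn).f i ≫ f) h := by
  obtain ⟨e, he, rfl⟩ := H
  exact ⟨_, he.res (LC.tr J hn), rho_tr hn e⟩

lemma Rep.map {f : (PP J n).X i ⟶ Y} {h : (HH J i).obj Y}
    (H : Rep J n i Y f h) (g : Y ⟶ Y') : Rep J n i Y' (f ≫ g) ((HH J i).map g h) := by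
  obtain ⟨e, he, rfl⟩ := H
  exact ⟨_, he.map g, rho_map g e⟩

lemma Rep.coboundary (g : (PP J n).X i ⟶ Y) : Rep J n (i+1) Y ((PP J n).d (i+1) i ≫ g) 0 :=
  ⟨0, RepE.zero_iff.2 ⟨g, rfl⟩, by simp⟩

lemma Rep.exists_of_zero {f : (PP J n).X (i+1) ⟶ Y} (H : Rep J n (i+1) Y f 0) :
    ∃ n', ∃ hn : n ≤ n', ∃ g : (PP J n').X i ⟶ Y, (trP J hn).f (i+1) ≫ f = (PP J n').d (i+1) i ≫ g := by
  obtain ⟨e, he, h⟩ := H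
  obtain ⟨n', hn, h0⟩ := rho_zero h
  have := he.res (LC.tr J hn)
  rw [h0] at this
  exact ⟨n', hn, RepE.zero_iff.1 this⟩

lemma Rep.zero_of_zero {f : (PP J n).X 0 ⟶ Y} (H : Rep J n 0 Y f 0) :
    ∃ n', ∃ hn : n ≤ n', (trP J hn).f 0 ≫ f = 0 := by
  obtain ⟨e, he, h⟩ := H
  obtain ⟨n', hn, h0⟩ := rho_zero h
  have := he.res (LC.tr J hn)
  rw [h0] at this
  exact ⟨n', hn, RepE.zero_zero this⟩

lemma Rep.zero : Rep J n i Y 0 0 := by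
  obtain ⟨h, hh⟩ := Rep.of_cocycle (J := J) (n := n) (i := i) (Y := Y) (f := 0) (by simp)
  simpa using hh.smul 0



end
end LC

namespace LC
open CategoryTheory IsLocalRing Opposite Limits
noncomputable section
variable {R : Type} [CommRing R] {J : Ideal R} {i n n' : ℕ} {X X' Y Y' : ModuleCat.{0} R}

/-! ### Linear maps from graphs -/

lemma exists_linearMap_of_graph {A B : Type} [AddCommGroup A] [Module R A] [AddCommGroup B]
    [Module R B] (G : Submodule R (A × B)) (h1 : ∀ a, ∃ b, (a, b) ∈ G)
    (h2 : ∀ b, (0, b) ∈ G → b = 0) :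
    ∃ f : A →ₗ[R] B, ∀ a b, (a, b) ∈ G ↔ f a = b := by
  choose f hf using h1
  have uniq : ∀ {a b b'}, (a, b) ∈ G → (a, b') ∈ G → b = b' := by
    intro a b b' h h'
    have := G.sub_mem h h'
    rw [Prod.mk_sub_mk, sub_self] at this
    exact sub_eq_zero.1 (h2 _ this)
  refine ⟨⟨⟨f, fun a a' => ?_⟩, fun r a => ?_⟩, fun a b => ⟨fun h => uniq (hf a) h, ?_⟩⟩
  · exact uniq (hf _) (by simpa using G.add_mem (hf a) (hf a'))
  · exact uniq (hf _) (by simpa using G.smul_mem r (hf a))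
  · rintro rfl
    exact hf a

/-! ### Long exact sequence -/

lemma exists_cob {f : (PP J n).X i ⟶ Y} (H : Rep J n i Y f 0) :
    ∃ n', ∃ hn : n ≤ n', ∃ g : (PP J n').X (i-1) ⟶ Y,
      (trP J hn).f i ≫ f = (PP J n').d i (i-1) ≫ g := by
  cases i with
  | zero =>
    obtain ⟨n', hn, h⟩ := H.zero_of_zero
    exact ⟨n', hn, 0, by simpa using h⟩
  | succ i => exact H.exists_of_zero

lemma rep_cob (g : (PP J n).X (i-1) ⟶ Y) : Rep J n i Y ((PP J n).d i (i-1) ≫ g) 0 := by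
  cases i with
  | zero => 
    have : (PP J n).d 0 (0-1) ≫ g = 0 := by simp
    rw [this]; exact Rep.zero
  | succ i => exact Rep.coboundary g

instance projPP (i : ℕ) : Projective ((PP J n).X i) := (projectiveResolution _).projective i

lemma exists_lift {A B C : ModuleCat.{0} R} {g : B ⟶ C} (hg : Function.Surjective g)
    (u : (PP J n).X i ⟶ C) : ∃ v : (PP J n).X i ⟶ B, v ≫ g = u := by
  have : Epi g := (ModuleCat.epi_iff_surjective _).2 hg
  exact ⟨Projective.factorThru u g, by simp⟩

lemma exists_fac {P A B C : ModuleCat.{0} R} {f : A ⟶ B} {g : B ⟶ C} (hf : Function.Injective f)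
    (hfg : Function.Exact f g) (u : P ⟶ B) (hu : u ≫ g = 0) : ∃ v : P ⟶ A, v ≫ f = u := by
  have h : ∀ x, u x ∈ LinearMap.range f.hom := fun x =>
    (hfg _).1 (congrArg (fun k => k.hom x) hu)
  refine ⟨ModuleCat.ofHom ((LinearEquiv.ofInjective f.hom hf).symm.toLinearMap ∘ₗ
    LinearMap.codRestrict _ u.hom h), ?_⟩
  ext x
  have := LinearEquiv.apply_symm_apply (LinearEquiv.ofInjective f.hom hf) ⟨u x, h x⟩
  exact congrArg Subtype.val this

section LES
variable {A B C : ModuleCat.{0} R} {f : A ⟶ B} {g : B ⟶ C}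

/-- middle exactness -/
lemma les_mid (hf : Function.Injective f)
    (hfg : Function.Exact f g) (hg : Function.Surjective g) (z : (HH J i).obj B)
    (hz : (HH J i).map g z = 0) : ∃ y, (HH J i).map f y = z := by
  obtain ⟨n, b, hb⟩ := Rep.exists z
  have h1 := hb.map g
  rw [hz] at h1
  obtain ⟨n', hn, c, hc⟩ := exists_cob h1
  obtain ⟨b', rfl⟩ := exists_lift (A := A) hg c
  have h2 := (hb.tr hn).sub (rep_cob b')
  rw [sub_zero] at h2
  obtain ⟨a, ha⟩ := exists_fac hf hfg ((trP J hn).f i ≫ b - (PP J n').d i (i-1) ≫ b')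
    (by simp only [Preadditive.sub_comp, Category.assoc, hc, sub_self])
  rw [← ha] at h2
  have hm : Mono f := (ModuleCat.mono_iff_injective _).2 hf
  obtain ⟨y, hy⟩ := Rep.of_cocycle (J := J) (n := n') (i := i) (Y := A) (f := a) (by
    have := h2.cocycle
    rw [← Category.assoc] at this
    exact zero_of_comp_mono f this)
  exact ⟨y, (hy.map f).unique h2⟩

variable (J i f g) in
/-- graph of the connecting map -/
def dRel (z : (HH J i).obj C) (y : (HH J (i+1)).obj A) : Prop :=
  ∃ n, ∃ b : (PP J n).X i ⟶ B, ∃ a : (PP J n).X (i+1) ⟶ A,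
    a ≫ f = (PP J n).d (i+1) i ≫ b ∧ Rep J n i C (b ≫ g) z ∧ Rep J n (i+1) A a y

lemma dRel_tr {z : (HH J i).obj C} {y : (HH J (i+1)).obj A} {n : ℕ}
    {b : (PP J n).X i ⟶ B} {a : (PP J n).X (i+1) ⟶ A}
    (h1 : a ≫ f = (PP J n).d (i+1) i ≫ b) (h2 : Rep J n i C (b ≫ g) z)
    (h3 : Rep J n (i+1) A a y) {n' : ℕ} (hn : n ≤ n') :
    ∃ b : (PP J n').X i ⟶ B, ∃ a : (PP J n').X (i+1) ⟶ A,
      a ≫ f = (PP J n').d (i+1) i ≫ b ∧ Rep J n' i C (b ≫ g) z ∧ Rep J n' (i+1) A a y := by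
  refine ⟨(trP J hn).f i ≫ b, (trP J hn).f (i+1) ≫ a, ?_, ?_, h3.tr hn⟩
  · rw [Category.assoc, h1]
    simp
  · have := h2.tr hn
    rwa [← Category.assoc] at this

variable (J i f g) in
def dGraph : Submodule R (((HH J i).obj C) × ((HH J (i+1)).obj A)) where
  carrier := {p | dRel J i f g p.1 p.2}
  add_mem' := by
    rintro ⟨z, y⟩ ⟨z', y'⟩ ⟨n, b, a, h1, h2, h3⟩ ⟨n', b', a', h1', h2', h3'⟩
    obtain ⟨b, a, h1, h2, h3⟩ := dRel_tr h1 h2 h3 (le_max_left n n')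
    obtain ⟨b', a', h1', h2', h3'⟩ := dRel_tr h1' h2' h3' (le_max_right n n')
    refine ⟨_, b + b', a + a', ?_, ?_, h3.add h3'⟩
    · simp [h1, h1']
    · rw [Preadditive.add_comp]
      exact h2.add h2'
  zero_mem' := ⟨0, 0, 0, by simp, by rw [zero_comp]; exact Rep.zero, Rep.zero⟩
  smul_mem' := by
    rintro r ⟨z, y⟩ ⟨n, b, a, h1, h2, h3⟩
    refine ⟨_, r • b, r • a, ?_, ?_, h3.smul r⟩
    · simp [h1]
    · rw [Linear.smul_comp]
      exact h2.smul r

lemma dRel_total (hf : Function.Injective f)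
    (hfg : Function.Exact f g) (hg : Function.Surjective g) (z : (HH J i).obj C) :
    ∃ y, dRel J i f g z y := by
  obtain ⟨n, c, hc⟩ := Rep.exists z
  obtain ⟨b, rfl⟩ := exists_lift (A := A) hg c
  obtain ⟨a, ha⟩ := exists_fac hf hfg ((PP J n).d (i+1) i ≫ b) (by
    rw [Category.assoc]; exact hc.cocycle)
  have hm : Mono f := (ModuleCat.mono_iff_injective _).2 hf
  obtain ⟨y, hy⟩ := Rep.of_cocycle (J := J) (n := n) (i := i+1) (Y := A) (f := a) (by
    apply zero_of_comp_mono f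
    rw [Category.assoc, ha]
    simp)
  exact ⟨y, n, b, a, ha, hc, hy⟩

/-- exactness at `H^i(C)`, and for `z = 0` single-valuedness -/
lemma dRel_zero (hf : Function.Injective f)
    (hfg : Function.Exact f g) (hg : Function.Surjective g) {y : (HH J (i+1)).obj A}
    (h : dRel J i f g 0 y) : y = 0 := by
  obtain ⟨n, b, a, h1, h2, h3⟩ := h
  obtain ⟨n', hn, c, hc⟩ := exists_cob h2
  obtain ⟨b', rfl⟩ := exists_lift (A := A) hg c
  obtain ⟨a', ha'⟩ := exists_fac hf hfg ((trP J hn).f i ≫ b - (PP J n').d i (i-1) ≫ b')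
    (by simp only [Preadditive.sub_comp, Category.assoc, hc, sub_self])
  have hm : Mono f := (ModuleCat.mono_iff_injective _).2 hf
  have : (trP J hn).f (i+1) ≫ a = (PP J n').d (i+1) i ≫ a' := by
    rw [← cancel_mono f, Category.assoc, Category.assoc, h1, ha']
    simp
  have h4 := h3.tr hn
  rw [this] at h4
  exact h4.unique (Rep.coboundary a')

lemma dRel_ker (hf : Function.Injective f)
    (hfg : Function.Exact f g) (hg : Function.Surjective g) {z : (HH J i).obj C}
    (h : dRel J i f g z 0) : ∃ x, (HH J i).map g x = z := by
  obtain ⟨n, b, a, h1, h2, h3⟩ := h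
  obtain ⟨n', hn, c, hc⟩ := Rep.exists_of_zero h3
  have hm : Mono f := (ModuleCat.mono_iff_injective _).2 hf
  have h4 := h2.tr hn
  have hw : f ≫ g = 0 := by ext x; exact hfg.apply_apply_eq_zero x
  obtain ⟨x, hx⟩ := Rep.of_cocycle (J := J) (n := n') (i := i) (Y := B)
    (f := (trP J hn).f i ≫ b - c ≫ f) (by
      rw [Preadditive.comp_sub, ← Category.assoc _ c, ← hc, Category.assoc, h1]
      simp)
  refine ⟨x, (hx.map g).unique ?_⟩
  rw [Preadditive.sub_comp, Category.assoc, Category.assoc, hw, comp_zero, sub_zero]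
  exact h4

lemma dRel_map (hfg : Function.Exact f g) (x : (HH J i).obj B) :
    dRel J i f g ((HH J i).map g x) 0 := by
  obtain ⟨n, b, hb⟩ := Rep.exists x
  exact ⟨n, b, 0, by rw [hb.cocycle, zero_comp], hb.map g, Rep.zero⟩

lemma dRel_map_f {z : (HH J i).obj C} {y : (HH J (i+1)).obj A} (h : dRel J i f g z y) :
    (HH J (i+1)).map f y = 0 := by
  obtain ⟨n, b, a, h1, h2, h3⟩ := h
  have := h3.map f
  rw [h1] at this
  exact this.unique (Rep.coboundary b)

lemma dRel_of_map_f (hfg : Function.Exact f g) {y : (HH J (i+1)).obj A} (h : (HH J (i+1)).map f y = 0) :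
    ∃ z, dRel J i f g z y := by
  obtain ⟨n, a, ha⟩ := Rep.exists y
  have h1 := ha.map f
  rw [h] at h1
  obtain ⟨n', hn, b, hb⟩ := Rep.exists_of_zero h1
  have hw : f ≫ g = 0 := by ext x; exact hfg.apply_apply_eq_zero x
  obtain ⟨z, hz⟩ := Rep.of_cocycle (J := J) (n := n') (i := i) (Y := C) (f := b ≫ g) (by
    rw [← Category.assoc, ← hb, Category.assoc, Category.assoc, hw]; simp)
  exact ⟨z, n', b, _, by rw [Category.assoc]; exact hb, hz, ha.tr hn⟩

lemma dRel_nat {A' B' C' : ModuleCat.{0} R} {f' : A' ⟶ B'} {g' : B' ⟶ C'} (u : A ⟶ A')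
    (v : B ⟶ B') (w : C ⟶ C') (hu : f ≫ v = u ≫ f') (hv : g ≫ w = v ≫ g')
    {z : (HH J i).obj C} {y : (HH J (i+1)).obj A} (h : dRel J i f g z y) :
    dRel J i f' g' ((HH J i).map w z) ((HH J (i+1)).map u y) := by
  obtain ⟨n, b, a, h1, h2, h3⟩ := h
  refine ⟨n, b ≫ v, a ≫ u, ?_, ?_, h3.map u⟩
  · rw [Category.assoc, ← hu, ← Category.assoc, h1, Category.assoc]
  · have := h2.map w
    rwa [Category.assoc, hv, ← Category.assoc] at this

end LES

/-! ### Vanishing on injectives, additivity and degree zero -/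

lemma inj_vanish (hY : Injective Y) (z : (HH J (i+1)).obj Y) : z = 0 := by
  obtain ⟨n, f, hf⟩ := Rep.exists z
  have hex := (projectiveResolution (XX J n)).exact_succ i
  have h1 := hf.cocycle
  have : f = (PP J n).d (i+1) i ≫ hex.descToInjective f h1 := (hex.comp_descToInjective f h1).symm
  rw [this] at hf
  exact hf.unique (Rep.coboundary _)

lemma HH_map_add (f g : Y ⟶ Y') (z : (HH J i).obj Y) :
    (HH J i).map (f + g) z = (HH J i).map f z + (HH J i).map g z := by
  obtain ⟨n, c, hc⟩ := Rep.exists z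
  have h1 := hc.map (f + g)
  rw [Preadditive.comp_add] at h1
  exact h1.unique ((hc.map f).add (hc.map g))

lemma HH_map_smul (a : R) (f : Y ⟶ Y') (z : (HH J i).obj Y) :
    (HH J i).map (a • f) z = a • (HH J i).map f z := by
  obtain ⟨n, c, hc⟩ := Rep.exists z
  have h1 := hc.map (a • f)
  rw [Linear.comp_smul] at h1
  exact h1.unique ((hc.map f).smul a)

abbrev ppi (J : Ideal R) (n : ℕ) : (PP J n).X 0 ⟶ XX J n := (projectiveResolution (XX J n)).π.f 0

instance : Epi (ppi J n) := by
  unfold ppi; exact inferInstanceAs (Epi ((projectiveResolution (XX J n)).π.f 0))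

lemma ppi_fac (f : (PP J n).X 0 ⟶ Y) (hf : (PP J n).d 1 0 ≫ f = 0) :
    ∃ g : XX J n ⟶ Y, f = ppi J n ≫ g := by
  let P := projectiveResolution (XX J n)
  exact ⟨(P.isColimitCokernelCofork).desc (CokernelCofork.ofπ f hf), 
    ((P.isColimitCokernelCofork).fac (CokernelCofork.ofπ f hf) WalkingParallelPair.one).symm⟩

lemma ppi_d : (PP J n).d 1 0 ≫ ppi J n = 0 := (projectiveResolution (XX J n)).complex_d_comp_π_f_zero

lemma trP_ppi (hn : n ≤ n') : (trP J hn).f 0 ≫ ppi J n = ppi J n' ≫ tr J hn := lft_zero _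

def zRel (J : Ideal R) (Y : ModuleCat.{0} R) (z : (HH J 0).obj Y) (m : Y) : Prop :=
  ∃ n, ∃ g : XX J n ⟶ Y, Rep J n 0 Y (ppi J n ≫ g) z ∧ g.hom (Ideal.Quotient.mk _ 1) = m

lemma tr_one (hn : n ≤ n') : (tr J hn).hom (Ideal.Quotient.mk _ 1) = Ideal.Quotient.mk _ 1 := rfl

lemma zRel_tr {z : (HH J 0).obj Y} {m : Y} {n : ℕ} {g : XX J n ⟶ Y}
    (h1 : Rep J n 0 Y (ppi J n ≫ g) z) (h2 : g.hom (Ideal.Quotient.mk _ 1) = m) (hn : n ≤ n') :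
    ∃ g : XX J n' ⟶ Y, Rep J n' 0 Y (ppi J n' ≫ g) z ∧ g.hom (Ideal.Quotient.mk _ 1) = m := by
  refine ⟨tr J hn ≫ g, ?_, h2⟩
  have := h1.tr hn
  rwa [← Category.assoc, trP_ppi, Category.assoc] at this

def zGraph (J : Ideal R) (Y : ModuleCat.{0} R) : Submodule R (((HH J 0).obj Y) × Y) where
  carrier := {p | zRel J Y p.1 p.2}
  add_mem' := by
    rintro ⟨z, y⟩ ⟨z', y'⟩ ⟨n, g, h1, h2⟩ ⟨n', g', h1', h2'⟩
    obtain ⟨g, h1, h2⟩ := zRel_tr h1 h2 (le_max_left n n')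
    obtain ⟨g', h1', h2'⟩ := zRel_tr h1' h2' (le_max_right n n')
    refine ⟨_, g + g', ?_, ?_⟩
    · rw [Preadditive.comp_add]
      exact h1.add h1'
    · exact congrArg₂ (· + ·) h2 h2'
  zero_mem' := ⟨0, 0, by rw [comp_zero]; exact Rep.zero, by simp⟩
  smul_mem' := by
    rintro r ⟨z, y⟩ ⟨n, g, h1, h2⟩
    refine ⟨_, r • g, ?_, ?_⟩
    · rw [Linear.comp_smul]
      exact h1.smul r
    · exact congrArg (r • ·) h2

lemma XX_hom_ext {g g' : XX J n ⟶ Y}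
    (h : g.hom (Ideal.Quotient.mk _ 1) = g'.hom (Ideal.Quotient.mk _ 1)) : g = g' := by
  apply ModuleCat.hom_ext
  apply Submodule.linearMap_qext
  apply LinearMap.ext_ring
  exact h

/-- `H^0` is the torsion submodule -/
lemma exists_e (J : Ideal R) (Y : ModuleCat.{0} R) : ∃ e : ((HH J 0).obj Y) →ₗ[R] Y,
    ∀ z m, zRel J Y z m ↔ e z = m := by
  refine exists_linearMap_of_graph (zGraph J Y) ?_ ?_
  · intro z
    obtain ⟨n, f, hf⟩ := Rep.exists z
    obtain ⟨g, rfl⟩ := ppi_fac f hf.cocycle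
    exact ⟨_, n, g, hf, rfl⟩
  · rintro m ⟨n, g, h1, rfl⟩
    obtain ⟨n', hn, h⟩ := Rep.zero_of_zero h1
    rw [← Category.assoc, trP_ppi, Category.assoc] at h
    have h3 := zero_of_epi_comp _ h
    exact congrArg (fun k => k.hom (Ideal.Quotient.mk _ 1)) h3

def ee (J : Ideal R) (Y : ModuleCat.{0} R) : ((HH J 0).obj Y) →ₗ[R] Y := (exists_e J Y).choose
lemma ee_spec (z m) : zRel J Y z m ↔ ee J Y z = m := (exists_e J Y).choose_spec z m

lemma ee_inj : Function.Injective (ee J Y) := by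
  rw [injective_iff_map_eq_zero]
  intro z hz
  obtain ⟨n, g, h1, h2⟩ := (ee_spec z 0).2 hz
  have : g = 0 := XX_hom_ext (by rw [h2]; rfl)
  subst this
  rw [comp_zero] at h1
  exact h1.unique Rep.zero

lemma ee_range (m : Y) : (∃ z, ee J Y z = m) ↔ ∃ n, ∀ a ∈ J ^ n, a • m = 0 := by
  constructor
  · rintro ⟨z, hz⟩
    obtain ⟨n, g, h1, rfl⟩ := (ee_spec z m).2 hz
    refine ⟨n, fun a ha => ?_⟩
    rw [← map_smul]
    have : a • (Ideal.Quotient.mk (J ^ n) 1) = 0 := by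
      rw [← Ideal.Quotient.mk_eq_mk, ← Submodule.Quotient.mk_smul, Submodule.Quotient.mk_eq_zero]
      simpa using ha
    rw [this, map_zero]
  · rintro ⟨n, h⟩
    let g : XX J n ⟶ Y := ModuleCat.ofHom (Submodule.liftQ (J ^ n) (LinearMap.toSpanSingleton R Y m)
      (fun a ha => h a ha))
    obtain ⟨z, hz⟩ := Rep.of_cocycle (J := J) (n := n) (i := 0) (Y := Y) (f := ppi J n ≫ g)
      (by rw [← Category.assoc, ppi_d, zero_comp])
    refine ⟨z, (ee_spec z m).1 ⟨n, g, hz, ?_⟩⟩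
    exact (Submodule.liftQ_apply _ _ _).trans (one_smul _ _)

lemma ee_nat (g : Y ⟶ Y') (z : (HH J 0).obj Y) : ee J Y' ((HH J 0).map g z) = g (ee J Y z) := by
  obtain ⟨n, c, h1, h2⟩ := (ee_spec z _).2 rfl
  rw [← ee_spec]
  refine ⟨n, c ≫ g, ?_, ?_⟩
  · have := h1.map g
    rwa [Category.assoc] at this
  · rw [← h2]; rfl



end
end LC

namespace LC
open CategoryTheory IsLocalRing Opposite Limits
noncomputable section
variable {R : Type} [CommRing R] {J : Ideal R} {i n n' : ℕ} {X X' Y Y' : ModuleCat.{0} R}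

/-! ### Unbundled interface -/

section unb

/-- local cohomology of an unbundled module -/
abbrev Hc (J : Ideal R) (i : ℕ) (M : Type) [AddCommGroup M] [Module R M] : Type :=
  (HH J i).obj (ModuleCat.of R M)

variable {M N P : Type} [AddCommGroup M] [Module R M] [AddCommGroup N] [Module R N]
  [AddCommGroup P] [Module R P]

/-- functoriality -/
def Hm (J : Ideal R) (i : ℕ) (f : M →ₗ[R] N) : Hc J i M →ₗ[R] Hc J i N :=
  ((HH J i).map (ModuleCat.ofHom f)).hom

lemma Hm_comp (g : N →ₗ[R] P) (f : M →ₗ[R] N) (z : Hc J i M) :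
    Hm J i (g ∘ₗ f) z = Hm J i g (Hm J i f z) := by
  have : ModuleCat.ofHom (g ∘ₗ f) = ModuleCat.ofHom f ≫ ModuleCat.ofHom g := rfl
  unfold Hm
  rw [this, Functor.map_comp]
  rfl

lemma Hm_id (z : Hc J i M) : Hm J i (LinearMap.id : M →ₗ[R] M) z = z := by
  have : ModuleCat.ofHom (LinearMap.id : M →ₗ[R] M) = 𝟙 _ := rfl
  unfold Hm
  rw [this, CategoryTheory.Functor.map_id]
  rfl

lemma Hm_add (f g : M →ₗ[R] N) (z : Hc J i M) : Hm J i (f + g) z = Hm J i f z + Hm J i g z :=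
  HH_map_add _ _ z

lemma Hm_smul (a : R) (f : M →ₗ[R] N) (z : Hc J i M) : Hm J i (a • f) z = a • Hm J i f z :=
  HH_map_smul _ _ z

lemma Hm_zero (z : Hc J i M) : Hm J i (0 : M →ₗ[R] N) z = 0 := by
  have := Hm_smul (0 : R) (0 : M →ₗ[R] N) z
  rwa [zero_smul, zero_smul] at this

lemma Hm_sum {ι : Type} (s : Finset ι) (f : ι → (M →ₗ[R] N)) (z : Hc J i M) :
    Hm J i (∑ k ∈ s, f k) z = ∑ k ∈ s, Hm J i (f k) z := by
  classical
  induction s using Finset.induction_on with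
  | empty => simp [Hm_zero]
  | insert a s ha ih => rw [Finset.sum_insert ha, Finset.sum_insert ha, Hm_add, ih]

variable {f : M →ₗ[R] N} {g : N →ₗ[R] P} 

lemma Hm_exact_mid (hf : Function.Injective f) (hfg : Function.Exact f g)
    (hg : Function.Surjective g) : Function.Exact (Hm J i f) (Hm J i g) := by
  intro z
  refine ⟨fun hz => les_mid (f := ModuleCat.ofHom f) (g := ModuleCat.ofHom g) hf hfg hg z hz, ?_⟩
  rintro ⟨y, rfl⟩
  rw [← Hm_comp, hfg.linearMap_comp_eq_zero, Hm_zero]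

lemma exists_del (J : Ideal R) (i : ℕ) (hf : Function.Injective f) (hfg : Function.Exact f g)
    (hg : Function.Surjective g) : ∃ D : Hc J i P →ₗ[R] Hc J (i+1) M, ∀ z y,
      dRel J i (ModuleCat.ofHom f) (ModuleCat.ofHom g) z y ↔ D z = y := by
  refine exists_linearMap_of_graph (dGraph J i (ModuleCat.ofHom f) (ModuleCat.ofHom g)) ?_ ?_
  · exact fun z => dRel_total (f := ModuleCat.ofHom f) (g := ModuleCat.ofHom g) hf hfg hg z
  · exact fun y h => dRel_zero (f := ModuleCat.ofHom f) (g := ModuleCat.ofHom g) hf hfg hg h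

/-- the connecting map -/
def del (J : Ideal R) (i : ℕ) (hf : Function.Injective f) (hfg : Function.Exact f g)
    (hg : Function.Surjective g) : Hc J i P →ₗ[R] Hc J (i+1) M :=
  (exists_del J i hf hfg hg).choose

lemma del_spec (hf : Function.Injective f) (hfg : Function.Exact f g)
    (hg : Function.Surjective g) (z : Hc J i P) (y : Hc J (i+1) M) :
      dRel J i (ModuleCat.ofHom f) (ModuleCat.ofHom g) z y ↔ del J i hf hfg hg z = y :=
  (exists_del J i hf hfg hg).choose_spec z y

lemma del_exact (hf : Function.Injective f) (hfg : Function.Exact f g)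
    (hg : Function.Surjective g) : Function.Exact (Hm J i g) (del J i hf hfg hg) := by
  intro z
  refine ⟨fun hz => dRel_ker (f := ModuleCat.ofHom f) (g := ModuleCat.ofHom g) hf hfg hg
    ((del_spec hf hfg hg _ _).2 hz), ?_⟩
  rintro ⟨x, rfl⟩
  exact (del_spec hf hfg hg _ _).1 (dRel_map (f := ModuleCat.ofHom f) (g := ModuleCat.ofHom g) hfg x)

lemma exact_del (hf : Function.Injective f) (hfg : Function.Exact f g)
    (hg : Function.Surjective g) : Function.Exact (del J i hf hfg hg) (Hm J (i+1) f) := by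
  intro y
  constructor
  · intro hy
    obtain ⟨z, hz⟩ := dRel_of_map_f (f := ModuleCat.ofHom f) (g := ModuleCat.ofHom g) hfg hy
    exact ⟨z, (del_spec hf hfg hg _ _).1 hz⟩
  · rintro ⟨z, rfl⟩
    exact dRel_map_f ((del_spec hf hfg hg _ _).2 rfl)

lemma del_nat {M' N' P' : Type} [AddCommGroup M'] [Module R M'] [AddCommGroup N'] [Module R N']
    [AddCommGroup P'] [Module R P'] {f' : M' →ₗ[R] N'} {g' : N' →ₗ[R] P'}
    (hf : Function.Injective f) (hfg : Function.Exact f g)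
    (hg : Function.Surjective g) (hf' : Function.Injective f') (hfg' : Function.Exact f' g')
    (hg' : Function.Surjective g') (u : M →ₗ[R] M') (v : N →ₗ[R] N') (w : P →ₗ[R] P')
    (hu : v ∘ₗ f = f' ∘ₗ u) (hv : w ∘ₗ g = g' ∘ₗ v) (z : Hc J i P) :
    del J i hf' hfg' hg' (Hm J i w z) = Hm J (i+1) u (del J i hf hfg hg z) := by
  rw [← del_spec]
  exact dRel_nat (ModuleCat.ofHom u) (ModuleCat.ofHom v) (ModuleCat.ofHom w)
    (ModuleCat.hom_ext hu) (ModuleCat.hom_ext hv) ((del_spec hf hfg hg _ _).2 rfl)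

/-- `H^0` as a submodule -/
def e0 (J : Ideal R) (M : Type) [AddCommGroup M] [Module R M] : Hc J 0 M →ₗ[R] M :=
  ee J (ModuleCat.of R M)

lemma e0_inj : Function.Injective (e0 J M) := ee_inj
lemma e0_range (m : M) : (∃ z, e0 J M z = m) ↔ ∃ n, ∀ a ∈ J ^ n, a • m = 0 :=
  ee_range (Y := ModuleCat.of R M) m
lemma e0_nat (f : M →ₗ[R] N) (z : Hc J 0 M) : e0 J N (Hm J 0 f z) = f (e0 J M z) :=
  ee_nat (ModuleCat.ofHom f) z

lemma Hm_zero_inj (hf : Function.Injective f) : Function.Injective (Hm J 0 f) := by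
  rw [injective_iff_map_eq_zero]
  intro z hz
  apply e0_inj
  apply hf
  rw [← e0_nat, hz]; simp

end unb



end
end LC

namespace LC
open CategoryTheory IsLocalRing Opposite Limits
noncomputable section
variable {R : Type} [CommRing R] {J : Ideal R} {i n n' : ℕ} {X X' Y Y' : ModuleCat.{0} R}

/-! ### Torsion -/

section tors
variable {M N P : Type} [AddCommGroup M] [Module R M] [AddCommGroup N] [Module R N]
  [AddCommGroup P] [Module R P]

/-- the `J`-power torsion submodule -/
def gam (J : Ideal R) (M : Type) [AddCommGroup M] [Module R M] : Submodule R M where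
  carrier := {m | ∃ n, ∀ a ∈ J ^ n, a • m = 0}
  add_mem' := by
    rintro a b ⟨n, hn⟩ ⟨n', hn'⟩
    refine ⟨n + n', fun c hc => ?_⟩
    rw [smul_add, hn _ (Ideal.pow_le_pow_right (by omega) hc),
      hn' _ (Ideal.pow_le_pow_right (by omega) hc), add_zero]
  zero_mem' := ⟨0, by simp⟩
  smul_mem' := by
    rintro r m ⟨n, hn⟩
    exact ⟨n, fun c hc => by rw [smul_comm, hn _ hc, smul_zero]⟩

lemma mem_gam {m : M} : m ∈ gam J M ↔ ∃ n, ∀ a ∈ J ^ n, a • m = 0 := Iff.rfl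

lemma fg_tors (K : Submodule R M) (hK : K.FG) (h : K ≤ gam J M) :
    ∃ n, ∀ a ∈ J ^ n, ∀ m ∈ K, a • m = 0 := by
  obtain ⟨s, rfl⟩ := hK
  classical
  induction s using Finset.induction_on with
  | empty => exact ⟨0, by simp⟩
  | insert x s hx ih =>
    rw [Finset.coe_insert, Submodule.span_insert] at h ⊢
    obtain ⟨n, hn⟩ := ih (le_sup_right.trans h)
    obtain ⟨n', hn'⟩ := h (Submodule.mem_sup_left (Submodule.mem_span_singleton_self x))
    refine ⟨n + n', fun a ha m hm => ?_⟩
    obtain ⟨y, hy, z, hz, rfl⟩ := Submodule.mem_sup.1 hm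
    obtain ⟨r, rfl⟩ := Submodule.mem_span_singleton.1 hy
    rw [smul_add, smul_comm, hn' _ (Ideal.pow_le_pow_right (by omega) ha),
      hn _ (Ideal.pow_le_pow_right (by omega) ha) _ hz, smul_zero, add_zero]

lemma gam_injective [IsNoetherianRing R] (E : Type) [AddCommGroup E] [Module R E]
    [hE : Module.Injective R E] : Module.Injective R (gam J E) := by
  apply Module.Baer.injective
  intro I g
  obtain ⟨n, hn⟩ := fg_tors (J := J) (LinearMap.range ((gam J E).subtype ∘ₗ g))
    (by rw [LinearMap.range_eq_map]; exact (IsNoetherian.noetherian _).map _) (by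
      rintro _ ⟨x, rfl⟩
      exact (g x).2)
  obtain ⟨k, hk⟩ := Ideal.exists_pow_inf_eq_pow_smul (M := R) J I
  let p : I →ₗ[R] (R ⧸ J ^ (n + k)) := (Submodule.mkQ (J ^ (n+k))) ∘ₗ I.subtype
  have hg : LinearMap.ker p ≤ LinearMap.ker ((gam J E).subtype ∘ₗ g) := by
    intro x hx
    have hx1 : (x : R) ∈ J ^ (n + k) := by
      have : (Submodule.mkQ (J ^ (n+k))) (x : R) = 0 := hx
      rwa [Submodule.mkQ_apply, Submodule.Quotient.mk_eq_zero] at this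
    have hx2 : (x : R) ∈ J ^ (n+k) • (⊤ : Submodule R R) ⊓ I := ⟨by simpa using hx1, x.2⟩
    rw [hk (n+k) (by omega), Nat.add_sub_cancel] at hx2
    have hx3 : (x : R) ∈ J ^ n • I := Submodule.smul_mono le_rfl inf_le_right hx2
    have hx4 : x ∈ J ^ n • (⊤ : Submodule R I) := by
      have : (J ^ n • (⊤ : Submodule R I)).map I.subtype = J ^ n • I := by
        rw [Submodule.map_smul'', Submodule.map_top, Submodule.range_subtype]
      rw [← this] at hx3
      obtain ⟨y, hy, hxy⟩ := hx3
      rwa [← Subtype.ext hxy]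
    refine Submodule.smul_induction_on hx4 ?_ ?_
    · intro r hr m _
      rw [LinearMap.mem_ker, map_smul]
      exact hn r hr _ ⟨m, rfl⟩
    · intro a b ha hb
      exact Submodule.add_mem _ ha hb
  obtain ⟨h, hh⟩ := hE.out (Submodule.liftQ (LinearMap.ker p) p le_rfl)
    (LinearMap.ker_eq_bot.1 (Submodule.ker_liftQ_eq_bot _ _ _ le_rfl))
    (Submodule.liftQ (LinearMap.ker p) ((gam J E).subtype ∘ₗ g) hg)
  refine ⟨LinearMap.codRestrict (gam J E) (h ∘ₗ Submodule.mkQ (J ^ (n+k))) ?_, ?_⟩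
  · intro c
    refine ⟨n + k, fun a ha => ?_⟩
    rw [← map_smul]
    have : (Submodule.mkQ (J ^ (n+k))) (a • c) = 0 := by
      rw [Submodule.mkQ_apply, Submodule.Quotient.mk_eq_zero]
      exact Ideal.mul_mem_right c _ ha
    rw [LinearMap.comp_apply, this, map_zero]
  · intro x hx
    apply Subtype.ext
    exact hh (Submodule.Quotient.mk ⟨x, hx⟩)

/-- every torsion module embeds in a torsion injective module -/
lemma exists_tors_inj [IsNoetherianRing R] (hM : ∀ m : M, m ∈ gam J M) :
    ∃ (E : Type) (_ : AddCommGroup E) (_ : Module R E) (f : M →ₗ[R] E), Function.Injective f ∧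
      Module.Injective R E ∧ ∀ e : E, e ∈ gam J E := by
  let X := ModuleCat.of R M
  let E := Injective.under X
  have hE : Module.Injective R E := by
    have : Injective (ModuleCat.of R E) := inferInstanceAs (Injective (Injective.under X))
    exact Module.injective_module_of_injective_object R E
  have hi : Function.Injective (Injective.ι X) := (ModuleCat.mono_iff_injective _).1 inferInstance
  refine ⟨gam J E, inferInstance, inferInstance, LinearMap.codRestrict (gam J E)
    (Injective.ι X).hom ?_, ?_, gam_injective E, ?_⟩
  · intro m
    obtain ⟨n, hn⟩ := hM m
    refine ⟨n, fun a ha => ?_⟩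
    have := congrArg (Injective.ι X).hom (hn a ha)
    rw [map_smul, map_zero] at this
    exact this
  · intro a b hab
    exact hi (congrArg Subtype.val hab)
  · rintro ⟨e, n, hn⟩
    exact ⟨n, fun a ha => Subtype.ext (hn a ha)⟩

lemma tors_vanish [IsNoetherianRing R] (i : ℕ) : ∀ (M : Type) [AddCommGroup M] [Module R M]
    (_ : ∀ m : M, m ∈ gam J M) (z : Hc J (i+1) M), z = 0 := by
  induction i with
  | zero =>
    intro M _ _ hM z
    obtain ⟨E, _, _, f, hf, hE, hE2⟩ := exists_tors_inj hM
    let p := (LinearMap.range f).mkQ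
    have hfp : Function.Exact f p := LinearMap.exact_map_mkQ_range f
    have hp : Function.Surjective p := Submodule.mkQ_surjective _
    have h0 : Hm J 1 f z = 0 := inj_vanish (Module.injective_object_of_injective_module R E) _
    obtain ⟨c, rfl⟩ := (exact_del hf hfp hp z).1 h0
    rw [del_exact hf hfp hp c]
    obtain ⟨e, he⟩ := hp (e0 J _ c)
    obtain ⟨b, rfl⟩ := (e0_range (J := J) e).2 (hE2 e)
    exact ⟨b, e0_inj (by rw [e0_nat, he])⟩
  | succ i ih =>
    intro M _ _ hM z
    obtain ⟨E, _, _, f, hf, hE, hE2⟩ := exists_tors_inj hM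
    let p := (LinearMap.range f).mkQ
    have hfp : Function.Exact f p := LinearMap.exact_map_mkQ_range f
    have hp : Function.Surjective p := Submodule.mkQ_surjective _
    have h0 : Hm J (i+1+1) f z = 0 := inj_vanish (Module.injective_object_of_injective_module R E) _
    obtain ⟨c, rfl⟩ := (exact_del hf hfp hp z).1 h0
    rw [ih _ _ c, map_zero]
    intro q
    obtain ⟨e, rfl⟩ := hp q
    obtain ⟨n, hn⟩ := hE2 e
    exact ⟨n, fun a ha => by rw [← map_smul, hn a ha, map_zero]⟩

/-- `M → M/Γ(M)` induces isomorphisms in positive degrees -/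
lemma Hm_mk_bij [IsNoetherianRing R] (i : ℕ) :
    Function.Bijective (Hm J (i+1) (gam J M).mkQ) := by
  have hf : Function.Injective (gam J M).subtype := Subtype.val_injective
  have hfg : Function.Exact (gam J M).subtype (gam J M).mkQ :=  LinearMap.exact_subtype_mkQ _
  have hg : Function.Surjective (gam J M).mkQ := Submodule.mkQ_surjective _
  have ht : ∀ m : gam J M, m ∈ gam J (gam J M) := by
    rintro ⟨e, n, hn⟩
    exact ⟨n, fun a ha => Subtype.ext (hn a ha)⟩
  constructor
  · rw [injective_iff_map_eq_zero]
    intro z hz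
    obtain ⟨y, rfl⟩ := (Hm_exact_mid hf hfg hg z).1 hz
    rw [tors_vanish _ _ ht y, map_zero]
  · intro z
    exact (del_exact hf hfg hg z).1 (tors_vanish _ _ ht _)

lemma gam_quot [IsNoetherianRing R] [Module.Finite R M] {q : M ⧸ gam J M}
    (hq : q ∈ gam J (M ⧸ gam J M)) : q = 0 := by
  obtain ⟨m, rfl⟩ := Submodule.mkQ_surjective _ q
  obtain ⟨n, hn⟩ := hq
  obtain ⟨n', hn'⟩ := fg_tors (J := J) (gam J M) (IsNoetherian.noetherian _) le_rfl
  suffices m ∈ gam J M by simpa using this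
  refine ⟨n' + n, fun a ha => ?_⟩
  rw [pow_add] at ha
  refine Submodule.mul_induction_on ha ?_ ?_
  · intro b hb c hc
    rw [mul_smul]
    apply hn' b hb
    have := hn c hc
    rwa [← map_smul, Submodule.mkQ_apply, Submodule.Quotient.mk_eq_zero] at this
  · intro x y hx hy
    rw [add_smul, hx, hy, add_zero]

lemma H0_quot [IsNoetherianRing R] [Module.Finite R M] (z : Hc J 0 (M ⧸ gam J M)) : z = 0 := by
  apply e0_inj
  rw [map_zero]
  exact gam_quot ((e0_range _).1 ⟨z, rfl⟩)

end tors



end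
end LC

namespace LC
open CategoryTheory IsLocalRing Opposite Limits
noncomputable section
variable {R : Type} [CommRing R] {J : Ideal R} {i n n' : ℕ} {X X' Y Y' : ModuleCat.{0} R}

/-! ### Splitting -/

section split
variable {M M' : Type} [AddCommGroup M] [Module R M] [AddCommGroup M'] [Module R M']

lemma exists_sum_of_mem_mul {I K : Ideal R} {x : R} (hx : x ∈ I * K) :
    ∃ (k : Type) (_ : Fintype k) (a b : k → R), (∀ i, a i ∈ I) ∧ (∀ i, b i ∈ K) ∧
      x = ∑ i, a i * b i := by
  refine Submodule.mul_induction_on hx ?_ ?_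
  · intro m hm n hn
    exact ⟨Unit, inferInstance, fun _ => m, fun _ => n, fun _ => hm, fun _ => hn, by simp⟩
  · rintro x y ⟨k, _, a, b, ha, hb, rfl⟩ ⟨k', _, a', b', ha', hb', rfl⟩
    refine ⟨k ⊕ k', inferInstance, Sum.elim a a', Sum.elim b b', ?_, ?_, by simp⟩
    · rintro (i | i)
      · exact ha i
      · exact ha' i
    · rintro (i | i)
      · exact hb i
      · exact hb' i

lemma split_core [IsNoetherianRing R] [Module.Finite R M] {n0 j : ℕ} {x : R}
    (h0 : ∀ a ∈ J ^ n0, ∀ z : Hc J 0 M, a • z = 0)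
    (hj : ∀ a ∈ J ^ n0, ∀ z : Hc J j M, a • z = 0)
    (hx : x ∈ J ^ (2 * n0)) (hreg : ∀ m : M, x • m = 0 → m ∈ gam J M)
    (q : M →ₗ[R] M') (hq : Function.Surjective q)
    (hxq : Function.Exact (x • (LinearMap.id : M →ₗ[R] M)) q) :
    ∃ (t : Hc J j M' →ₗ[R] Hc J (j+1) M)
      (s : Submodule.torsionBySet R (Hc J (j+1) M) ((J ^ n0 : Ideal R) : Set R) →ₗ[R] Hc J j M'),
      Function.Injective (Hm J j q) ∧ Function.Exact (Hm J j q) t ∧ ∀ v, t (s v) = v := by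
  have hx1 : x ∈ J ^ n0 := Ideal.pow_le_pow_right (by omega) hx
  have hT : ∀ a ∈ J ^ n0, ∀ m ∈ gam J M, a • m = 0 := by
    intro a ha m hm
    obtain ⟨z, rfl⟩ := (e0_range m).2 hm
    rw [← map_smul, h0 a ha, map_zero]
  rw [two_mul, pow_add] at hx
  obtain ⟨k, _, a, b, ha, hb, hab⟩ := exists_sum_of_mem_mul hx
  classical
  -- the maps
  let π := (gam J M).mkQ
  have hπ : Function.Surjective π := Submodule.mkQ_surjective _
  let ξ : (M ⧸ gam J M) →ₗ[R] M := (gam J M).liftQ (x • LinearMap.id)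
    (fun m hm => LinearMap.mem_ker.2 (hT x hx1 m hm))
  have hξπ : ξ ∘ₗ π = x • LinearMap.id := Submodule.liftQ_mkQ _ _ _
  have hξπ' : ∀ m, ξ (π m) = x • m := fun m => congrArg (fun k => k m) hξπ
  have hξ : Function.Injective ξ := by
    rw [injective_iff_map_eq_zero]
    intro y hy
    obtain ⟨m, rfl⟩ := hπ y
    rw [hξπ'] at hy
    exact (Submodule.Quotient.mk_eq_zero _).2 (hreg m hy)
  have hξq : Function.Exact ξ q := by
    intro m
    rw [hxq m]
    constructor
    · rintro ⟨y, rfl⟩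
      exact ⟨π y, hξπ' y⟩
    · rintro ⟨y, rfl⟩
      obtain ⟨m, rfl⟩ := hπ y
      exact ⟨m, (hξπ' m).symm⟩
  let β : (M ⧸ gam J M) →ₗ[R] (k → M) := (gam J M).liftQ (∑ i, b i • LinearMap.single R (fun _ => M) i) (by
    intro m hm
    rw [LinearMap.mem_ker, LinearMap.sum_apply]
    refine Finset.sum_eq_zero fun i _ => ?_
    rw [LinearMap.smul_apply, ← map_smul, hT _ (hb i) m hm, map_zero])
  have hβπ : β ∘ₗ π = ∑ i, b i • LinearMap.single R (fun _ => M) i := Submodule.liftQ_mkQ _ _ _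
  let α : (k → M) →ₗ[R] M := ∑ i, a i • LinearMap.proj i
  have hαβ : α ∘ₗ β = ξ := by
    apply Submodule.linearMap_qext
    change α ∘ₗ (β ∘ₗ π) = ξ ∘ₗ π
    rw [hβπ, hξπ]
    ext m
    simp only [α, LinearMap.comp_apply, LinearMap.sum_apply, LinearMap.smul_apply,
      LinearMap.proj_apply, Finset.sum_apply, Pi.smul_apply, LinearMap.single_apply, LinearMap.id_apply]
    rw [hab, Finset.sum_smul]
    refine Finset.sum_congr rfl fun i _ => ?_
    rw [Finset.sum_eq_single i, Pi.single_eq_same, mul_smul]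
    · intro l _ hl
      rw [Pi.single_eq_of_ne hl.symm, smul_zero]
    · simp
  have hβ : Function.Injective β := by
    intro y y' h
    apply hξ
    rw [← hαβ, LinearMap.comp_apply, LinearMap.comp_apply, h]
  let p := (LinearMap.range β).mkQ
  have hp : Function.Surjective p := Submodule.mkQ_surjective _
  have hβp : Function.Exact β p := LinearMap.exact_map_mkQ_range β
  let α' : ((k → M) ⧸ LinearMap.range β) →ₗ[R] M' := (LinearMap.range β).liftQ (q ∘ₗ α) (by
    rintro _ ⟨y, rfl⟩
    have : α (β y) = ξ y := congrArg (fun k => k y) hαβ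
    rw [LinearMap.mem_ker, LinearMap.comp_apply, this]
    exact hξq.apply_apply_eq_zero y)
  have hα'p : α' ∘ₗ p = q ∘ₗ α := Submodule.liftQ_mkQ _ _ _
  have hHα : ∀ z, Hm J j α z = 0 := by
    intro z
    rw [Hm_sum]
    refine Finset.sum_eq_zero fun i _ => ?_
    rw [Hm_smul, hj _ (ha i)]
  have hHβ : ∀ v : Hc J (j+1) M, (∀ c ∈ J ^ n0, c • v = 0) → Hm J (j+1) β (Hm J (j+1) π v) = 0 := by
    intro v hv
    rw [← Hm_comp, hβπ, Hm_sum]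
    refine Finset.sum_eq_zero fun i _ => ?_
    rw [Hm_smul, ← map_smul, hv _ (hb i), map_zero]
  have hHp : ∀ z, Hm J j α' (Hm J j p z) = 0 := by
    intro z
    rw [← Hm_comp, hα'p, Hm_comp, hHα, map_zero]
  let δ := del J j hξ hξq hq
  let δC := del J j hβ hβp hp
  have hδ : ∀ c, δ (Hm J j α' c) = δC c := by
    intro c
    refine (del_nat hβ hβp hp hξ hξq hq LinearMap.id α α' ?_ hα'p c).trans (Hm_id _)
    rw [hαβ, LinearMap.comp_id]
  have hbij : Function.Bijective (Hm J (j+1) π) := Hm_mk_bij j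
  let ε := LinearEquiv.ofBijective (Hm J (j+1) π) hbij
  let W := Submodule.torsionBySet R (Hc J (j+1) M) ((J ^ n0 : Ideal R) : Set R)
  let G : Submodule R (W × Hc J j M') :=
    { carrier := {vw | ∃ c, δC c = Hm J (j+1) π vw.1 ∧ Hm J j α' c = vw.2}
      add_mem' := by
        rintro ⟨v, w⟩ ⟨v', w'⟩ ⟨c, h1, h2⟩ ⟨c', h1', h2'⟩
        exact ⟨c + c', by simp [h1, h1'], by simp [h2, h2']⟩
      zero_mem' := ⟨0, by simp, by simp⟩
      smul_mem' := by
        rintro r ⟨v, w⟩ ⟨c, h1, h2⟩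
        exact ⟨r • c, by simp [h1], by simp [h2]⟩ }
  obtain ⟨s, hs⟩ := exists_linearMap_of_graph G (by
    intro v
    obtain ⟨c, hc⟩ := (exact_del hβ hβp hp _).1 (hHβ v
      (fun c hc => (Submodule.mem_torsionBySet_iff _ _).1 v.2 ⟨c, hc⟩))
    exact ⟨_, c, hc, rfl⟩) (by
    rintro w ⟨c, h1, h2⟩
    have h1 : δC c = 0 := by simpa using h1
    obtain ⟨z, rfl⟩ := (del_exact hβ hβp hp c).1 h1
    rw [hHp] at h2
    exact h2.symm)
  refine ⟨ε.symm.toLinearMap ∘ₗ δ, s, ?_, ?_, ?_⟩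
  · rw [injective_iff_map_eq_zero]
    intro z hz
    obtain ⟨y, rfl⟩ := (Hm_exact_mid hξ hξq hq z).1 hz
    cases j with
    | zero => rw [H0_quot y, map_zero]
    | succ j =>
      obtain ⟨y, rfl⟩ := (Hm_mk_bij j).2 y
      change Hm J (j+1) ξ (Hm J (j+1) π y) = 0
      rw [← Hm_comp, hξπ, Hm_smul, ← map_smul, hj x hx1, map_zero]
  · intro z
    rw [LinearMap.comp_apply]
    change ε.symm (δ z) = 0 ↔ _
    rw [LinearEquiv.map_eq_zero_iff]
    exact del_exact hξ hξq hq z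
  · intro v
    obtain ⟨c, h1, h2⟩ := (hs v (s v)).2 rfl
    simp only at h1 h2
    change ε.symm (δ (s v)) = v
    rw [LinearEquiv.symm_apply_eq, ← h2, hδ, h1]
    rfl

/-- the socle -/
abbrev Soc (J : Ideal R) (M : Type) [AddCommGroup M] [Module R M] : Submodule R M :=
  Submodule.torsionBySet R M (J : Set R)

lemma mem_soc {m : M} : m ∈ Soc J M ↔ ∀ a ∈ J, a • m = 0 :=
  ⟨fun h a ha => (Submodule.mem_torsionBySet_iff _ _).1 h ⟨a, ha⟩,
    fun h => (Submodule.mem_torsionBySet_iff _ _).2 fun a => h a a.2⟩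

lemma soc_equiv {A B C : Type} [AddCommGroup A] [Module R A] [AddCommGroup B] [Module R B]
    [AddCommGroup C] [Module R C] {I : Ideal R} (hIJ : I ≤ J) (f : A →ₗ[R] B) (t : B →ₗ[R] C)
    (s : Soc I C →ₗ[R] B) (hf : Function.Injective f) (hft : Function.Exact f t)
    (hts : ∀ v, t (s v) = v) : Nonempty ((Soc J A × Soc J C) ≃ₗ[R] Soc J B) := by
  have hle : Soc J C ≤ Soc I C := fun c hc => mem_soc.2 fun a ha => mem_soc.1 hc a (hIJ ha)
  let φ : (Soc J A × Soc J C) →ₗ[R] B :=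
    LinearMap.coprod (f ∘ₗ (Soc J A).subtype) (s ∘ₗ Submodule.inclusion hle)
  have hφ : ∀ u v, φ (u, v) = f u + s (Submodule.inclusion hle v) := fun u v => rfl
  have htφ : ∀ u v, t (φ (u, v)) = v := by
    intro u v
    rw [hφ, map_add, hft.apply_apply_eq_zero, hts, zero_add]
    rfl
  have hmem : ∀ y, φ y ∈ Soc J B := by
    rintro ⟨u, v⟩
    rw [mem_soc]
    intro a ha
    have : a • (u, v) = 0 := by
      ext
      · exact mem_soc.1 u.2 a ha
      · exact mem_soc.1 v.2 a ha
    rw [← map_smul, this, map_zero]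
  refine ⟨LinearEquiv.ofBijective (LinearMap.codRestrict _ φ hmem) ⟨?_, ?_⟩⟩
  · rw [injective_iff_map_eq_zero]
    rintro ⟨u, v⟩ h
    have h1 : φ (u, v) = 0 := congrArg Subtype.val h
    have h2 := htφ u v
    rw [h1, map_zero] at h2
    have hv : v = 0 := Subtype.ext h2.symm
    subst hv
    rw [hφ, map_zero, map_zero, add_zero] at h1
    have hu : u = 0 := Subtype.ext (hf (by rw [h1]; simp))
    rw [hu]; rfl
  · rintro ⟨z, hz⟩
    have hv : t z ∈ Soc J C := mem_soc.2 fun a ha => by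
      rw [← map_smul, mem_soc.1 hz a ha, map_zero]
    obtain ⟨u, hu⟩ := (hft (z - s (Submodule.inclusion hle ⟨t z, hv⟩))).1 (by
      rw [map_sub, hts, sub_eq_zero]; rfl)
    have hsv : s (Submodule.inclusion hle ⟨t z, hv⟩) ∈ Soc J B := by
      have := hmem (0, ⟨t z, hv⟩)
      rwa [hφ, Submodule.coe_zero, map_zero, zero_add] at this
    refine ⟨(⟨u, mem_soc.2 fun a ha => hf ?_⟩, ⟨t z, hv⟩), Subtype.ext ?_⟩
    · rw [map_smul, hu, map_zero]
      exact mem_soc.1 (Submodule.sub_mem _ hz hsv) a ha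
    · change f u + s (Submodule.inclusion hle ⟨t z, hv⟩) = z
      rw [hu, sub_add_cancel]

lemma split_ann {A B C : Type} [AddCommGroup A] [Module R A] [AddCommGroup B] [Module R B]
    [AddCommGroup C] [Module R C] {I : Ideal R} (f : A →ₗ[R] B) (t : B →ₗ[R] C)
    (s : Soc I C →ₗ[R] B) (hft : Function.Exact f t)
    (hts : ∀ v, t (s v) = v) (hA : ∀ a ∈ I, ∀ u : A, a • u = 0)
    (hC : ∀ a ∈ I, ∀ u : C, a • u = 0) : ∀ a ∈ I, ∀ u : B, a • u = 0 := by
  intro a ha z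
  have hv : t z ∈ Soc I C := mem_soc.2 fun a ha => hC a ha _
  obtain ⟨u, hu⟩ := (hft (z - s ⟨t z, hv⟩)).1 (by rw [map_sub, hts, sub_self])
  have : z = f u + s ⟨t z, hv⟩ := by rw [hu, sub_add_cancel]
  rw [this, smul_add, ← map_smul, ← map_smul, hA a ha, map_zero, zero_add]
  have : a • (⟨t z, hv⟩ : Soc I C) = 0 := Subtype.ext (hC a ha _)
  rw [this, map_zero]

end split



end
end LC

namespace LC
open CategoryTheory IsLocalRing Opposite Limits
noncomputable section
variable {R : Type} [CommRing R] {J : Ideal R} {i n n' : ℕ} {X X' Y Y' : ModuleCat.{0} R}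

/-! ### Filter regularity -/

section filt
variable [IsNoetherianRing R] [IsLocalRing R]
variable {M N : Type} [AddCommGroup M] [Module R M] [AddCommGroup N] [Module R N]

/-- `p` is the annihilator of `m` and is prime -/
def AP (p : Ideal R) (m : M) : Prop := p.IsPrime ∧ ∀ a, a ∈ p ↔ a • m = 0

lemma AP.ne_zero {p : Ideal R} {m : M} (h : AP p m) : m ≠ 0 := by
  rintro rfl
  exact h.1.ne_top ((Ideal.eq_top_iff_one _).2 ((h.2 _).2 (by simp)))

lemma exists_AP_iff {p : Ideal R} : (∃ m : M, AP p m) ↔ p ∈ associatedPrimes R M := by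
  rw [AssociatedPrimes.mem_iff, isAssociatedPrime_iff]
  constructor
  · rintro ⟨m, hp, h⟩
    refine ⟨hp, m, ?_⟩
    ext a
    rw [h, Submodule.mem_colon_singleton, Submodule.mem_bot]
  · rintro ⟨hp, m, rfl⟩
    exact ⟨m, hp, fun a => by rw [Submodule.mem_colon_singleton, Submodule.mem_bot]⟩

lemma AP.map {p : Ideal R} {m : M} (h : AP p m) (f : M →ₗ[R] N) (hf : Function.Injective f) :
    AP p (f m) :=
  ⟨h.1, fun a => by rw [h.2, ← map_smul, map_eq_zero_iff f hf]⟩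

lemma pow_le_annihilator_of_AP [Module.Finite R M]
    (h : ∀ (p : Ideal R) (m : M), AP p m → p = maximalIdeal R) :
    ∃ n, ∀ a ∈ (maximalIdeal R) ^ n, ∀ m : M, a • m = 0 := by
  have h1 : maximalIdeal R ≤ (Module.annihilator R M).radical := by
    rw [← Ideal.sInf_minimalPrimes]
    refine le_sInf fun p hp => ?_
    obtain ⟨m, hm⟩ := exists_AP_iff.2
      (Module.associatedPrimes.minimalPrimes_annihilator_subset_associatedPrimes R M hp)
    exact (h p m hm).ge
  obtain ⟨n, hn⟩ := Ideal.exists_pow_le_of_le_radical_of_fg h1 (IsNoetherian.noetherian _)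
  exact ⟨n, fun a ha m => Module.mem_annihilator.1 (hn ha) m⟩

lemma exists_reg [Module.Finite R M] (h : ∀ m ∈ gam (maximalIdeal R) M, m = 0) :
    ∃ x ∈ maximalIdeal R, ∀ m : M, x • m = 0 → m = 0 := by
  by_contra! hc
  have hsub : ((maximalIdeal R : Ideal R) : Set R) ⊆ ⋃ p ∈ associatedPrimes R M, p := by
    rw [biUnion_associatedPrimes_eq_zero_divisors]
    intro x hx
    obtain ⟨m, h1, h2⟩ := hc x hx
    exact ⟨m, h2, h1⟩
  obtain ⟨p, hp, hle⟩ := (Ideal.subset_union_prime_finite (associatedPrimes.finite R M)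
    (f := id) 0 0 fun _ h _ _ ↦ h.1).1 hsub
  obtain ⟨m, hm⟩ := exists_AP_iff.2 hp
  refine hm.ne_zero (h m ⟨1, fun a ha => (hm.2 a).1 (hle (by simpa using ha))⟩)

lemma dim_succ_le {p q : Ideal R} (hp : p.IsPrime) (hpq : p < q) :
    ringKrullDim (R ⧸ q) + 1 ≤ ringKrullDim (R ⧸ p) := by
  obtain ⟨x, hxq, hxp⟩ := SetLike.exists_of_lt hpq
  refine ringKrullDim_succ_le_of_surjective (Ideal.Quotient.factor hpq.le)
    (Ideal.Quotient.factor_surjective _) (r := Ideal.Quotient.mk p x) ?_ ?_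
  · rw [mem_nonZeroDivisors_iff_ne_zero]
    rwa [Ne, Ideal.Quotient.eq_zero_iff_mem]
  · rwa [Ideal.Quotient.factor_mk, Ideal.Quotient.eq_zero_iff_mem]

/-- killing of `H^j(M/xM)` -/
lemma ann_quot {J : Ideal R} {n j : ℕ} {x : R} (hx : ∀ m : M, x • m = 0 → m = 0)
    (q : M →ₗ[R] N) (hq : Function.Surjective q)
    (hxq : Function.Exact (x • (LinearMap.id : M →ₗ[R] M)) q)
    (h1 : ∀ a ∈ J ^ n, ∀ z : Hc J (j+1) M, a • z = 0) (a : R) (ha : a ∈ J ^ n) (z : Hc J j N) :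
    ∃ u, a • z = Hm J j q u := by
  have hinj : Function.Injective (x • (LinearMap.id : M →ₗ[R] M)) := by
    rw [injective_iff_map_eq_zero]
    exact fun m hm => hx m hm
  obtain ⟨u, hu⟩ := (del_exact (J := J) (i := j) hinj hxq hq (a • z)).1 (by rw [map_smul, h1 a ha])
  exact ⟨u, hu.symm⟩

lemma dim_ge (t : ℕ) : ∀ (M : Type) [AddCommGroup M] [Module R M] [Module.Finite R M] (n : ℕ)
    (_ : ∀ j < t, ∀ a ∈ (maximalIdeal R) ^ n, ∀ z : Hc (maximalIdeal R) j M, a • z = 0)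
    (p : Ideal R) (m : M) (_ : AP p m) (_ : p ≠ maximalIdeal R),
    (t : WithBot ℕ∞) ≤ ringKrullDim (R ⧸ p) := by
  induction t with
  | zero =>
    intro M _ _ _ n hn p m hp hpm
    have := hp.1
    exact ringKrullDim_nonneg_of_nontrivial
  | succ t ih =>
    have key : ∀ (M : Type) [AddCommGroup M] [Module R M] [Module.Finite R M] (n : ℕ)
      (_ : ∀ j < t + 1, ∀ a ∈ (maximalIdeal R) ^ n, ∀ z : Hc (maximalIdeal R) j M, a • z = 0)
      (_ : ∀ m ∈ gam (maximalIdeal R) M, m = 0)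
      (p : Ideal R) (m : M) (_ : AP p m) (_ : p ≠ maximalIdeal R),
      ((t+1 : ℕ) : WithBot ℕ∞) ≤ ringKrullDim (R ⧸ p) := by
      intro M _ _ _ n hn hgam p m hp hpm
      have hpprime := hp.1
      by_contra hcon
      have hq : ∀ q : Ideal R, p < q → ¬ (t : WithBot ℕ∞) ≤ ringKrullDim (R ⧸ q) := by
        intro q hpq h
        apply hcon
        push_cast
        exact (add_le_add_left h 1).trans (dim_succ_le hp.1 hpq)
      cases t with
      | zero =>
        refine hq (maximalIdeal R) (lt_of_le_of_ne (le_maximalIdeal hp.1.ne_top) hpm) ?_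
        exact ringKrullDim_nonneg_of_nontrivial
      | succ t =>
        obtain ⟨x, hxm, hx⟩ := exists_reg hgam
        have hxp : x ∉ p := fun h => hp.ne_zero (hx m ((hp.2 x).1 h))
        have hxk : ∀ k, ∀ m : M, x ^ k • m = 0 → m = 0 := by
          intro k
          induction k with
          | zero => intro m hm; simpa using hm
          | succ k ihk => intro m hm; rw [pow_succ', mul_smul] at hm; exact ihk m (hx _ hm)
        let N := Soc p M
        let q : ∀ k : ℕ, M →ₗ[R] (M ⧸ LinearMap.range (x ^ k • (LinearMap.id : M →ₗ[R] M))) :=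
          fun k => Submodule.mkQ _
        have hqs : ∀ k, Function.Surjective (q k) := fun k => Submodule.mkQ_surjective _
        have hqe : ∀ k, Function.Exact (x ^ k • (LinearMap.id : M →ₗ[R] M)) (q k) :=
          fun k => LinearMap.exact_map_mkQ_range _
        -- the image of `N` in `M/xM` is torsion
        have hN1 : ∃ s, ∀ a ∈ (maximalIdeal R) ^ s, ∀ v : N.map (q 1), a • v = 0 := by
          refine pow_le_annihilator_of_AP (R := R) (M := N.map (q 1)) ?_
          intro Q v hQ
          by_contra hne
          have hQ' := hQ.map (N.map (q 1)).subtype Subtype.val_injective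
          refine hq Q ?_ (ih (M ⧸ LinearMap.range (x ^ 1 • (LinearMap.id : M →ₗ[R] M))) (n + n) ?_ Q _ hQ' hne)
          · refine SetLike.lt_iff_le_and_exists.2 ⟨?_, x, ?_, hxp⟩
            · intro a ha
              rw [hQ.2]
              obtain ⟨w, hw, hwv⟩ := v.2
              apply Subtype.ext
              rw [Submodule.coe_smul, ← hwv, ← map_smul, mem_soc.1 hw a ha, map_zero, Submodule.coe_zero]
            · rw [hQ.2]
              obtain ⟨w, hw, hwv⟩ := v.2
              apply Subtype.ext
              rw [Submodule.coe_smul, ← hwv, ← map_smul, Submodule.coe_zero]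
              exact (hqe 1 _).2 ⟨w, by simp⟩
          · intro j hj a ha z
            rw [pow_add] at ha
            refine Submodule.mul_induction_on ha ?_ ?_
            · intro b hb c hc
              obtain ⟨u, hu⟩ := ann_quot (hxk 1) (q 1) (hqs 1) (hqe 1) (hn (j+1) (by omega)) c hc z
              rw [mul_smul, hu, ← map_smul, hn j (by omega) b hb, map_zero]
            · intro b c hb hc
              rw [add_smul, hb, hc, add_zero]
        obtain ⟨s, hs⟩ := hN1
        have hs' : ∀ a ∈ (maximalIdeal R) ^ s, ∀ v ∈ N, ∃ w ∈ N, a • v = x • w := by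
          intro a ha v hv
          have h1 : q 1 (a • v) = 0 := by
            rw [map_smul]
            exact congrArg Subtype.val (hs a ha ⟨q 1 v, v, hv, rfl⟩)
          obtain ⟨w, hw⟩ := (hqe 1 _).1 h1
          have hw : x • w = a • v := by simpa using hw
          refine ⟨w, mem_soc.2 fun b hb => hx _ ?_, hw.symm⟩
          rw [smul_comm, hw, smul_comm, mem_soc.1 hv b hb, smul_zero]
        have hsk : ∀ k, ∀ v ∈ N, ∀ a ∈ ((maximalIdeal R) ^ s) ^ k, ∃ w ∈ N, a • v = x ^ k • w := by
          intro k
          induction k with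
          | zero => intro v hv a _; exact ⟨a • v, N.smul_mem _ hv, by simp⟩
          | succ k ihk =>
            intro v hv a ha
            rw [pow_succ] at ha
            refine Submodule.mul_induction_on ha ?_ ?_
            · intro b hb c hc
              obtain ⟨w, hw, h1⟩ := hs' c hc v hv
              obtain ⟨w', hw', h2⟩ := ihk w hw b hb
              exact ⟨w', hw', by rw [mul_smul, h1, smul_comm, h2, pow_succ', mul_smul]⟩
            · rintro b c ⟨w, hw, h1⟩ ⟨w', hw', h2⟩
              exact ⟨w + w', N.add_mem hw hw', by rw [add_smul, h1, h2, smul_add]⟩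
        have hmN : m ∈ N := mem_soc.2 fun a ha => (hp.2 a).1 ha
        refine hp.ne_zero (hgam m ⟨n, fun a ha => ?_⟩)
        have hall : ∀ k, a • m ∈ (maximalIdeal R) ^ k • (⊤ : Submodule R M) := by
          intro k
          have h1 : q k m ∈ gam (maximalIdeal R) (M ⧸ LinearMap.range (x ^ k • (LinearMap.id : M →ₗ[R] M))) := by
            refine ⟨s * k, fun b hb => ?_⟩
            rw [pow_mul] at hb
            obtain ⟨w, hw, h2⟩ := hsk k m hmN b hb
            rw [← map_smul, h2]
            exact (hqe k _).2 ⟨w, by simp⟩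
          obtain ⟨z, hz⟩ := (e0_range _).2 h1
          obtain ⟨u, hu⟩ := ann_quot (hxk k) (q k) (hqs k) (hqe k) (hn 1 (by omega)) a ha z
          have hu0 : u = 0 := e0_inj (by
            rw [map_zero]
            exact hgam _ ((e0_range _).1 ⟨u, rfl⟩))
          rw [hu0, map_zero] at hu
          have h2 : q k (a • m) = 0 := by rw [map_smul, ← hz, ← map_smul, hu, map_zero]
          obtain ⟨w, hw⟩ := (hqe k _).1 h2
          rw [← hw]
          exact Submodule.smul_mem_smul (Ideal.pow_mem_pow hxm k) trivial
        have hbot := Ideal.iInf_pow_smul_eq_bot_of_isLocalRing (M := M) (maximalIdeal R)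
          (Ideal.IsPrime.ne_top inferInstance)
        have : a • m ∈ (⨅ i : ℕ, (maximalIdeal R) ^ i • (⊤ : Submodule R M)) :=
          (Submodule.mem_iInf _).2 hall
        rw [hbot] at this
        exact this
    intro M _ _ _ n hn p m hp hpm
    refine key (M ⧸ gam (maximalIdeal R) M) n ?_ (fun m hm => gam_quot hm) p
      ((gam (maximalIdeal R) M).mkQ m) ⟨hp.1, fun a => ?_⟩ hpm
    · intro j hj a ha z
      cases j with
      | zero => exact H0_quot _
      | succ j =>
        obtain ⟨z, rfl⟩ := (Hm_mk_bij j).2 z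
        rw [← map_smul, hn _ hj a ha, map_zero]
    · rw [← map_smul, Submodule.mkQ_apply, Submodule.Quotient.mk_eq_zero, hp.2]
      constructor
      · intro h; rw [h]; exact zero_mem _
      · rintro ⟨k, hk⟩
        rw [← hp.2]
        have hnot : ¬ (maximalIdeal R) ^ k ≤ p := fun h => hpm
          (le_antisymm (le_maximalIdeal hp.1.ne_top) (hp.1.le_of_pow_le h))
        obtain ⟨b, hb, hbp⟩ := SetLike.not_le_iff_exists.1 hnot
        have := hk b hb
        rw [← mul_smul, ← hp.2] at this
        exact (hp.1.mem_or_mem this).resolve_left hbp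

lemma dim_le [Module.Finite R M] {d n : ℕ} (y : Fin (d+1) → R)
    (hn : ∀ a ∈ (maximalIdeal R) ^ n, ∀ v : M ⧸ (Ideal.span (Set.range y) • (⊤ : Submodule R M)), a • v = 0)
    (hy : ∀ i, y i ∈ maximalIdeal R)
    {p : Ideal R} {m : M} (hp : AP p m) (h0 : y 0 ∈ p) : ringKrullDim (R ⧸ p) ≤ d := by
  have hpp := hp.1
  have hle : p ≤ maximalIdeal R := le_maximalIdeal hp.1.ne_top
  -- primes containing `p` and `y`
  have hQ : ∀ Q : Ideal R, Q.IsPrime → p ≤ Q → (∀ i, y i ∈ Q) → maximalIdeal R ≤ Q := by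
    intro Q hQ hpQ hyQ
    have h1 : (⟨Q, hQ⟩ : PrimeSpectrum R) ∈
        Module.support R (M ⧸ (Ideal.span (Set.range y) • (⊤ : Submodule R M))) := by
      rw [Module.support_quotient]
      constructor
      · rw [Module.mem_support_iff_of_finite]
        intro a ha
        exact hpQ ((hp.2 a).2 (Module.mem_annihilator.1 ha m))
      · rw [PrimeSpectrum.mem_zeroLocus]
        exact Ideal.span_le.2 (by rintro _ ⟨i, rfl⟩; exact hyQ i)
    rw [Module.mem_support_iff_of_finite] at h1
    refine hQ.le_of_pow_le (n := n) fun a ha => h1 (Module.mem_annihilator.2 (hn a ha))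
  have : IsLocalRing (R ⧸ p) := IsLocalRing.of_surjective' (Ideal.Quotient.mk p) Ideal.Quotient.mk_surjective
  let s : Set (R ⧸ p) := Set.range fun i : Fin d => Ideal.Quotient.mk p (y i.succ)
  have hs : s.Finite := Set.finite_range _
  have hmax : (maximalIdeal (R ⧸ p)).comap (Ideal.Quotient.mk p) = maximalIdeal R :=
    eq_maximalIdeal (Ideal.comap_isMaximal_of_surjective _ Ideal.Quotient.mk_surjective)
  have hmin : maximalIdeal (R ⧸ p) ∈ (Ideal.span s).minimalPrimes := by
    refine ⟨⟨inferInstance, Ideal.span_le.2 ?_⟩, ?_⟩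
    · rintro _ ⟨i, rfl⟩
      have := hy i.succ
      rw [← hmax] at this
      exact this
    · rintro Q ⟨hQ1, hQ2⟩ _
      have h2 := hQ (Q.comap (Ideal.Quotient.mk p)) inferInstance (fun a ha => by
        rw [Ideal.mem_comap, Ideal.Quotient.eq_zero_iff_mem.2 ha]; exact zero_mem _) (by
        intro i
        refine Fin.cases ?_ (fun i => ?_) i
        · rw [Ideal.mem_comap, Ideal.Quotient.eq_zero_iff_mem.2 h0]; exact zero_mem _
        · exact hQ2 (Ideal.subset_span ⟨i, rfl⟩))
      intro b hb
      obtain ⟨b, rfl⟩ := Ideal.Quotient.mk_surjective b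
      have : b ∈ maximalIdeal R := by rw [← hmax]; exact hb
      exact h2 this
  have h3 := Ideal.height_le_card_of_mem_minimalPrimes_span hs hmin
  have h4 : s.ncard ≤ d := by
    have := Set.ncard_image_le (f := fun i : Fin d => Ideal.Quotient.mk p (y i.succ)) (Set.toFinite Set.univ)
    rw [Set.image_univ, Set.ncard_univ, Nat.card_eq_fintype_card, Fintype.card_fin] at this
    exact this
  rw [← IsLocalRing.maximalIdeal_height_eq_ringKrullDim]
  exact_mod_cast h3.trans (by exact_mod_cast h4)

lemma filter_reg [Module.Finite R M] {d n n' : ℕ} (y : Fin (d+1) → R)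
    (hn : ∀ a ∈ (maximalIdeal R) ^ n, ∀ v : M ⧸ (Ideal.span (Set.range y) • (⊤ : Submodule R M)), a • v = 0)
    (hy : ∀ i, y i ∈ maximalIdeal R)
    (hH : ∀ j < d + 1, ∀ a ∈ (maximalIdeal R) ^ n', ∀ z : Hc (maximalIdeal R) j M, a • z = 0)
    (m : M) (hm : y 0 • m = 0) : m ∈ gam (maximalIdeal R) M := by
  let K := LinearMap.ker (y 0 • (LinearMap.id : M →ₗ[R] M))
  obtain ⟨k, hk⟩ := pow_le_annihilator_of_AP (R := R) (M := K) (by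
    intro p v hv
    by_contra hne
    have hv' := hv.map K.subtype Subtype.val_injective
    have h1 := dim_ge (d+1) M n' hH p _ hv' hne
    have h2 := dim_le y hn hy hv' ((hv'.2 _).2 v.2)
    have h3 := h1.trans h2
    have h4 : d + 1 ≤ d := by exact_mod_cast h3
    omega)
  exact ⟨k, fun a ha => congrArg Subtype.val (hk a ha ⟨m, hm⟩)⟩

end filt



end
end LC

namespace LC
open CategoryTheory IsLocalRing Opposite Limits
noncomputable section
variable {R : Type} [CommRing R] {J : Ideal R} {i n n' : ℕ} {X X' Y Y' : ModuleCat.{0} R}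

/-! ### The main induction -/

section main

lemma soc_congr {A B : Type} [AddCommGroup A] [Module R A] [AddCommGroup B] [Module R B]
    (e : A ≃ₗ[R] B) : Nonempty (Soc J A ≃ₗ[R] Soc J B) := by
  refine ⟨e.ofSubmodules _ _ ?_⟩
  ext b
  rw [Submodule.mem_map]
  constructor
  · rintro ⟨a, ha, rfl⟩
    exact mem_soc.2 fun r hr => by
      change r • e a = 0
      rw [← map_smul, mem_soc.1 ha r hr, map_zero]
  · intro hb
    refine ⟨e.symm b, mem_soc.2 fun r hr => ?_, e.apply_symm_apply b⟩
    rw [← map_smul, mem_soc.1 hb r hr, map_zero]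

lemma finrank_soc_congr {A B : Type} [AddCommGroup A] [Module R A] [AddCommGroup B] [Module R B]
    (e : Soc J A ≃ₗ[R] Soc J B) :
    Module.finrank (R ⧸ J) (Soc J A) = Module.finrank (R ⧸ J) (Soc J B) :=
  LinearEquiv.finrank_eq (e.extendScalarsOfSurjective
    (show Function.Surjective (algebraMap R (R ⧸ J)) from Ideal.Quotient.mk_surjective))

lemma finrank_soc_prod [hJ : J.IsMaximal] {A B C : Type} [AddCommGroup A] [Module R A]
    [AddCommGroup B] [Module R B] [AddCommGroup C] [Module R C]
    [Module.Finite R (Soc J A)] [Module.Finite R (Soc J C)]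
    (e : (Soc J A × Soc J C) ≃ₗ[R] Soc J B) :
    Module.finrank (R ⧸ J) (Soc J B) =
      Module.finrank (R ⧸ J) (Soc J A) + Module.finrank (R ⧸ J) (Soc J C) := by
  have h1 : Module.Finite (R ⧸ J) (Soc J A) := Module.Finite.of_restrictScalars_finite R _ _
  have h2 : Module.Finite (R ⧸ J) (Soc J C) := Module.Finite.of_restrictScalars_finite R _ _
  have hF : Module.Free (R ⧸ J) (Soc J A) :=
    letI := Ideal.Quotient.field J
    inferInstance
  have hF2 : Module.Free (R ⧸ J) (Soc J C) :=
    letI := Ideal.Quotient.field J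
    inferInstance
  have := LinearEquiv.finrank_eq (e.extendScalarsOfSurjective
    (show Function.Surjective (algebraMap R (R ⧸ J)) from Ideal.Quotient.mk_surjective))
  rw [← this, Module.finrank_prod]

lemma quot_equiv {M : Type} [AddCommGroup M] [Module R M] {d : ℕ} (y : Fin (d+1) → R) :
    Nonempty ((M ⧸ (Ideal.span (Set.range y) • (⊤ : Submodule R M))) ≃ₗ[R]
      ((M ⧸ LinearMap.range (y 0 • (LinearMap.id : M →ₗ[R] M))) ⧸
        (Ideal.span (Set.range fun i : Fin d => y i.succ) •
          (⊤ : Submodule R (M ⧸ LinearMap.range (y 0 • (LinearMap.id : M →ₗ[R] M))))))) := by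
  let q := (LinearMap.range (y 0 • (LinearMap.id : M →ₗ[R] M))).mkQ
  let I := Ideal.span (Set.range fun i : Fin d => y i.succ)
  let q' := (I • (⊤ : Submodule R (M ⧸ LinearMap.range (y 0 • (LinearMap.id : M →ₗ[R] M))))).mkQ
  have hsurj : Function.Surjective (q' ∘ₗ q) :=
    (Submodule.mkQ_surjective _).comp (Submodule.mkQ_surjective _)
  have hr : LinearMap.range (y 0 • (LinearMap.id : M →ₗ[R] M)) =
      Ideal.span {y 0} • (⊤ : Submodule R M) := by
    rw [Submodule.ideal_span_singleton_smul]
    ext m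
    rw [Submodule.mem_smul_pointwise_iff_exists]
    simp
  have hker : LinearMap.ker (q' ∘ₗ q) = Ideal.span (Set.range y) • (⊤ : Submodule R M) := by
    have h1 : Ideal.span (Set.range y) = I ⊔ Ideal.span {y 0} := by
      rw [← Ideal.span_union]
      congr 1
      ext r
      simp [Fin.exists_fin_succ, eq_comm]
    have h2 : (I • (⊤ : Submodule R M)).map q = I • ⊤ := by
      rw [Submodule.map_smul'', Submodule.map_top, Submodule.range_mkQ]
    rw [LinearMap.ker_comp, Submodule.ker_mkQ, ← h2, Submodule.comap_map_eq, Submodule.ker_mkQ,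
      hr, h1, Submodule.sup_smul]
  rw [← hker]
  exact ⟨LinearMap.quotKerEquivOfSurjective _ hsurj⟩

lemma pascal_sum (d : ℕ) (h : ℕ → ℕ) :
    ∑ i ∈ Finset.range (d + 1), d.choose i * (h i + h (i+1)) =
      ∑ i ∈ Finset.range (d + 1 + 1), (d+1).choose i * h i := by
  have h1 : ∑ i ∈ Finset.range (d + 1), d.choose i * h i =
      ∑ i ∈ Finset.range (d + 1 + 1), d.choose i * h i := by
    rw [Finset.sum_range_succ _ (d+1)]
    simp
  simp only [mul_add]
  rw [Finset.sum_add_distrib, h1, Finset.sum_range_succ', Finset.sum_range_succ' _ (d+1)]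
  simp only [Nat.choose_succ_succ, add_mul, Finset.sum_add_distrib, Nat.choose_zero_right]
  ring

variable [IsNoetherianRing R] [IsLocalRing R]

lemma main_ind {n0 : ℕ} (hn0 : 0 < n0) (N : ℕ) (d : ℕ) : ∀ (M : Type) [AddCommGroup M] [Module R M]
    [Module.Finite R M] (y : Fin d → R) (_ : ∀ i, y i ∈ (maximalIdeal R) ^ (2 * n0))
    (_ : ∀ a ∈ (maximalIdeal R) ^ N,
      ∀ v : M ⧸ (Ideal.span (Set.range y) • (⊤ : Submodule R M)), a • v = 0)
    (_ : ∀ j < d, ∀ a ∈ (maximalIdeal R) ^ n0, ∀ z : Hc (maximalIdeal R) j M, a • z = 0),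
    (∀ i ≤ d, Module.Finite R (Soc (maximalIdeal R) (Hc (maximalIdeal R) i M))) ∧
    Module.finrank (R ⧸ maximalIdeal R)
      (Soc (maximalIdeal R) (M ⧸ (Ideal.span (Set.range y) • (⊤ : Submodule R M)))) =
    ∑ i ∈ Finset.range (d + 1), d.choose i *
      Module.finrank (R ⧸ maximalIdeal R) (Soc (maximalIdeal R) (Hc (maximalIdeal R) i M)) := by
  induction d with
  | zero =>
    intro M _ _ _ y hy hN hH
    have hbot : Ideal.span (Set.range y) • (⊤ : Submodule R M) = ⊥ := by
      rw [Set.range_eq_empty, Ideal.span_empty, Submodule.bot_smul]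
    rw [hbot] at hN ⊢
    let e := Submodule.quotEquivOfEqBot (⊥ : Submodule R M) rfl
    have hN' : ∀ m : M, m ∈ gam (maximalIdeal R) M := by
      intro m
      refine ⟨N, fun a ha => ?_⟩
      have := congrArg e (hN a ha (e.symm m))
      rwa [map_smul, e.apply_symm_apply, map_zero] at this
    let e' : Hc (maximalIdeal R) 0 M ≃ₗ[R] M :=
      LinearEquiv.ofBijective (e0 _ M) ⟨e0_inj, fun m => (e0_range m).2 (hN' m)⟩
    constructor
    · intro i hi
      obtain rfl : i = 0 := by omega
      obtain ⟨f⟩ := soc_congr (J := maximalIdeal R) e'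
      exact Module.Finite.equiv f.symm
    · obtain ⟨f⟩ := soc_congr (J := maximalIdeal R) (e.trans e'.symm)
      rw [finrank_soc_congr f]
      simp
  | succ d ih =>
    intro M _ _ _ y hy hN hH
    have hym : ∀ i, y i ∈ maximalIdeal R := fun i => Ideal.pow_le_self (by omega) (hy i)
    have hreg := filter_reg y hN hym hH
    let q := (LinearMap.range (y 0 • (LinearMap.id : M →ₗ[R] M))).mkQ
    have hq : Function.Surjective q := Submodule.mkQ_surjective _
    have hxq : Function.Exact (y 0 • (LinearMap.id : M →ₗ[R] M)) q :=
      LinearMap.exact_map_mkQ_range _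
    have hsp : ∀ j < d + 1, _ := fun j hj => split_core (J := maximalIdeal R) (j := j)
      (hH 0 (by omega)) (hH j hj) (hy 0) hreg q hq hxq
    obtain ⟨E⟩ := quot_equiv (M := M) y
    obtain ⟨h1, h2⟩ := ih (M ⧸ LinearMap.range (y 0 • (LinearMap.id : M →ₗ[R] M)))
      (fun i => y i.succ) (fun i => hy _) (by
        intro a ha v
        have := congrArg E (hN a ha (E.symm v))
        rwa [map_smul, E.apply_symm_apply, map_zero] at this) (by
        intro j hj
        obtain ⟨t, s, _, hft, hts⟩ := hsp j (by omega)
        exact split_ann (Hm (maximalIdeal R) j q) t s hft hts (hH j (by omega)) (hH (j+1) (by omega)))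
    have heq : ∀ j < d + 1, Nonempty ((Soc (maximalIdeal R) (Hc (maximalIdeal R) j M) ×
        Soc (maximalIdeal R) (Hc (maximalIdeal R) (j+1) M)) ≃ₗ[R]
        Soc (maximalIdeal R) (Hc (maximalIdeal R) j
          (M ⧸ LinearMap.range (y 0 • (LinearMap.id : M →ₗ[R] M))))) := by
      intro j hj
      obtain ⟨t, s, hf, hft, hts⟩ := hsp j hj
      exact soc_equiv (Ideal.pow_le_self (by omega)) (Hm (maximalIdeal R) j q) t s hf hft hts
    have hfin : ∀ i ≤ d + 1, Module.Finite R (Soc (maximalIdeal R) (Hc (maximalIdeal R) i M)) := by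
      intro i hi
      cases i with
      | zero =>
        obtain ⟨f⟩ := heq 0 (by omega)
        have := h1 0 (by omega)
        exact Module.Finite.of_surjective (LinearMap.fst R _ _ ∘ₗ f.symm.toLinearMap)
          (Prod.fst_surjective.comp f.symm.surjective)
      | succ i =>
        obtain ⟨f⟩ := heq i (by omega)
        have := h1 i (by omega)
        exact Module.Finite.of_surjective (LinearMap.snd R _ _ ∘ₗ f.symm.toLinearMap)
          (Prod.snd_surjective.comp f.symm.surjective)
    refine ⟨hfin, ?_⟩
    obtain ⟨f⟩ := soc_congr (J := maximalIdeal R) E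
    rw [finrank_soc_congr f, h2, ← pascal_sum]
    refine Finset.sum_congr rfl fun i hi => ?_
    have hi := Finset.mem_range.1 hi
    obtain ⟨g⟩ := heq i hi
    have := hfin i (by omega)
    have := hfin (i+1) (by omega)
    rw [finrank_soc_prod g]

lemma finLen_kill {M : Type} [AddCommGroup M] [Module R M] (h : IsFiniteLength R M) :
    ∃ n, ∀ a ∈ (maximalIdeal R) ^ n, ∀ v : M, a • v = 0 := by
  induction h with
  | of_subsingleton => exact ⟨0, fun a _ v => Subsingleton.elim _ _⟩
  | @of_simple_quotient M _ _ K hs _ ih =>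
    obtain ⟨n, hn⟩ := ih
    have hmax : Module.annihilator R (M ⧸ K) = maximalIdeal R :=
      eq_maximalIdeal (IsSimpleModule.annihilator_isMaximal)
    refine ⟨n + 1, fun a ha v => ?_⟩
    rw [pow_succ] at ha
    refine Submodule.mul_induction_on ha ?_ ?_
    · intro b hb c hc
      rw [← hmax] at hc
      have h1 := Module.mem_annihilator.1 hc (K.mkQ v)
      rw [← map_smul, Submodule.mkQ_apply, Submodule.Quotient.mk_eq_zero] at h1
      rw [mul_smul]
      exact congrArg Subtype.val (hn b hb ⟨_, h1⟩)
    · intro x y hx hy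
      rw [add_smul, hx, hy, add_zero]

end main



end
end LC


open CategoryTheory IsLocalRing

/-- **Corollary 4.3, second part.** Let `M` be a generalized Cohen-Macaulay module of
dimension `d` over a Noetherian local ring `(R, 𝔪)` with `𝔪^{n₀}·H^i_𝔪(M) = 0` for all
`i < d`. Then for every parameter ideal `𝔮 ⊆ 𝔪^{2n₀}` of `M`, the index of irreducibility
`N_R(𝔮, M) = dim_{R/𝔪} Soc(M/𝔮M)` is independent of `𝔮` and equals
`∑_{i=0}^{d} binom(d,i)·dim_{R/𝔪} Soc(H^i_𝔪(M))`. -/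
theorem index_of_irreducibility_parameter_ideal
    {R : Type} [CommRing R] [IsNoetherianRing R] [IsLocalRing R]
    (M : Type) [AddCommGroup M] [Module R M] [Module.Finite R M]
    (d : ℕ) (hd : 0 < d)
    (hdim : ringKrullDim (R ⧸ Module.annihilator R M) = (d : WithBot (WithTop ℕ)))
    (n₀ : ℕ) (hn₀ : 0 < n₀)
    (hann : ∀ i < d, (maximalIdeal R) ^ n₀ ≤ Module.annihilator R
      ((localCohomology (maximalIdeal R) i).obj (ModuleCat.of R M)))
    (𝔮 : Ideal R) (h𝔮 : 𝔮 ≤ (maximalIdeal R) ^ (2 * n₀))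
    (hpar : ∃ y : Fin d → R, (∀ i, y i ∈ maximalIdeal R) ∧
      𝔮 = Ideal.span (Set.range y) ∧
      IsFiniteLength R (M ⧸ (𝔮 • (⊤ : Submodule R M)))) :
    Module.finrank (R ⧸ maximalIdeal R)
        (Submodule.torsionBySet R (M ⧸ (𝔮 • (⊤ : Submodule R M)))
          ((maximalIdeal R : Ideal R) : Set R)) =
      ∑ i ∈ Finset.range (d + 1), d.choose i *
        Module.finrank (R ⧸ maximalIdeal R)
          (Submodule.torsionBySet R
            ((localCohomology (maximalIdeal R) i).obj (ModuleCat.of R M))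
            ((maximalIdeal R : Ideal R) : Set R)) := by
  obtain ⟨y, hy, rfl, hfl⟩ := hpar
  obtain ⟨N, hN⟩ := LC.finLen_kill hfl
  refine (LC.main_ind hn₀ N d M y (fun i => h𝔮 (Ideal.subset_span ⟨i, rfl⟩)) hN ?_).2
  intro j hj a ha z
  exact Module.mem_annihilator.1 (hann j hj ha) z
end
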